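/- (Even symmetry for the spherical Onsager vortex equation, planar form; Theorem 1.11.) Let β, γ ∈ ℝ with 8π < β ≤ 16π and 0 ≤ γ ≤ 3 − β/(8π) + √( 2 (3 − β/(8π)) (2 − β/(8π)) ). Define h : ℝ² → ℝ by h(x) = 8 (1 + |x|²)^{−2 + β/(4π)} · e^{γ·J(x)} with J(x) = 2/(1 + |x|²). Let w ∈ C²(ℝ²) satisfy Δw(x) + h(x) e^{w(x)} = 0 for all x ∈ ℝ², ∫_{ℝ²} h(x) e^{w(x)} dx = β, and suppose the function x ↦ w(x) + (β/(4π)) ln(1 + |x|²) is bounded on ℝ². Then there exists a unit vector e ∈ ℝ² such that w(x − 2⟨x, e⟩ e) = w(x) for all x ∈ ℝ², i.e. w is evenly symmetric with respect to a line through the origin. -/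

import Mathlib

open Real MeasureTheory Metric Filter Topology RealInnerProductSpace

noncomputable section

/-- The plane `ℝ²`. -/
abbrev Pl := EuclideanSpace ℝ (Fin 2)

/-- The Laplacian `Δu = ∂²u/∂x₁² + ∂²u/∂x₂²` of a function on `ℝ²`. -/
def lap (u : Pl → ℝ) (x : Pl) : ℝ :=
  ∑ i : Fin 2, fderiv ℝ (fun y => fderiv ℝ u y (EuclideanSpace.single i 1)) x
    (EuclideanSpace.single i 1)

namespace Ons

def dX (f : ℂ → ℝ) (z : ℂ) : ℝ := fderiv ℝ f z 1
def dY (f : ℂ → ℝ) (z : ℂ) : ℝ := fderiv ℝ f z Complex.I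
def lp (f : ℂ → ℝ) (z : ℂ) : ℝ := dX (dX f) z + dY (dY f) z
def gn2 (f : ℂ → ℝ) (z : ℂ) : ℝ := dX f z ^ 2 + dY f z ^ 2

/-- generic directional derivative -/
def dd (v : ℂ) (f : ℂ → ℝ) (z : ℂ) : ℝ := fderiv ℝ f z v

lemma dX_eq : dX = dd 1 := rfl
lemma dY_eq : dY = dd Complex.I := rfl

lemma dd_contDiffAt {n : ℕ} {v : ℂ} {f : ℂ → ℝ} {z : ℂ} (hf : ContDiffAt ℝ (n+1) f z) :
    ContDiffAt ℝ n (dd v f) z := by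
  have := hf.fderiv_right (m := n) (by norm_cast)
  exact this.clm_apply contDiffAt_const

lemma dd_contDiff {n : ℕ} {v : ℂ} {f : ℂ → ℝ} (hf : ContDiff ℝ (n+1) f) :
    ContDiff ℝ n (dd v f) := by
  rw [contDiff_iff_contDiffAt] at hf ⊢
  exact fun x => dd_contDiffAt (hf x)

lemma dd_add {v : ℂ} {f g : ℂ → ℝ} {z : ℂ} (hf : DifferentiableAt ℝ f z)
    (hg : DifferentiableAt ℝ g z) : dd v (fun x => f x + g x) z = dd v f z + dd v g z := by
  simp [dd, fderiv_fun_add hf hg]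

lemma dd_sub {v : ℂ} {f g : ℂ → ℝ} {z : ℂ} (hf : DifferentiableAt ℝ f z)
    (hg : DifferentiableAt ℝ g z) : dd v (fun x => f x - g x) z = dd v f z - dd v g z := by
  simp [dd, fderiv_fun_sub hf hg]

lemma dd_mul {v : ℂ} {f g : ℂ → ℝ} {z : ℂ} (hf : DifferentiableAt ℝ f z)
    (hg : DifferentiableAt ℝ g z) :
    dd v (fun x => f x * g x) z = f z * dd v g z + g z * dd v f z := by
  simp [dd, fderiv_fun_mul hf hg]

lemma dd_comp {v : ℂ} {f : ℂ → ℝ} {T : ℝ → ℝ} {T' : ℝ} {z : ℂ} (hf : DifferentiableAt ℝ f z)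
    (hT : HasDerivAt T T' (f z)) : dd v (fun x => T (f x)) z = T' * dd v f z := by
  have := (hT.comp_hasFDerivAt z hf.hasFDerivAt).fderiv
  unfold dd
  rw [show (fun x => T (f x)) = T ∘ f from rfl, this]; simp

lemma dd_const {v : ℂ} (c : ℝ) {z : ℂ} : dd v (fun _ => c) z = 0 := by
  simp [dd]

lemma dd_congr {v : ℂ} {f g : ℂ → ℝ} {z : ℂ} (h : f =ᶠ[𝓝 z] g) : dd v f z = dd v g z := by
  unfold dd; rw [h.fderiv_eq]

lemma dd_eventually_congr {v : ℂ} {f g : ℂ → ℝ} {z : ℂ} (h : f =ᶠ[𝓝 z] g) :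
    dd v f =ᶠ[𝓝 z] dd v g := by
  filter_upwards [h.eventuallyEq_nhds] with x hx using dd_congr hx

lemma dd2_add {v : ℂ} {f g : ℂ → ℝ} {z : ℂ} (hf : ContDiffAt ℝ 2 f z) (hg : ContDiffAt ℝ 2 g z) :
    dd v (dd v (fun x => f x + g x)) z = dd v (dd v f) z + dd v (dd v g) z := by
  have h1 : dd v (fun x => f x + g x) =ᶠ[𝓝 z] fun x => dd v f x + dd v g x := by
    filter_upwards [hf.eventually (by simp), hg.eventually (by simp)] with x hx hy
    exact dd_add (hx.differentiableAt (by simp)) (hy.differentiableAt (by simp))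
  rw [dd_congr h1, dd_add]
  · exact (dd_contDiffAt (n := 1) hf).differentiableAt (by simp)
  · exact (dd_contDiffAt (n := 1) hg).differentiableAt (by simp)

lemma dd2_mul {v : ℂ} {f g : ℂ → ℝ} {z : ℂ} (hf : ContDiffAt ℝ 2 f z) (hg : ContDiffAt ℝ 2 g z) :
    dd v (dd v (fun x => f x * g x)) z =
      f z * dd v (dd v g) z + g z * dd v (dd v f) z + 2 * (dd v f z * dd v g z) := by
  have h1 : dd v (fun x => f x * g x) =ᶠ[𝓝 z] fun x => f x * dd v g x + g x * dd v f x := by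
    filter_upwards [hf.eventually (by simp), hg.eventually (by simp)] with x hx hy
    exact dd_mul (hx.differentiableAt (by simp)) (hy.differentiableAt (by simp))
  have hf1 := hf.differentiableAt (by simp)
  have hg1 := hg.differentiableAt (by simp)
  have hf2 := (dd_contDiffAt (n := 1) (v := v) hf).differentiableAt (by simp)
  have hg2 := (dd_contDiffAt (n := 1) (v := v) hg).differentiableAt (by simp)
  rw [dd_congr h1, dd_add (hf1.fun_mul hg2) (hg1.fun_mul hf2), dd_mul hf1 hg2, dd_mul hg1 hf2]
  ring

lemma dd2_comp {v : ℂ} {f : ℂ → ℝ} {T T' : ℝ → ℝ} {T'' : ℝ} {z : ℂ} (hf : ContDiffAt ℝ 2 f z)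
    (hT : ∀ᶠ s in 𝓝 (f z), HasDerivAt T (T' s) s) (hT' : HasDerivAt T' T'' (f z)) :
    dd v (dd v (fun x => T (f x))) z = T' (f z) * dd v (dd v f) z + T'' * dd v f z ^ 2 := by
  have h1 : dd v (fun x => T (f x)) =ᶠ[𝓝 z] fun x => T' (f x) * dd v f x := by
    filter_upwards [hf.eventually (by simp), hf.continuousAt.eventually hT] with x hx hy
    exact dd_comp (hx.differentiableAt (by simp)) hy
  have hf1 := hf.differentiableAt (by simp)
  have hf2 := (dd_contDiffAt (n := 1) (v := v) hf).differentiableAt (by simp)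
  have h3 : DifferentiableAt ℝ (fun x => T' (f x)) z := hT'.differentiableAt.comp z hf1
  rw [dd_congr h1, dd_mul h3 hf2, dd_comp hf1 hT']
  ring

lemma lp_congr {f g : ℂ → ℝ} {z : ℂ} (h : f =ᶠ[𝓝 z] g) : lp f z = lp g z := by
  unfold lp; rw [dX_eq, dY_eq, dd_congr (dd_eventually_congr h), dd_congr (dd_eventually_congr h)]

lemma lp_add {f g : ℂ → ℝ} {z : ℂ} (hf : ContDiffAt ℝ 2 f z) (hg : ContDiffAt ℝ 2 g z) :
    lp (fun x => f x + g x) z = lp f z + lp g z := by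
  unfold lp; rw [dX_eq, dY_eq, dd2_add hf hg, dd2_add hf hg]; ring

lemma lp_mul {f g : ℂ → ℝ} {z : ℂ} (hf : ContDiffAt ℝ 2 f z) (hg : ContDiffAt ℝ 2 g z) :
    lp (fun x => f x * g x) z = f z * lp g z + g z * lp f z
      + 2 * (dX f z * dX g z + dY f z * dY g z) := by
  unfold lp; rw [dX_eq, dY_eq, dd2_mul hf hg, dd2_mul hf hg]; ring

lemma lp_const (c : ℝ) (z : ℂ) : lp (fun _ => c) z = 0 := by
  have : ∀ v, dd v (fun _ : ℂ => c) = fun _ => 0 := fun v => funext fun z => dd_const c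
  simp [lp, dX_eq, dY_eq, this, dd_const]

lemma lp_const_mul {f : ℂ → ℝ} {z : ℂ} (c : ℝ) (hf : ContDiffAt ℝ 2 f z) :
    lp (fun x => c * f x) z = c * lp f z := by
  rw [lp_mul contDiffAt_const hf, lp_const]
  simp [dX_eq, dY_eq, dd_const]

lemma lp_sub {f g : ℂ → ℝ} {z : ℂ} (hf : ContDiffAt ℝ 2 f z) (hg : ContDiffAt ℝ 2 g z) :
    lp (fun x => f x - g x) z = lp f z - lp g z := by
  have : (fun x => f x - g x) = fun x => f x + (-1) * g x := by ext; ring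
  rw [this, lp_add hf (contDiffAt_const.mul hg), lp_const_mul _ hg]; ring

lemma lp_comp {f : ℂ → ℝ} {T T' : ℝ → ℝ} {T'' : ℝ} {z : ℂ} (hf : ContDiffAt ℝ 2 f z)
    (hT : ∀ᶠ s in 𝓝 (f z), HasDerivAt T (T' s) s) (hT' : HasDerivAt T' T'' (f z)) :
    lp (fun x => T (f x)) z = T' (f z) * lp f z + T'' * gn2 f z := by
  unfold lp gn2; rw [dX_eq, dY_eq, dd2_comp hf hT hT', dd2_comp hf hT hT']; ring

lemma lp_continuous {f : ℂ → ℝ} (hf : ContDiff ℝ 2 f) : Continuous (lp f) := by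
  have h : ∀ v, Continuous (dd v (dd v f)) := fun v =>
    (dd_contDiff (n := 0) (dd_contDiff (n := 1) hf)).continuous
  exact (h _).add (h _)

lemma gn2_continuous {f : ℂ → ℝ} (hf : ContDiff ℝ 1 f) : Continuous (gn2 f) := by
  have h : ∀ v, Continuous (dd v f) := fun v => (dd_contDiff (n := 0) (by simpa using hf)).continuous
  exact ((h _).pow 2).add ((h _).pow 2)

lemma gn2_nonneg (f : ℂ → ℝ) (z : ℂ) : 0 ≤ gn2 f z := by unfold gn2; positivity

/-! local extrema -/
lemma deriv2_nonneg_of_min {g : ℝ → ℝ} {x : ℝ} (h : IsLocalMin g x) (hc : ContinuousAt g x) :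
    0 ≤ deriv (deriv g) x := by
  by_contra hn
  push Not at hn
  have h1 : IsLocalMax g x := isLocalMax_of_deriv_deriv_neg hn h.deriv_eq_zero hc
  have h2 : g =ᶠ[𝓝 x] fun _ => g x := by
    filter_upwards [h, h1] with y h3 h4 using le_antisymm h4 h3
  have h3 : deriv g =ᶠ[𝓝 x] fun _ => 0 := by
    filter_upwards [h2.eventuallyEq_nhds] with y hy
    rw [hy.deriv_eq]; simp
  rw [h3.deriv_eq] at hn
  simp at hn

lemma dd_eq_deriv {f : ℂ → ℝ} {z v : ℂ} (t : ℝ) (hf : DifferentiableAt ℝ f (z + t * v)) :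
    HasDerivAt (fun t : ℝ => f (z + t * v)) (dd v f (z + t * v)) t := by
  have h1 : HasDerivAt (fun t : ℝ => z + t * v) v t := by
    have := ((Complex.ofRealCLM.hasDerivAt (x := t)).mul_const v).const_add z
    simpa using this
  exact hf.hasFDerivAt.comp_hasDerivAt t h1

lemma dd2_nonneg_of_min {f : ℂ → ℝ} {z v : ℂ} (h : IsLocalMin f z) (hf : ContDiffAt ℝ 2 f z) :
    0 ≤ dd v (dd v f) z := by
  have hcont : ContinuousAt (fun t : ℝ => z + t * v) 0 := by fun_prop
  have e0 : z + ((0:ℝ):ℂ) * v = z := by simp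
  have hev : ∀ᶠ t : ℝ in 𝓝 0, ContDiffAt ℝ 2 f (z + t * v) := by
    apply hcont.eventually
    simpa using hf.eventually (by simp)
  have h1 : deriv (fun t : ℝ => f (z + t * v)) =ᶠ[𝓝 0] fun t : ℝ => dd v f (z + t * v) := by
    filter_upwards [hev] with t ht
    exact (dd_eq_deriv t (ht.differentiableAt (by simp))).deriv
  have h2 : deriv (deriv (fun t : ℝ => f (z + t * v))) 0 = dd v (dd v f) z := by
    rw [h1.deriv_eq]
    have := (dd_eq_deriv (f := dd v f) (z := z) (v := v) 0 (by
      rw [e0]; exact (dd_contDiffAt (n := 1) (v := v) hf).differentiableAt (by simp))).deriv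
    rw [this, e0]
  rw [← h2]
  apply deriv2_nonneg_of_min
  · have : Tendsto (fun t : ℝ => z + t * v) (𝓝 0) (𝓝 z) := by
      have := hcont.tendsto; rwa [e0] at this
    have := this.eventually h
    filter_upwards [this] with t ht
    simpa using ht
  · have : ContinuousAt f (z + ((0:ℝ):ℂ) * v) := by rw [e0]; exact hf.continuousAt
    exact ContinuousAt.comp (f := fun t : ℝ => z + t * v) this hcont

lemma lp_nonneg_of_min {f : ℂ → ℝ} {z : ℂ} (h : IsLocalMin f z) (hf : ContDiffAt ℝ 2 f z) :
    0 ≤ lp f z := add_nonneg (dd2_nonneg_of_min h hf) (dd2_nonneg_of_min h hf)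

lemma lp_nonpos_of_max {f : ℂ → ℝ} {z : ℂ} (h : IsLocalMax f z) (hf : ContDiffAt ℝ 2 f z) :
    lp f z ≤ 0 := by
  have h1 : IsLocalMin (fun x => (-1) * f x) z := by
    filter_upwards [h] with x hx
    linarith
  have := lp_nonneg_of_min h1 (contDiffAt_const.mul hf)
  rw [lp_const_mul _ hf] at this; linarith

/-! base functions -/
def ns (z : ℂ) : ℝ := z.re ^ 2 + z.im ^ 2

lemma ns_eq (z : ℂ) : ns z = ‖z‖ ^ 2 := by
  rw [← Complex.normSq_eq_norm_sq, Complex.normSq_apply]; unfold ns; ring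

lemma contDiff_re {n : WithTop ℕ∞} : ContDiff ℝ n (fun z : ℂ => z.re) := Complex.reCLM.contDiff
lemma contDiff_im {n : WithTop ℕ∞} : ContDiff ℝ n (fun z : ℂ => z.im) := Complex.imCLM.contDiff
lemma contDiff_ns {n : WithTop ℕ∞} : ContDiff ℝ n ns := (contDiff_re.pow 2).add (contDiff_im.pow 2)

lemma dd_re (v z : ℂ) : dd v (fun z => z.re) z = v.re := by
  unfold dd; rw [show (fun z : ℂ => z.re) = Complex.reCLM from rfl, ContinuousLinearMap.fderiv]; simp
lemma dd_im (v z : ℂ) : dd v (fun z => z.im) z = v.im := by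
  unfold dd; rw [show (fun z : ℂ => z.im) = Complex.imCLM from rfl, ContinuousLinearMap.fderiv]; simp
lemma dd_ns (v z : ℂ) : dd v ns z = 2 * (z.re * v.re + z.im * v.im) := by
  have : ns = fun z => z.re * z.re + z.im * z.im := by ext; unfold ns; ring
  have hr : DifferentiableAt ℝ (fun z : ℂ => z.re) z := contDiff_re.differentiable one_ne_zero z
  have hi : DifferentiableAt ℝ (fun z : ℂ => z.im) z := contDiff_im.differentiable one_ne_zero z
  rw [this, dd_add (hr.fun_mul hr) (hi.fun_mul hi), dd_mul hr hr, dd_mul hi hi, dd_re, dd_im]; ring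
lemma dX_ns (z : ℂ) : dX ns z = 2 * z.re := by rw [dX_eq, dd_ns]; simp
lemma dY_ns (z : ℂ) : dY ns z = 2 * z.im := by rw [dY_eq, dd_ns]; simp
lemma gn2_ns (z : ℂ) : gn2 ns z = 4 * ns z := by
  unfold gn2; rw [dX_ns, dY_ns]; unfold ns; ring
lemma dX_im (z : ℂ) : dX (fun z => z.im) z = 0 := by rw [dX_eq, dd_im]; simp
lemma dY_im (z : ℂ) : dY (fun z => z.im) z = 1 := by rw [dY_eq, dd_im]; simp
lemma lp_im (z : ℂ) : lp (fun z => z.im) z = 0 := by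
  unfold lp
  rw [show dX (fun z => z.im) = fun _ => 0 from funext dX_im,
    show dY (fun z => z.im) = fun _ => 1 from funext dY_im]
  simp [dX_eq, dY_eq, dd_const]
lemma lp_ns (z : ℂ) : lp ns z = 4 := by
  unfold lp
  have h1 : dX ns = fun z => 2 * z.re := funext dX_ns
  have h2 : dY ns = fun z => 2 * z.im := funext dY_ns
  have hr : DifferentiableAt ℝ (fun z : ℂ => z.re) z := contDiff_re.differentiable one_ne_zero z
  have hi : DifferentiableAt ℝ (fun z : ℂ => z.im) z := contDiff_im.differentiable one_ne_zero z
  rw [h1, h2, dX_eq, dY_eq, dd_mul (differentiableAt_const _) hr,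
    dd_mul (differentiableAt_const _) hi, dd_re, dd_im, dd_const, dd_const]
  simp; norm_num

/-- radial Laplacian -/
lemma lp_radial {g g' : ℝ → ℝ} {g'' : ℝ} {z : ℂ}
    (hT : ∀ᶠ s in 𝓝 (ns z), HasDerivAt g (g' s) s) (hT' : HasDerivAt g' g'' (ns z)) :
    lp (fun x => g (ns x)) z = 4 * (ns z * g'' + g' (ns z)) := by
  rw [lp_comp contDiff_ns.contDiffAt hT hT', lp_ns, gn2_ns]; ring

/-- translation and composition with linear isometries -/
lemma dd_comp_add {v : ℂ} (f : ℂ → ℝ) (a z : ℂ) : dd v (fun x => f (x + a)) z = dd v f (z + a) := by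
  unfold dd; rw [fderiv_comp_add_right]

lemma lp_comp_add (f : ℂ → ℝ) (a z : ℂ) : lp (fun x => f (x + a)) z = lp f (z + a) := by
  unfold lp; rw [dX_eq, dY_eq]
  have h : ∀ v, dd v (fun x => f (x + a)) = fun z => dd v f (z + a) := fun v =>
    funext fun z => dd_comp_add f a z
  rw [h, h, dd_comp_add (dd _ f), dd_comp_add (dd _ f)]

lemma lp_comp_sub (f : ℂ → ℝ) (a z : ℂ) : lp (fun x => f (x - a)) z = lp f (z - a) := by
  simpa [sub_eq_add_neg] using lp_comp_add f (-a) z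

lemma dd_comp_conj {v : ℂ} (f : ℂ → ℝ) (z : ℂ) :
    dd v (fun x => f ((starRingEnd ℂ) x)) z = dd ((starRingEnd ℂ) v) f ((starRingEnd ℂ) z) := by
  unfold dd
  have : (fun x => f ((starRingEnd ℂ) x)) = f ∘ Complex.conjCLE := rfl
  rw [this, ContinuousLinearEquiv.comp_right_fderiv]; simp

lemma dd_neg_dir {v : ℂ} (f : ℂ → ℝ) (z : ℂ) : dd (-v) f z = - dd v f z := by simp [dd]

lemma lp_comp_conj {f : ℂ → ℝ} {z : ℂ}  :
    lp (fun x => f ((starRingEnd ℂ) x)) z = lp f ((starRingEnd ℂ) z) := by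
  unfold lp; rw [dX_eq, dY_eq]
  have h : ∀ v, dd v (fun x => f ((starRingEnd ℂ) x))
      = fun z => dd ((starRingEnd ℂ) v) f ((starRingEnd ℂ) z) := fun v =>
    funext fun z => dd_comp_conj f z
  rw [h, h, dd_comp_conj (dd _ f), dd_comp_conj (dd _ f)]
  simp only [map_one, Complex.conj_I]
  congr 1
  have : dd (-Complex.I) f = fun z => - dd Complex.I f z := by
    ext z; rw [dd_neg_dir]
  rw [dd_neg_dir, this]
  unfold dd
  rw [fderiv_fun_neg]; simp

end Ons

namespace Ons

lemma dd_continuous {v : ℂ} {f : ℂ → ℝ} (hf : ContDiff ℝ 1 f) : Continuous (dd v f) :=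
  (dd_contDiff (n := 0) (by simpa using hf)).continuous

lemma dd_hasCompactSupport {v : ℂ} {f : ℂ → ℝ} (hf : HasCompactSupport f) :
    HasCompactSupport (dd v f) := hf.fderiv_apply ℝ v

lemma ibp {v : ℂ} {a ψ : ℂ → ℝ} (ha : ContDiff ℝ 1 a) (hψ : ContDiff ℝ 1 ψ)
    (hc : HasCompactSupport ψ) : ∫ z, a z * dd v ψ z = -∫ z, dd v a z * ψ z := by
  apply integral_mul_fderiv_eq_neg_fderiv_mul_of_integrable
  · exact ((dd_continuous ha).mul hψ.continuous).integrable_of_hasCompactSupport hc.mul_left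
  · exact (ha.continuous.mul (dd_continuous hψ)).integrable_of_hasCompactSupport
      (dd_hasCompactSupport hc).mul_left
  · exact (ha.continuous.mul hψ.continuous).integrable_of_hasCompactSupport hc.mul_left
  · exact fun x _ => ha.differentiable one_ne_zero x
  · exact fun x _ => hψ.differentiable one_ne_zero x

lemma green1 {ψ η : ℂ → ℝ} (hψ : ContDiff ℝ 1 ψ) (hc : HasCompactSupport ψ)
    (hη : ContDiff ℝ 2 η) :
    ∫ z, (dX ψ z * dX η z + dY ψ z * dY η z) = ∫ z, ψ z * (-lp η z) := by
  have key : ∀ v, ∫ z, dd v ψ z * dd v η z = -∫ z, dd v (dd v η) z * ψ z := by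
    intro v
    rw [← ibp (dd_contDiff (n := 1) hη) hψ hc]
    congr 1; ext z; ring
  have i1 : ∀ v, Integrable (fun z => dd v ψ z * dd v η z) := fun v =>
    ((dd_continuous hψ).mul (dd_continuous (hη.of_le (by norm_num)))).integrable_of_hasCompactSupport
      (dd_hasCompactSupport hc).mul_right
  have i2 : ∀ v, Integrable (fun z => dd v (dd v η) z * ψ z) := fun v =>
    ((dd_continuous (dd_contDiff (n := 1) hη)).mul hψ.continuous).integrable_of_hasCompactSupport
      hc.mul_left
  rw [dX_eq, dY_eq, integral_add (i1 _) (i1 _), key, key, ← neg_add,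
    ← integral_add (i2 _) (i2 _), ← integral_neg]
  congr 1; ext z; unfold lp; rw [dX_eq, dY_eq]; ring

lemma green2 {a b : ℂ → ℝ} (ha : ContDiff ℝ 2 a) (hb : ContDiff ℝ 2 b)
    (hc : HasCompactSupport b) : ∫ z, a z * lp b z = ∫ z, b z * lp a z := by
  have h1 := green1 (hb.of_le (by norm_num)) hc ha
  have key : ∀ v, ∫ z, a z * dd v (dd v b) z = -∫ z, dd v b z * dd v a z := by
    intro v
    rw [ibp (ha.of_le (by norm_num)) (dd_contDiff (n := 1) hb) (dd_hasCompactSupport hc)]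
    congr 2; ext z; ring
  have i1 : ∀ v, Integrable (fun z => dd v b z * dd v a z) := fun v =>
    ((dd_continuous (hb.of_le (by norm_num))).mul
      (dd_continuous (ha.of_le (by norm_num)))).integrable_of_hasCompactSupport
      (dd_hasCompactSupport hc).mul_right
  have i2 : ∀ v, Integrable (fun z => a z * dd v (dd v b) z) := fun v =>
    (ha.continuous.mul (dd_continuous (dd_contDiff (n := 1) hb))).integrable_of_hasCompactSupport
      (dd_hasCompactSupport (dd_hasCompactSupport hc)).mul_left
  have h2 : ∫ z, a z * lp b z = -∫ z, (dX b z * dX a z + dY b z * dY a z) := by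
    rw [dX_eq, dY_eq, integral_add (i1 _) (i1 _), neg_add, ← key, ← key, ← integral_add (i2 _) (i2 _)]
    congr 1; ext z; unfold lp; rw [dX_eq, dY_eq]; ring
  rw [h2, h1, ← integral_neg]
  congr 1; ext z; ring

/-- truncation profile -/
lemma exists_profile (s h H : ℝ) (hH : H < h) (h0 : 0 < h) :
    ∃ T T' : ℝ → ℝ, (∀ x, HasDerivAt T (T' x) x) ∧ Continuous T' ∧ (∀ x, 0 ≤ T' x) ∧
      (∀ x, T' x ≤ 1) ∧ (∀ x, x ≤ s → T' x = 0) ∧ (∀ x, s + h ≤ x → T' x = 0) ∧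
      (∀ x, x ≤ s → T x = 0) ∧ (∀ x, 0 ≤ T x) ∧ (∀ x, T x ≤ h) ∧ (∀ x, s + h ≤ x → H ≤ T x) := by
  wlog hpos : 0 < H generalizing H
  · obtain ⟨T, T', h1, h2, h3, h4, h5, h6, h7, h8, h9, h10⟩ :=
      this (h/2) (by linarith) (by linarith)
    exact ⟨T, T', h1, h2, h3, h4, h5, h6, h7, h8, h9, fun x hx => by
      have := h10 x hx; linarith⟩
  set κ := (h - H) / 2 with hκ
  have hκ0 : 0 < κ := by rw [hκ]; linarith
  set ρ : ℝ → ℝ := fun u => max 0 (min 1 (min (u - s) (s + h - u) / κ)) with hρ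
  have hρc : Continuous ρ := by rw [hρ]; fun_prop
  have hρ0 : ∀ x, 0 ≤ ρ x := fun x => le_max_left _ _
  have hρ1 : ∀ x, ρ x ≤ 1 := fun x => max_le zero_le_one (min_le_left _ _)
  have hρs : ∀ x, x ≤ s → ρ x = 0 := by
    intro x hx
    apply max_eq_left
    apply (min_le_right _ _).trans
    apply div_nonpos_of_nonpos_of_nonneg _ hκ0.le
    exact (min_le_left _ _).trans (by linarith)
  have hρh : ∀ x, s + h ≤ x → ρ x = 0 := by
    intro x hx
    apply max_eq_left
    apply (min_le_right _ _).trans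
    apply div_nonpos_of_nonpos_of_nonneg _ hκ0.le
    exact (min_le_right _ _).trans (by linarith)
  have hρm : ∀ x, s + κ ≤ x → x ≤ s + h - κ → 1 ≤ ρ x := by
    intro x hx hx'
    apply le_max_of_le_right
    apply le_min le_rfl
    rw [le_div_iff₀ hκ0, one_mul]
    exact le_min (by linarith) (by linarith)
  have hintg : ∀ a b, IntervalIntegrable ρ volume a b := fun a b => hρc.intervalIntegrable a b
  set T : ℝ → ℝ := fun x => ∫ u in s..x, ρ u with hT
  have hd : ∀ x, HasDerivAt T (ρ x) x := fun x =>
    intervalIntegral.integral_hasDerivAt_right (hintg _ _)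
      hρc.aestronglyMeasurable.stronglyMeasurableAtFilter hρc.continuousAt
  have hmono : Monotone T := monotone_of_deriv_nonneg (fun x => (hd x).differentiableAt)
    (fun x => by rw [(hd x).deriv]; exact hρ0 x)
  have hTs : ∀ x, x ≤ s → T x = 0 := by
    intro x hx
    apply intervalIntegral.integral_zero_ae
    refine Eventually.of_forall fun u hu => hρs u ?_
    rw [Set.uIoc_of_ge hx] at hu; exact hu.2
  have hT0 : ∀ x, 0 ≤ T x := by
    intro x
    rcases le_total x s with hx | hx
    · rw [hTs x hx]
    · rw [← hTs s le_rfl]; exact hmono hx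
  have hTh : ∀ x, s + h ≤ x → T x = T (s + h) := by
    intro x hx
    rw [hT]; dsimp only
    rw [← intervalIntegral.integral_add_adjacent_intervals (hintg s (s+h)) (hintg (s+h) x)]
    rw [add_eq_left]
    apply intervalIntegral.integral_zero_ae
    refine Eventually.of_forall fun u hu => hρh u ?_
    rw [Set.uIoc_of_le hx] at hu; exact hu.1.le
  have hTle : T (s + h) ≤ h := by
    have : ∫ u in s..(s+h), ρ u ≤ ∫ u in s..(s+h), (1:ℝ) :=
      intervalIntegral.integral_mono_on (by linarith) (hintg _ _) (by simp) (fun x _ => hρ1 x)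
    simpa using this
  have hTge : H ≤ T (s + h) := by
    have e1 : T (s + h) = (∫ u in s..(s+κ), ρ u) + (∫ u in (s+κ)..(s+h-κ), ρ u)
        + ∫ u in (s+h-κ)..(s+h), ρ u := by
      rw [intervalIntegral.integral_add_adjacent_intervals (hintg _ _) (hintg _ _),
        intervalIntegral.integral_add_adjacent_intervals (hintg _ _) (hintg _ _)]
    have e2 : 0 ≤ ∫ u in s..(s+κ), ρ u :=
      intervalIntegral.integral_nonneg (by linarith) (fun u _ => hρ0 u)
    have e3 : 0 ≤ ∫ u in (s+h-κ)..(s+h), ρ u :=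
      intervalIntegral.integral_nonneg (by linarith) (fun u _ => hρ0 u)
    have e4 : ∫ u in (s+κ)..(s+h-κ), (1:ℝ) ≤ ∫ u in (s+κ)..(s+h-κ), ρ u :=
      intervalIntegral.integral_mono_on (by linarith) (by simp) (hintg _ _)
        (fun x hx => hρm x hx.1 hx.2)
    simp at e4
    rw [e1]; linarith
  refine ⟨T, ρ, hd, hρc, hρ0, hρ1, hρs, hρh, hTs, hT0, ?_, ?_⟩
  · intro x
    rcases le_total x (s+h) with hx | hx
    · exact (hmono hx).trans hTle
    · rw [hTh x hx]; exact hTle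
  · intro x hx; rw [hTh x hx]; exact hTge

/-- plateau -/
lemma plateau {G : Set ℂ} (hG : IsOpen G) {η : ℂ → ℝ} (hη : ContDiff ℝ 1 η) {s : ℝ}
    (hK : IsCompact {z | z ∈ G ∧ s ≤ η z}) {T T' : ℝ → ℝ} (hT : ∀ x, HasDerivAt T (T' x) x)
    (hT' : Continuous T') (hs : ∀ x, x ≤ s → T x = 0) :
    ContDiff ℝ 1 (G.indicator (fun z => T (η z))) ∧
    HasCompactSupport (G.indicator (fun z => T (η z))) ∧
    ∀ v, dd v (G.indicator (fun z => T (η z))) = G.indicator (fun z => T' (η z) * dd v η z) := by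
  classical
  set K := {z | z ∈ G ∧ s ≤ η z} with hKd
  have hTC : ContDiff ℝ 1 T := by
    rw [contDiff_one_iff_deriv]
    refine ⟨fun x => (hT x).differentiableAt, ?_⟩
    have : deriv T = T' := funext fun x => (hT x).deriv
    rwa [this]
  have hz : ∀ z, z ∉ K → G.indicator (fun z => T (η z)) z = 0 := by
    intro z hz
    by_cases hzG : z ∈ G
    · rw [Set.indicator_of_mem hzG]
      apply hs
      by_contra hn
      exact hz ⟨hzG, (not_le.1 hn).le⟩
    · exact Set.indicator_of_notMem hzG _
  have h0 : ∀ z, z ∉ K → G.indicator (fun z => T (η z)) =ᶠ[𝓝 z] fun _ => 0 := by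
    intro z h
    filter_upwards [hK.isClosed.isOpen_compl.mem_nhds h] with x hx using hz x hx
  have h1 : ∀ z, z ∈ G → G.indicator (fun z => T (η z)) =ᶠ[𝓝 z] fun z => T (η z) := by
    intro z h
    filter_upwards [hG.mem_nhds h] with x hx using Set.indicator_of_mem hx _
  refine ⟨?_, ?_, ?_⟩
  · rw [contDiff_iff_contDiffAt]
    intro z
    by_cases h : z ∈ K
    · exact (hTC.comp hη).contDiffAt.congr_of_eventuallyEq (h1 z h.1)
    · exact contDiffAt_const.congr_of_eventuallyEq (h0 z h)
  · exact HasCompactSupport.intro hK hz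
  · intro v
    ext z
    by_cases h : z ∈ G
    · rw [Set.indicator_of_mem h, dd_congr (h1 z h),
        dd_comp (hη.differentiable one_ne_zero z) (hT _)]
    · rw [Set.indicator_of_notMem h, dd_congr (h0 z (fun hh => h hh.1)), dd_const]

lemma cauchy_schwarz {α : Type*} [MeasurableSpace α] {μ : Measure α} {f g : α → ℝ}
    (hf : Integrable (fun x => f x ^ 2) μ) (hg : Integrable (fun x => g x ^ 2) μ)
    (hfg : Integrable (fun x => f x * g x) μ) :
    (∫ x, f x * g x ∂μ) ^ 2 ≤ (∫ x, f x ^ 2 ∂μ) * ∫ x, g x ^ 2 ∂μ := by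
  have h : ∀ t : ℝ, 0 ≤ (∫ x, g x ^ 2 ∂μ) * (t * t) + (2 * ∫ x, f x * g x ∂μ) * t
      + ∫ x, f x ^ 2 ∂μ := by
    intro t
    have h0 : 0 ≤ ∫ x, (f x + t * g x) ^ 2 ∂μ := integral_nonneg fun x => sq_nonneg _
    have h1 : ∫ x, (f x + t * g x) ^ 2 ∂μ
        = ∫ x, (f x ^ 2 + ((2 * t) * (f x * g x) + (t*t) * g x ^ 2)) ∂μ := by
      congr 1; ext x; ring
    have i2 : Integrable (fun x => (2 * t) * (f x * g x) + (t*t) * g x ^ 2) μ :=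
      (hfg.const_mul _).add (hg.const_mul _)
    rw [h1, integral_add hf i2,
      integral_add (hfg.const_mul _) (hg.const_mul _), integral_const_mul, integral_const_mul] at h0
    linarith
  have := discrim_le_zero h
  unfold discrim at this
  nlinarith

end Ons

namespace Ons

def ker (δ : ℝ) (ζ : ℂ) : ℂ := (starRingEnd ℂ) ζ / ((ns ζ + δ ^ 2 : ℝ) : ℂ)

lemma ns_nonneg (z : ℂ) : 0 ≤ ns z := by unfold ns; positivity

lemma ker_den_pos {δ : ℝ} (hδ : 0 < δ) (ζ : ℂ) : 0 < ns ζ + δ ^ 2 := by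
  have := ns_nonneg ζ; positivity

lemma continuous_ns : Continuous ns := contDiff_ns (n := 0).continuous

lemma continuous_ker {δ : ℝ} (hδ : 0 < δ) : Continuous (ker δ) := by
  unfold ker
  refine Continuous.div Complex.continuous_conj ?_ ?_
  · exact Complex.continuous_ofReal.comp (continuous_ns.add continuous_const)
  · intro z
    exact_mod_cast (ker_den_pos hδ z).ne'

lemma ker_re (δ : ℝ) (ζ : ℂ) : (ker δ ζ).re = ζ.re / (ns ζ + δ ^ 2) := by
  unfold ker; rw [Complex.div_ofReal_re, Complex.conj_re]

lemma lint_inner {c l : ℝ} (hl : 0 < l) :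
    ∫⁻ r in Set.Ioi (0:ℝ), ENNReal.ofReal (max c 0 - l * r)
      ≤ ENNReal.ofReal ((max c 0) ^ 2 / (2 * l)) := by
  set d := max c 0 with hd
  have hd0 : 0 ≤ d := le_max_right _ _
  have h1 : ∀ r : ℝ, ENNReal.ofReal (d - l * r)
      = (Set.Iic (d / l)).indicator (fun r => ENNReal.ofReal (d - l * r)) r := by
    intro r
    by_cases h : r ≤ d / l
    · rw [Set.indicator_of_mem (by exact h)]
    · rw [Set.indicator_of_notMem (by exact h), ENNReal.ofReal_eq_zero]
      push Not at h
      rw [div_lt_iff₀ hl] at h; nlinarith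
  rw [lintegral_congr h1, lintegral_indicator measurableSet_Iic, Measure.restrict_restrict measurableSet_Iic,
    Set.inter_comm, Set.Ioi_inter_Iic]
  have hdl : 0 ≤ d / l := by positivity
  rw [← ofReal_integral_eq_lintegral_ofReal]
  · rw [← intervalIntegral.integral_of_le hdl]
    apply ENNReal.ofReal_le_ofReal
    rw [intervalIntegral.integral_sub (by simp) (by
      exact (continuous_const.mul continuous_id).intervalIntegrable _ _)]
    rw [intervalIntegral.integral_const_mul, integral_id, intervalIntegral.integral_const]
    apply le_of_eq; simp only [smul_eq_mul]; field_simp; ring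
  · have : Continuous fun r : ℝ => d - l * r := by fun_prop
    exact (this.integrableOn_Icc (a := 0) (b := d / l)).mono_set Set.Ioc_subset_Icc_self
  · refine (ae_restrict_iff' measurableSet_Ioc).2 (Eventually.of_forall fun r hr => ?_)
    have := hr.2
    rw [le_div_iff₀ hl] at this
    simp; nlinarith

lemma lint_cos {l : ℝ} (hl : 0 < l) :
    ∫⁻ θ in Set.Ioo (-π) π, ENNReal.ofReal ((max (cos θ) 0) ^ 2 / (2 * l))
      = ENNReal.ofReal (π / (4 * l)) := by
  have hcont : Continuous fun θ : ℝ => (max (cos θ) 0) ^ 2 / (2 * l) := by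
    apply Continuous.div_const; fun_prop
  rw [← ofReal_integral_eq_lintegral_ofReal]
  · congr 1
    have hpi := Real.pi_pos
    rw [← integral_Ioc_eq_integral_Ioo, ← intervalIntegral.integral_of_le (by linarith),
      intervalIntegral.integral_div]
    have hc : Continuous fun θ : ℝ => (max (cos θ) 0) ^ 2 := by fun_prop
    have hi : ∀ a b, IntervalIntegrable (fun θ : ℝ => (max (cos θ) 0) ^ 2) volume a b :=
      fun a b => hc.intervalIntegrable a b
    rw [← intervalIntegral.integral_add_adjacent_intervals (hi (-π) (-(π/2))) (hi _ π),
      ← intervalIntegral.integral_add_adjacent_intervals (hi (-(π/2)) (π/2)) (hi _ π)]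
    have e1 : ∫ θ in (-π)..(-(π/2)), (max (cos θ) 0) ^ 2 = 0 := by
      apply intervalIntegral.integral_zero_ae
      refine Eventually.of_forall fun θ hθ => ?_
      rw [Set.uIoc_of_le (by linarith)] at hθ
      have : cos θ ≤ 0 := by
        rw [← cos_neg]
        exact cos_nonpos_of_pi_div_two_le_of_le (by linarith [hθ.2]) (by linarith [hθ.1])
      rw [max_eq_right this]; simp
    have e3 : ∫ θ in (π/2)..π, (max (cos θ) 0) ^ 2 = 0 := by
      apply intervalIntegral.integral_zero_ae
      refine Eventually.of_forall fun θ hθ => ?_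
      rw [Set.uIoc_of_le (by linarith)] at hθ
      have : cos θ ≤ 0 :=
        cos_nonpos_of_pi_div_two_le_of_le (by linarith [hθ.1]) (by linarith [hθ.2])
      rw [max_eq_right this]; simp
    have e2 : ∫ θ in (-(π/2))..(π/2), (max (cos θ) 0) ^ 2 = π / 2 := by
      have : ∫ θ in (-(π/2))..(π/2), (max (cos θ) 0) ^ 2 = ∫ θ in (-(π/2))..(π/2), (cos θ) ^ 2 := by
        apply intervalIntegral.integral_congr
        intro θ hθ
        rw [Set.uIcc_of_le (by linarith)] at hθ
        have : 0 ≤ cos θ := cos_nonneg_of_mem_Icc hθ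
        dsimp only
        rw [max_eq_left this]
      rw [this, integral_cos_sq]; simp
    rw [e1, e2, e3]; field_simp; ring
  · exact (hcont.integrableOn_Icc (a := -π) (b := π)).mono_set Set.Ioo_subset_Icc_self
  · exact Eventually.of_forall fun θ => by positivity

lemma lint_ker {δ l : ℝ} (hδ : 0 < δ) (hl : 0 < l) :
    ∫⁻ ζ : ℂ, ENNReal.ofReal ((ker δ ζ).re - l) ≤ ENNReal.ofReal (π / (4 * l)) := by
  rw [← Complex.lintegral_comp_polarCoord_symm, polarCoord_target]
  have hm : Measurable fun p : ℝ × ℝ => ENNReal.ofReal (max (cos p.2) 0 - l * p.1) := by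
    fun_prop
  calc ∫⁻ p in Set.Ioi (0:ℝ) ×ˢ Set.Ioo (-π) π,
        ENNReal.ofReal p.1 • ENNReal.ofReal ((ker δ (Complex.polarCoord.symm p)).re - l)
      ≤ ∫⁻ p in Set.Ioi (0:ℝ) ×ˢ Set.Ioo (-π) π, ENNReal.ofReal (max (cos p.2) 0 - l * p.1) := by
        apply setLIntegral_mono hm
        rintro ⟨r, θ⟩ ⟨hr, hθ⟩
        have hr : 0 < r := hr
        rw [smul_eq_mul, ← ENNReal.ofReal_mul hr.le]
        apply ENNReal.ofReal_le_ofReal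
        rw [ker_re]
        have e1 : ns (Complex.polarCoord.symm (r, θ)) = r ^ 2 := by
          rw [ns_eq, Complex.norm_polarCoord_symm]; simp
        have e2 : (Complex.polarCoord.symm (r, θ)).re = r * cos θ := by
          rw [Complex.polarCoord_symm_apply]
          simp [Complex.cos_ofReal_re, Complex.sin_ofReal_im]
        rw [e1, e2]
        dsimp only
        rw [mul_sub, mul_comm l r]
        apply sub_le_sub_right
        have : r * (r * cos θ / (r ^ 2 + δ ^ 2)) = (r ^ 2 / (r ^ 2 + δ ^ 2)) * cos θ := by ring
        rw [this]
        have h1 : r ^ 2 / (r ^ 2 + δ ^ 2) ≤ 1 := by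
          rw [div_le_one (by positivity)]; nlinarith
        have h2 : 0 ≤ r ^ 2 / (r ^ 2 + δ ^ 2) := by positivity
        calc _ ≤ (r ^ 2 / (r ^ 2 + δ ^ 2)) * max (cos θ) 0 := by
              gcongr; exact le_max_left _ _
          _ ≤ 1 * max (cos θ) 0 := by gcongr; 
          _ = _ := one_mul _
    _ = ∫⁻ θ in Set.Ioo (-π) π, ∫⁻ r in Set.Ioi (0:ℝ), ENNReal.ofReal (max (cos θ) 0 - l * r) := by
        rw [Measure.volume_eq_prod, ← Measure.prod_restrict, lintegral_prod_symm _ hm.aemeasurable]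
    _ ≤ ∫⁻ θ in Set.Ioo (-π) π, ENNReal.ofReal ((max (cos θ) 0) ^ 2 / (2 * l)) :=
        lintegral_mono fun θ => lint_inner hl
    _ = _ := lint_cos hl

lemma ker_rot (δ : ℝ) {u : ℂ} (hu : ‖u‖ = 1) (ζ : ℂ) : u * ker δ (u * ζ) = ker δ ζ := by
  unfold ker
  have : ns (u * ζ) = ns ζ := by rw [ns_eq, ns_eq, norm_mul, hu, one_mul]
  rw [this, map_mul, ← mul_div_assoc, ← mul_assoc, Complex.mul_conj, Complex.normSq_eq_norm_sq, hu]
  simp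

/-- bathtub bound -/
lemma bathtub {δ : ℝ} (hδ : 0 < δ) (ξ : ℂ) {S : Set ℂ} (hS : IsCompact S)  :
    ‖∫ z in S, ker δ (ξ - z)‖ ≤ √(π * volume.real S) := by
  set I := ∫ z in S, ker δ (ξ - z) with hI
  have hfin : volume S ≠ ⊤ := hS.measure_lt_top.ne
  rcases eq_or_lt_of_le (measureReal_nonneg (μ := volume) (s := S)) with h0 | hpos
  · have : volume S = 0 := by
      rw [eq_comm, measureReal_def, ENNReal.toReal_eq_zero_iff] at h0
      exact h0.resolve_right hfin
    rw [hI, Measure.restrict_eq_zero.2 this]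
    simpa only [integral_zero_measure, norm_zero] using Real.sqrt_nonneg _
  set a := volume.real S with ha
  have hcont : Continuous fun z => ker δ (ξ - z) :=
    (continuous_ker hδ).comp (continuous_const.sub continuous_id)
  have hintg : IntegrableOn (fun z => ker δ (ξ - z)) S := hcont.continuousOn.integrableOn_compact hS
  obtain ⟨u, hu, huI⟩ : ∃ u : ℂ, ‖u‖ = 1 ∧ u * I = (‖I‖ : ℂ) := by
    by_cases h : I = 0
    · exact ⟨1, by simp, by simp [h]⟩
    · refine ⟨(starRingEnd ℂ) I / ‖I‖, ?_, ?_⟩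
      · rw [norm_div, RCLike.norm_conj]; simp [h]
      · rw [div_mul_eq_mul_div, mul_comm, Complex.mul_conj, Complex.normSq_eq_norm_sq]
        have : (‖I‖ : ℂ) ≠ 0 := by simpa using h
        push_cast; field_simp
  have e1 : ‖I‖ = ∫ z in S, (u * ker δ (ξ - z)).re := by
    have h1 : u * I = ∫ z in S, u * ker δ (ξ - z) := by rw [hI, integral_const_mul]
    have h2 : (u * I).re = ∫ z in S, (u * ker δ (ξ - z)).re := by
      rw [h1]
      exact (integral_re (hintg.const_mul u)).symm
    rw [← h2, huI]; simp
  set l := √(π / a) / 2 with hl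
  have hpi := Real.pi_pos
  have hl0 : 0 < l := by rw [hl]; positivity
  have hintr : IntegrableOn (fun z => (u * ker δ (ξ - z)).re) S :=
    (Complex.continuous_re.comp (continuous_const.mul hcont)).continuousOn.integrableOn_compact hS
  have e2 : ∫ z in S, ((u * ker δ (ξ - z)).re - l) ≤ π / (4 * l) := by
    have h1 : ∫ z in S, ((u * ker δ (ξ - z)).re - l)
        ≤ ∫ z in S, max ((u * ker δ (ξ - z)).re - l) 0 := by
      have hi : IntegrableOn (fun z => (u * ker δ (ξ - z)).re - l) S :=
        hintr.sub (integrableOn_const hfin)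
      exact integral_mono hi hi.pos_part (fun z => le_max_left _ _)
    refine h1.trans ?_
    rw [integral_eq_lintegral_of_nonneg_ae
      (f := fun z => max ((u * ker δ (ξ - z)).re - l) 0)
      (Eventually.of_forall fun z => le_max_right _ _)
      (by
        apply Continuous.aestronglyMeasurable
        exact ((Complex.continuous_re.comp (continuous_const.mul hcont)).sub continuous_const).max
          continuous_const)]
    apply ENNReal.toReal_le_of_le_ofReal (by positivity)
    calc ∫⁻ z in S, ENNReal.ofReal (max ((u * ker δ (ξ - z)).re - l) 0)
        ≤ ∫⁻ z : ℂ, ENNReal.ofReal (max ((u * ker δ (ξ - z)).re - l) 0) :=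
          setLIntegral_le_lintegral _ _
      _ = ∫⁻ z : ℂ, ENNReal.ofReal ((u * ker δ (ξ - z)).re - l) := by
          congr 1; ext z; rw [ENNReal.ofReal_max]; simp
      _ = ∫⁻ z : ℂ, ENNReal.ofReal ((u * ker δ z).re - l) :=
          lintegral_sub_left_eq_self (fun z => ENNReal.ofReal ((u * ker δ z).re - l)) ξ
      _ = ∫⁻ z : ℂ, ENNReal.ofReal ((u * ker δ (u * z)).re - l) := by
          have hu' : u ∈ Submonoid.unitSphere ℂ := by
            exact mem_sphere_zero_iff_norm.2 hu
          have hmp := (rotation (⟨u, hu'⟩ : Circle)).measurePreserving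
          have := hmp.lintegral_comp_emb
            (rotation (⟨u, hu'⟩ : Circle)).toHomeomorph.measurableEmbedding
            (fun z => ENNReal.ofReal ((u * ker δ z).re - l))
          rw [← this]
          rfl
      _ = ∫⁻ z : ℂ, ENNReal.ofReal ((ker δ z).re - l) := by simp_rw [ker_rot δ hu]
      _ ≤ _ := lint_ker hδ hl0
  rw [integral_sub hintr (integrableOn_const hfin), ← e1, setIntegral_const, smul_eq_mul] at e2
  have e3 : ‖I‖ ≤ a * l + π / (4 * l) := by linarith
  refine e3.trans (le_of_eq ?_)
  have hsa : √(π * a) = √(π/a) * a := by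
    have : π * a = (π / a) * a ^ 2 := by field_simp
    rw [this, Real.sqrt_mul (by positivity), Real.sqrt_sq hpos.le]
  rw [hsa]
  have hs2 : √(π / a) ^ 2 = π / a := Real.sq_sqrt (by positivity)
  have hsp : 0 < √(π / a) := by positivity
  have h3 : π = √(π / a) ^ 2 * a := by rw [hs2]; field_simp
  rw [hl]
  have : π / (4 * (√(π / a) / 2)) = √(π / a) * a / 2 := by
    rw [div_eq_iff (by positivity)]
    nlinarith
  rw [this]; ring

/-- mass of the kernel in a ball -/
lemma mass_ball {δ r : ℝ} (hδ : 0 < δ) (hr : 0 < r) (ξ : ℂ) :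
    ∫ z in closedBall ξ r, δ ^ 2 / (ns (ξ - z) + δ ^ 2) ^ 2 = π * (r ^ 2 / (r ^ 2 + δ ^ 2)) := by
  have h1 : ∫ z in closedBall ξ r, δ ^ 2 / (ns (ξ - z) + δ ^ 2) ^ 2
      = ∫ z : ℂ, (Set.Iic r).indicator (fun y => δ ^ 2 / (y ^ 2 + δ ^ 2) ^ 2) ‖ξ - z‖ := by
    rw [← integral_indicator measurableSet_closedBall]
    congr 1; ext z
    by_cases h : ‖ξ - z‖ ≤ r
    · rw [Set.indicator_of_mem (by rw [mem_closedBall, dist_comm, dist_eq_norm]; exact h),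
        Set.indicator_of_mem (by exact h), ns_eq]
    · rw [Set.indicator_of_notMem (by rw [mem_closedBall, dist_comm, dist_eq_norm]; exact h),
        Set.indicator_of_notMem (by exact h)]
  rw [h1, integral_sub_left_eq_self
    (fun z : ℂ => (Set.Iic r).indicator (fun y => δ ^ 2 / (y ^ 2 + δ ^ 2) ^ 2) ‖z‖),
    integral_fun_norm_addHaar]
  have hvol : volume.real (ball (0:ℂ) 1) = π := by
    rw [measureReal_def, Complex.volume_ball]; simp
  rw [Complex.finrank_real_complex, hvol]
  have h2 : ∫ y in Set.Ioi (0:ℝ), y ^ (2 - 1) •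
      (Set.Iic r).indicator (fun y => δ ^ 2 / (y ^ 2 + δ ^ 2) ^ 2) y
      = ∫ y in (0:ℝ)..r, y * (δ ^ 2 / (y ^ 2 + δ ^ 2) ^ 2) := by
    have : ∀ y : ℝ, y ^ (2 - 1) • (Set.Iic r).indicator (fun y => δ ^ 2 / (y ^ 2 + δ ^ 2) ^ 2) y
        = (Set.Iic r).indicator (fun y => y * (δ ^ 2 / (y ^ 2 + δ ^ 2) ^ 2)) y := by
      intro y
      by_cases h : y ∈ Set.Iic r
      · simp [Set.indicator_of_mem h]
      · simp [Set.indicator_of_notMem h]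
    simp_rw [this]
    rw [integral_indicator measurableSet_Iic, Measure.restrict_restrict measurableSet_Iic,
      Set.inter_comm, Set.Ioi_inter_Iic, intervalIntegral.integral_of_le hr.le]
  have h3 : ∫ y in (0:ℝ)..r, y * (δ ^ 2 / (y ^ 2 + δ ^ 2) ^ 2)
      = (-(δ ^ 2 / (2 * (r ^ 2 + δ ^ 2)))) - (-(δ ^ 2 / (2 * (0 ^ 2 + δ ^ 2)))) := by
    apply intervalIntegral.integral_eq_sub_of_hasDerivAt
      (f := fun y => -(δ ^ 2 / (2 * (y ^ 2 + δ ^ 2))))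
    · intro y _
      have hp : (y ^ 2 + δ ^ 2) ≠ 0 := by positivity
      have h4 : HasDerivAt (fun y : ℝ => 2 * (y ^ 2 + δ ^ 2)) (2 * (2 * y)) y := by
        have := ((hasDerivAt_pow 2 y).add_const (δ ^ 2)).const_mul 2
        simpa using this
      have h5 : HasDerivAt (fun y => -(δ ^ 2 / (2 * (y ^ 2 + δ ^ 2)))) _ y :=
        ((hasDerivAt_const y (δ ^ 2)).div h4 (by positivity)).neg
      refine h5.congr_deriv ?_
      field_simp; ring
    · apply Continuous.intervalIntegrable
      refine continuous_id.mul (continuous_const.div (by fun_prop) ?_)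
      intro y; positivity
  rw [h2, h3]
  simp only [nsmul_eq_mul, smul_eq_mul]
  field_simp
  ring

/-- area of the image -/
lemma area_image {Φ : ℂ → ℂ} (hΦ : Differentiable ℂ Φ) {E : Set ℂ} (hE : IsCompact E) :
    volume.real (Set.image Φ E) ≤ ∫ z in E, ‖deriv Φ z‖ ^ 2 := by
  have hd : ∀ x ∈ E, HasFDerivWithinAt Φ
      ((ContinuousLinearMap.toSpanSingleton ℂ (deriv Φ x)).restrictScalars ℝ) E x := by
    intro x _
    have := (hΦ x).hasDerivAt.hasFDerivAt.restrictScalars ℝ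
    exact this.hasFDerivWithinAt
  have h1 := addHaar_image_le_lintegral_abs_det_fderiv volume hE.measurableSet hd
  have hdet : ∀ x, |((ContinuousLinearMap.toSpanSingleton ℂ (deriv Φ x)).restrictScalars ℝ).det|
      = ‖deriv Φ x‖ ^ 2 := by
    intro x
    have : (((ContinuousLinearMap.toSpanSingleton ℂ (deriv Φ x)).restrictScalars ℝ)).det
        = Algebra.norm ℝ (deriv Φ x) := by
      rw [Algebra.norm_apply]
      unfold ContinuousLinearMap.det
      congr 1
      ext z
      simp [mul_comm]
    rw [this, Algebra.norm_complex_apply, Complex.normSq_eq_norm_sq, abs_of_nonneg (by positivity)]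
  simp_rw [hdet] at h1
  have hc : Continuous (deriv Φ) := (hΦ.contDiff (n := 1)).continuous_deriv le_rfl
  rw [← ofReal_integral_eq_lintegral_ofReal] at h1
  · rw [measureReal_def]
    exact ENNReal.toReal_le_of_le_ofReal (integral_nonneg fun _ => by positivity) h1
  · exact (hc.norm.pow 2).continuousOn.integrableOn_compact hE
  · exact Eventually.of_forall fun _ => by positivity

end Ons

namespace Ons

lemma ker_hasFDerivAt {δ : ℝ} (hδ : 0 < δ) (ζ : ℂ) :
    ∃ L : ℂ →L[ℝ] ℂ, HasFDerivAt (ker δ) L ζ ∧ ∀ a, L a =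
      (starRingEnd ℂ) a / ((ns ζ + δ ^ 2 : ℝ) : ℂ) - (starRingEnd ℂ) ζ *
        ((2 * (ζ.re * a.re + ζ.im * a.im) / (ns ζ + δ ^ 2) ^ 2 : ℝ) : ℂ) := by
  have hD := ker_den_pos hδ ζ
  have h1 : HasFDerivAt (fun z : ℂ => (starRingEnd ℂ) z) (Complex.conjCLE : ℂ →L[ℝ] ℂ) ζ :=
    Complex.conjCLE.hasFDerivAt
  have h0 : HasFDerivAt (fun z => ns z + δ ^ 2) (fderiv ℝ ns ζ) ζ :=
    ((contDiff_ns.differentiable one_ne_zero) ζ).hasFDerivAt.add_const _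
  have h2 : HasFDerivAt (fun z => (ns z + δ ^ 2)⁻¹) _ ζ :=
    (hasDerivAt_inv hD.ne').comp_hasFDerivAt ζ h0
  have h3 : HasFDerivAt (fun z => (((ns z + δ ^ 2)⁻¹ : ℝ) : ℂ)) _ ζ :=
    Complex.ofRealCLM.hasFDerivAt.comp ζ h2
  have h4 := h1.mul h3
  refine ⟨_, h4.congr_of_eventuallyEq (Eventually.of_forall fun z => ?_), fun a => ?_⟩
  · simp only [ker, Pi.mul_apply, Complex.ofReal_inv, div_eq_mul_inv]
  · have : fderiv ℝ ns ζ a = 2 * (ζ.re * a.re + ζ.im * a.im) := dd_ns a ζ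
    simp [this]
    field_simp
    ring

lemma contDiff_ker {δ : ℝ} (hδ : 0 < δ) : ContDiff ℝ 1 (ker δ) := by
  have h1 : ContDiff ℝ 1 (fun z : ℂ => (ns z + δ ^ 2)⁻¹) :=
    ((contDiff_ns.of_le le_top).add contDiff_const).inv fun z => (ker_den_pos hδ z).ne'
  have h2 : ContDiff ℝ 1 (fun z : ℂ => (((ns z + δ ^ 2)⁻¹ : ℝ) : ℂ)) :=
    Complex.ofRealCLM.contDiff.comp h1
  have h3 : ContDiff ℝ 1 (fun z : ℂ => (starRingEnd ℂ) z) := Complex.conjCLE.contDiff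
  have e : ker δ = fun z : ℂ => (starRingEnd ℂ) z * (((ns z + δ ^ 2)⁻¹ : ℝ) : ℂ) := by
    funext z
    simp only [ker, Complex.ofReal_inv, div_eq_mul_inv]
  rw [e]
  exact h3.mul h2

lemma dbar_F {δ : ℝ} (hδ : 0 < δ) {Φ : ℂ → ℂ} (hΦ : Differentiable ℂ Φ) (z x : ℂ) :
    fderiv ℝ (fun x => ker δ (Φ x - z) * deriv Φ x) x 1
      + Complex.I * fderiv ℝ (fun x => ker δ (Φ x - z) * deriv Φ x) x Complex.I
      = ((2 * ‖deriv Φ x‖ ^ 2 * (δ ^ 2 / (ns (Φ x - z) + δ ^ 2) ^ 2) : ℝ) : ℂ) := by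
  obtain ⟨L, hL, hLa⟩ := ker_hasFDerivAt hδ (Φ x - z)
  have hd : Differentiable ℂ (deriv Φ) := hΦ.deriv
  have h1 : HasFDerivAt (fun x => Φ x - z) _ x :=
    ((hΦ x).hasDerivAt.hasFDerivAt.restrictScalars ℝ).sub_const z
  have h2 := (hd x).hasDerivAt.hasFDerivAt.restrictScalars ℝ
  have h3 : HasFDerivAt (fun x => ker δ (Φ x - z) * deriv Φ x) _ x := (hL.comp x h1).mul h2
  rw [h3.fderiv]
  set p := deriv Φ x with hp
  set q := deriv (deriv Φ) x
  have hD := ker_den_pos hδ (Φ x - z)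
  set ζ := Φ x - z with hζ
  have e : ((ns ζ + δ ^ 2 : ℝ) : ℂ) ≠ 0 := by exact_mod_cast hD.ne'
  have hpp : ((‖p‖ ^ 2 : ℝ) : ℂ) = p * (starRingEnd ℂ) p := by
    rw [Complex.mul_conj, Complex.normSq_eq_norm_sq]
  have hrw : ((2 * ‖p‖ ^ 2 * (δ ^ 2 / (ns ζ + δ ^ 2) ^ 2) : ℝ) : ℂ)
      = 2 * (p * (starRingEnd ℂ) p) * ((δ ^ 2 : ℝ) / ((ns ζ + δ ^ 2 : ℝ) : ℂ) ^ 2) := by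
    rw [← hpp]; push_cast; ring
  rw [hrw]
  simp only [Function.comp, add_apply, smul_apply, ContinuousLinearMap.comp_apply,
    ContinuousLinearMap.coe_restrictScalars', ContinuousLinearMap.toSpanSingleton_apply, hLa,
    smul_eq_mul, one_mul, ContinuousLinearMap.smulRight_apply]
  generalize hDd : ns ζ + δ ^ 2 = D at *
  have hns : ns ζ = D - δ ^ 2 := by linarith
  have hI : (starRingEnd ℂ) (Complex.I * p) = - Complex.I * (starRingEnd ℂ) p := by simp
  rw [hI]
  have h5 : ((2 * (ζ.re * p.re + ζ.im * p.im) / D ^ 2 : ℝ) : ℂ)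
      + Complex.I * ((2 * (ζ.re * (Complex.I * p).re + ζ.im * (Complex.I * p).im) / D ^ 2 : ℝ) : ℂ)
      = 2 * (ζ * (starRingEnd ℂ) p) / (D:ℂ) ^ 2 := by
    apply Complex.ext
    · have : ((D:ℂ) ^ 2) = ((D ^ 2 : ℝ) : ℂ) := by push_cast; rfl
      rw [this, Complex.div_ofReal_re]
      simp [-Complex.ofReal_div]
    · have : ((D:ℂ) ^ 2) = ((D ^ 2 : ℝ) : ℂ) := by push_cast; rfl
      rw [this, Complex.div_ofReal_im]
      simp [-Complex.ofReal_div]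
  have h6 : ζ * (starRingEnd ℂ) ζ = (D : ℂ) - ((δ ^ 2 : ℝ) : ℂ) := by
    rw [Complex.mul_conj, Complex.normSq_eq_norm_sq, ← ns_eq, hns]; push_cast; ring
  have hII : Complex.I * Complex.I = -1 := Complex.I_mul_I
  have hm : ∀ (A B : ℂ), ker δ ζ * q + p * ((starRingEnd ℂ) p / (D:ℂ) - (starRingEnd ℂ) ζ * A)
      + Complex.I * (ker δ ζ * (Complex.I * q)
        + p * (-Complex.I * (starRingEnd ℂ) p / (D:ℂ) - (starRingEnd ℂ) ζ * B))
      = p * (2 * (starRingEnd ℂ) p / (D:ℂ) - (starRingEnd ℂ) ζ * (A + Complex.I * B)) := by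
    intro A B
    linear_combination (ker δ ζ * q - p * (starRingEnd ℂ) p / (D:ℂ)) * hII
  rw [hm, h5]
  have : (starRingEnd ℂ) ζ * (2 * (ζ * (starRingEnd ℂ) p) / (D:ℂ) ^ 2)
    = 2 * (ζ * (starRingEnd ℂ) ζ) * (starRingEnd ℂ) p / (D:ℂ) ^ 2 := by ring
  rw [this, h6]
  field_simp
  ring

lemma ibp_complex {v : ℂ} {ψ : ℂ → ℝ} {F : ℂ → ℂ} (hψ : ContDiff ℝ 1 ψ)
    (hc : HasCompactSupport ψ) (hF : ContDiff ℝ 1 F) :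
    ∫ x, dd v ψ x • F x = - ∫ x, ψ x • fderiv ℝ F x v := by
  have hF' : Continuous fun x => fderiv ℝ F x v :=
    (hF.continuous_fderiv one_ne_zero).clm_apply continuous_const
  have := integral_smul_fderiv_eq_neg_fderiv_smul_of_integrable (μ := (volume : Measure ℂ))
    (f := ψ) (g := F) (v := v)
    (((dd_continuous hψ).smul hF.continuous).integrable_of_hasCompactSupport
      (dd_hasCompactSupport hc).smul_right)
    ((hψ.continuous.smul hF').integrable_of_hasCompactSupport hc.smul_right)
    ((hψ.continuous.smul hF.continuous).integrable_of_hasCompactSupport hc.smul_right)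
    (fun x _ => hψ.differentiable one_ne_zero x)
    (fun x _ => hF.differentiable one_ne_zero x)
  rw [this, neg_neg]; rfl

lemma norm_grad (ψ : ℂ → ℝ) (x : ℂ) :
    ‖((dX ψ x : ℝ) : ℂ) + Complex.I * ((dY ψ x : ℝ) : ℂ)‖ = √(gn2 ψ x) := by
  rw [mul_comm, Complex.norm_add_mul_I]; rfl

/-- the kernel identity -/
lemma ker_identity {δ : ℝ} (hδ : 0 < δ) {Φ : ℂ → ℂ} (hΦ : Differentiable ℂ Φ) {ψ : ℂ → ℝ}
    (hψ : ContDiff ℝ 1 ψ) (hc : HasCompactSupport ψ) (z : ℂ) :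
    ∫ x, (((dX ψ x : ℝ) : ℂ) + Complex.I * ((dY ψ x : ℝ) : ℂ)) * (ker δ (Φ x - z) * deriv Φ x)
     = - ((∫ x, ψ x * (2 * ‖deriv Φ x‖ ^ 2 * (δ ^ 2 / (ns (Φ x - z) + δ ^ 2) ^ 2)) : ℝ) : ℂ) := by
  have hF : ContDiff ℝ 1 (fun x => ker δ (Φ x - z) * deriv Φ x) := by
    have h1 : ContDiff ℝ 1 Φ := (hΦ.contDiff (n := 1)).restrict_scalars ℝ
    have h2 : ContDiff ℝ 1 (deriv Φ) := (hΦ.deriv.contDiff (n := 1)).restrict_scalars ℝ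
    exact ((contDiff_ker hδ).comp (h1.sub contDiff_const)).mul h2
  set F := fun x => ker δ (Φ x - z) * deriv Φ x with hFd
  have hF' : ∀ v, Continuous fun x => fderiv ℝ F x v := fun v =>
    (hF.continuous_fderiv one_ne_zero).clm_apply continuous_const
  have i1 : ∀ v, Integrable fun x => dd v ψ x • F x := fun v =>
    ((dd_continuous hψ).smul hF.continuous).integrable_of_hasCompactSupport
      (dd_hasCompactSupport hc).smul_right
  have i2 : ∀ v, Integrable fun x => ψ x • fderiv ℝ F x v := fun v =>
    (hψ.continuous.smul (hF' v)).integrable_of_hasCompactSupport hc.smul_right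
  have e1 : ∫ x, (((dX ψ x : ℝ) : ℂ) + Complex.I * ((dY ψ x : ℝ) : ℂ)) * F x
      = (∫ x, dd 1 ψ x • F x) + Complex.I * ∫ x, dd Complex.I ψ x • F x := by
    rw [← integral_const_mul, ← integral_add (i1 _) ((i1 _).const_mul _)]
    congr 1; ext x; simp only [dX_eq, dY_eq, Complex.real_smul]; ring
  rw [e1, ibp_complex hψ hc hF, ibp_complex hψ hc hF, ← integral_complex_ofReal, mul_neg, ← neg_add,
    ← integral_const_mul, ← integral_add (i2 _) ((i2 _).const_mul _)]
  congr 2; ext x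
  have := dbar_F hδ hΦ z x
  rw [Complex.ofReal_mul, ← this]
  simp only [Complex.real_smul, hFd]; ring

/-- weak weighted isoperimetric inequality -/
lemma isop_aux {δ r : ℝ} (hδ : 0 < δ) (hr : 0 < r) {Φ : ℂ → ℂ} (hΦ : Differentiable ℂ Φ)
    {ψ : ℂ → ℝ} (hψ : ContDiff ℝ 1 ψ) (hc : HasCompactSupport ψ) (h0 : ∀ x, 0 ≤ ψ x)
    {E : Set ℂ} (hE : IsCompact E) {H : ℝ} (hH : 0 ≤ H) (hEH : ∀ x ∈ E, H ≤ ψ x) :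
    2 * π * (r ^ 2 / (r ^ 2 + δ ^ 2)) * H * (∫ x in E, ‖deriv Φ x‖ ^ 2)
      ≤ (∫ x, √(gn2 ψ x) * ‖deriv Φ x‖) * √(π * volume.real (cthickening r (Set.image Φ E))) := by
  have hΦc : Continuous Φ := hΦ.continuous
  have hΦ'c : Continuous (deriv Φ) := hΦ.deriv.continuous
  set S := cthickening r (Set.image Φ E) with hS
  have hSc : IsCompact S := (hE.image hΦc).cthickening
  set K := tsupport ψ with hK
  have hKc : IsCompact K := hc
  have hdsupp : ∀ v x, x ∉ K → dd v ψ x = 0 := by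
    intro v x hx
    have : ψ =ᶠ[𝓝 x] fun _ => 0 := notMem_tsupport_iff_eventuallyEq.1 hx
    rw [dd_congr this, dd_const]
  have hψsupp : ∀ x, x ∉ K → ψ x = 0 := fun x hx => image_eq_zero_of_notMem_tsupport hx
  set g : ℂ → ℂ := fun x => ((dX ψ x : ℝ) : ℂ) + Complex.I * ((dY ψ x : ℝ) : ℂ) with hg
  have hgc : Continuous g := (Complex.continuous_ofReal.comp (dd_continuous hψ)).add
    (continuous_const.mul (Complex.continuous_ofReal.comp (dd_continuous hψ)))
  have hgsupp : ∀ x, x ∉ K → g x = 0 := by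
    intro x hx; simp [hg, dX_eq, dY_eq, hdsupp _ x hx]
  have hkc := continuous_ker hδ
  -- complex Fubini
  set A : ℂ → ℂ → ℂ := fun z x => g x * (ker δ (Φ x - z) * deriv Φ x) with hA
  have hAc : Continuous (Function.uncurry A) := by
    rw [hA]; simp only [Function.uncurry_def]
    exact (hgc.comp continuous_snd).mul ((hkc.comp ((hΦc.comp continuous_snd).sub continuous_fst)).mul
      (hΦ'c.comp continuous_snd))
  set B : ℂ → ℂ → ℝ := fun z x =>
    ψ x * (2 * ‖deriv Φ x‖ ^ 2 * (δ ^ 2 / (ns (Φ x - z) + δ ^ 2) ^ 2)) with hB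
  have hBc : Continuous (Function.uncurry B) := by
    rw [hB]; simp only [Function.uncurry_def]
    refine (hψ.continuous.comp continuous_snd).mul ((continuous_const.mul
      ((hΦ'c.comp continuous_snd).norm.pow 2)).mul (continuous_const.div ?_ ?_))
    · exact ((continuous_ns.comp ((hΦc.comp continuous_snd).sub continuous_fst)).add
        continuous_const).pow 2
    · intro p
      have := ker_den_pos hδ (Φ p.2 - p.1)
      positivity
  have hAi : Integrable (Function.uncurry A) ((volume.restrict S).prod (volume.restrict K)) := by
    rw [Measure.prod_restrict]
    exact hAc.continuousOn.integrableOn_compact (hSc.prod hKc)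
  have hBi : Integrable (Function.uncurry B) ((volume.restrict S).prod (volume.restrict K)) := by
    rw [Measure.prod_restrict]
    exact hBc.continuousOn.integrableOn_compact (hSc.prod hKc)
  have hA1 : ∀ z, ∫ x in K, A z x = - ((∫ x in K, B z x : ℝ) : ℂ) := by
    intro z
    rw [setIntegral_eq_integral_of_forall_compl_eq_zero (fun x hx => by simp [hA, hgsupp x hx]),
      setIntegral_eq_integral_of_forall_compl_eq_zero (fun x hx => by simp [hB, hψsupp x hx])]
    exact ker_identity hδ hΦ hψ hc z
  have hswA := integral_integral_swap hAi
  have hswB := integral_integral_swap hBi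
  have e1 : ∫ x in K, ∫ z in S, A z x = - ((∫ x in K, ∫ z in S, B z x : ℝ) : ℂ) := by
    rw [← hswA, ← hswB, ← integral_complex_ofReal, ← integral_neg]
    exact integral_congr_ae (Eventually.of_forall fun z => hA1 z)
  -- upper bound
  have hgrad : Continuous fun x => √(gn2 ψ x) * ‖deriv Φ x‖ :=
    (gn2_continuous hψ).sqrt.mul hΦ'c.norm
  have hgradK : ∀ x, x ∉ K → √(gn2 ψ x) * ‖deriv Φ x‖ = 0 := by
    intro x hx; simp [gn2, dX_eq, dY_eq, hdsupp _ x hx]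
  have eU : ‖∫ x in K, ∫ z in S, A z x‖
      ≤ (∫ x, √(gn2 ψ x) * ‖deriv Φ x‖) * √(π * volume.real S) := by
    rw [← setIntegral_eq_integral_of_forall_compl_eq_zero hgradK, ← integral_mul_const]
    apply norm_integral_le_of_norm_le
    · exact (hgrad.mul continuous_const).continuousOn.integrableOn_compact hKc
    · refine Eventually.of_forall fun x => ?_
      have : ∫ z in S, A z x = (g x * deriv Φ x) * ∫ z in S, ker δ (Φ x - z) := by
        rw [← integral_const_mul]; congr 1; ext z; simp only [hA]; ring
      rw [this, norm_mul, norm_mul]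
      have hgx : ‖g x‖ = √(gn2 ψ x) := norm_grad ψ x
      rw [hgx]
      exact mul_le_mul_of_nonneg_left (bathtub hδ _ hSc) (by positivity)
  -- lower bound
  have hB0 : ∀ z x, 0 ≤ B z x := fun z x => by
    have := h0 x; simp only [hB]; positivity
  have eL : 2 * π * (r ^ 2 / (r ^ 2 + δ ^ 2)) * H * (∫ x in E, ‖deriv Φ x‖ ^ 2)
      ≤ ∫ x in K, ∫ z in S, B z x := by
    rcases eq_or_lt_of_le hH with hH0 | hHpos
    · rw [← hH0]; simp
      exact integral_nonneg fun x => integral_nonneg fun z => hB0 z x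
    have hEK : E ⊆ K := by
      intro x hx
      by_contra hn
      have := hEH x hx
      rw [hψsupp x hn] at this; linarith
    have hint2 : IntegrableOn (fun x => ∫ z in S, B z x) K := hBi.integral_prod_right
    calc _ ≤ ∫ x in E, ∫ z in S, B z x := by
          rw [← integral_const_mul]
          apply setIntegral_mono_on
          · exact (continuous_const.mul (hΦ'c.norm.pow 2)).continuousOn.integrableOn_compact hE
          · exact hint2.mono_set hEK
          · exact hE.measurableSet
          · intro x hx
            have hball : closedBall (Φ x) r ⊆ S :=
              closedBall_subset_cthickening (Set.mem_image_of_mem Φ hx) r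
            have hcz : Continuous fun z => δ ^ 2 / (ns (Φ x - z) + δ ^ 2) ^ 2 := by
              refine continuous_const.div ?_ ?_
              · exact ((continuous_ns.comp (continuous_const.sub continuous_id)).add
                  continuous_const).pow 2
              · intro z
                have := ker_den_pos hδ (Φ x - z)
                positivity
            have hm : π * (r ^ 2 / (r ^ 2 + δ ^ 2)) ≤ ∫ z in S, δ ^ 2 / (ns (Φ x - z) + δ ^ 2) ^ 2 := by
              rw [← mass_ball hδ hr (Φ x)]
              apply setIntegral_mono_set (hcz.continuousOn.integrableOn_compact hSc)
              · exact Eventually.of_forall fun z => by positivity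
              · exact hball.eventuallyLE
            have : ∫ z in S, B z x = ψ x * (2 * ‖deriv Φ x‖ ^ 2 *
                ∫ z in S, δ ^ 2 / (ns (Φ x - z) + δ ^ 2) ^ 2) := by
              rw [← integral_const_mul, ← integral_const_mul]
            rw [this]
            have hx1 := hEH x hx
            have hψx := h0 x
            have hpi := Real.pi_pos
            calc _ = H * (2 * ‖deriv Φ x‖ ^ 2 * (π * (r ^ 2 / (r ^ 2 + δ ^ 2)))) := by ring
              _ ≤ _ := by gcongr
      _ ≤ _ := by
          apply setIntegral_mono_set hint2
          · exact Eventually.of_forall fun x => integral_nonneg fun z => hB0 z x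
          · exact hEK.eventuallyLE
  refine eL.trans (le_trans ?_ eU)
  rw [e1, norm_neg, Complex.norm_real]
  exact le_abs_self _

theorem isop {Φ : ℂ → ℂ} (hΦ : Differentiable ℂ Φ)
    {ψ : ℂ → ℝ} (hψ : ContDiff ℝ 1 ψ) (hc : HasCompactSupport ψ) (h0 : ∀ x, 0 ≤ ψ x)
    {E : Set ℂ} (hE : IsCompact E) {H : ℝ} (hH : 0 ≤ H) (hEH : ∀ x ∈ E, H ≤ ψ x) :
    4 * π * H ^ 2 * (∫ x in E, ‖deriv Φ x‖ ^ 2) ≤ (∫ x, √(gn2 ψ x) * ‖deriv Φ x‖) ^ 2 := by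
  set a := ∫ x in E, ‖deriv Φ x‖ ^ 2 with ha
  set Λ := ∫ x, √(gn2 ψ x) * ‖deriv Φ x‖ with hΛ
  have ha0 : 0 ≤ a := integral_nonneg fun x => by positivity
  have hΛ0 : 0 ≤ Λ := integral_nonneg fun x => by positivity
  have hpi := Real.pi_pos
  have hlim : Tendsto (fun r : ℝ => volume.real (cthickening r (Set.image Φ E))) (𝓝[>] 0)
      (𝓝 (volume.real (Set.image Φ E))) := by
    have hEc := hE.image hΦ.continuous
    have := (tendsto_measure_cthickening_of_isCompact (μ := volume) hEc).mono_left
      (nhdsWithin_le_nhds (s := Set.Ioi 0))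
    exact (ENNReal.tendsto_toReal hEc.measure_lt_top.ne).comp this
  have hlimR : Tendsto (fun r : ℝ => Λ * √(π * volume.real (cthickening r (Set.image Φ E)))) (𝓝[>] 0)
      (𝓝 (Λ * √(π * volume.real (Set.image Φ E)))) :=
    ((Real.continuous_sqrt.tendsto _).comp (hlim.const_mul π)).const_mul Λ
  have hlimL : Tendsto (fun r : ℝ => 2 * π * (1 / (1 + r ^ 2)) * H * a) (𝓝[>] 0)
      (𝓝 (2 * π * (1 / (1 + 0 ^ 2)) * H * a)) := by
    have : Continuous fun r : ℝ => 2 * π * (1 / (1 + r ^ 2)) * H * a := by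
      refine ((continuous_const.mul (continuous_const.div (by fun_prop) ?_)).mul
        continuous_const).mul continuous_const
      intro r; positivity
    exact (this.tendsto 0).mono_left nhdsWithin_le_nhds
  have hle : 2 * π * (1 / (1 + 0 ^ 2)) * H * a ≤ Λ * √(π * volume.real (Set.image Φ E)) := by
    apply le_of_tendsto_of_tendsto hlimL hlimR
    filter_upwards [self_mem_nhdsWithin] with r hr
    have hr : 0 < r := hr
    have := isop_aux (δ := r ^ 2) (r := r) (by positivity) hr hΦ hψ hc h0 hE hH hEH
    have e : r ^ 2 / (r ^ 2 + (r ^ 2) ^ 2) = 1 / (1 + r ^ 2) := by field_simp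
    rwa [e] at this
  have hle2 : 2 * π * H * a ≤ Λ * √(π * a) := by
    have h1 : √(π * volume.real (Set.image Φ E)) ≤ √(π * a) :=
      Real.sqrt_le_sqrt (mul_le_mul_of_nonneg_left (area_image hΦ hE) hpi.le)
    have h2 := mul_le_mul_of_nonneg_left h1 hΛ0
    have e : (1:ℝ) / (1 + 0 ^ 2) = 1 := by norm_num
    rw [e, mul_one] at hle
    linarith
  rcases eq_or_lt_of_le ha0 with h | hapos
  · rw [← h]; simp; positivity
  have h3 : (2 * π * H * a) ^ 2 ≤ (Λ * √(π * a)) ^ 2 := by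
    apply pow_le_pow_left₀ (by positivity) hle2
  rw [mul_pow Λ, Real.sq_sqrt (by positivity)] at h3
  have h4 : (4 * π * H ^ 2 * a) * (π * a) ≤ Λ ^ 2 * (π * a) := by nlinarith
  exact le_of_mul_le_mul_right h4 (by positivity)

end Ons

namespace Ons

/-- superlevel set inside `G` -/
def sl (G : Set ℂ) (η : ℂ → ℝ) (s : ℝ) : Set ℂ := {z | z ∈ G ∧ s < η z}

lemma isOpen_sl {G : Set ℂ} (hG : IsOpen G) {η : ℂ → ℝ} (hη : Continuous η) (s : ℝ) :
    IsOpen (sl G η s) := hG.inter (isOpen_lt continuous_const hη)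

lemma sl_anti {G : Set ℂ} {η : ℂ → ℝ} {s s' : ℝ} (h : s ≤ s') : sl G η s' ⊆ sl G η s :=
  fun _ hz => ⟨hz.1, h.trans_lt hz.2⟩

lemma layer_aux {G : Set ℂ} (hG : IsOpen G) {η : ℂ → ℝ} (hη : ContDiff ℝ 2 η) {s h H : ℝ}
    (h0 : 0 < h) (hH : H < h) (hH0 : 0 ≤ H)
    (hK : IsCompact {z | z ∈ G ∧ s ≤ η z}) {R : ℂ → ℝ}
    (hR : IntegrableOn R (sl G η s)) (hR0 : ∀ z ∈ sl G η s, 0 ≤ R z)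
    (hlap : ∀ z ∈ sl G η s, -lp η z ≤ R z)
    {Φ : ℂ → ℂ} (hΦ : Differentiable ℂ Φ) :
    4 * π * H ^ 2 * (∫ z in sl G η (s + h), ‖deriv Φ z‖ ^ 2) ≤
      (h * ∫ z in sl G η s, R z) *
        ((∫ z in sl G η s, ‖deriv Φ z‖ ^ 2) - ∫ z in sl G η (s + h), ‖deriv Φ z‖ ^ 2) := by
  classical
  obtain ⟨T, T', hT, hT'c, hT'0, hT'1, hT's, hT'sh, hTs, hT0, hTh, hTH⟩ := exists_profile s h H hH h0
  have hη1 : ContDiff ℝ 1 η := hη.of_le (by norm_num)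
  obtain ⟨pC, pS, pD⟩ := plateau hG hη1 hK hT hT'c hTs
  set ψ := G.indicator (fun z => T (η z)) with hψ
  have hψ0 : ∀ x, 0 ≤ ψ x := fun x => Set.indicator_nonneg (fun z _ => hT0 _) x
  have hψh : ∀ x, ψ x ≤ h := fun x => by
    rw [hψ]; by_cases hx : x ∈ G
    · rw [Set.indicator_of_mem hx]; exact hTh _
    · rw [Set.indicator_of_notMem hx]; exact h0.le
  have hψz : ∀ x, x ∉ sl G η s → ψ x = 0 := fun x hx => by
    rw [hψ]; by_cases hxG : x ∈ G
    · rw [Set.indicator_of_mem hxG]; apply hTs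
      by_contra hh; exact hx ⟨hxG, not_le.1 hh⟩
    · rw [Set.indicator_of_notMem hxG]
  have hdc : Continuous (deriv Φ) := hΦ.deriv.continuous
  have hwc : Continuous (fun z => ‖deriv Φ z‖ ^ 2) := hdc.norm.pow 2
  set E := {z | z ∈ G ∧ s ≤ η z} ∩ {z | s + h ≤ η z} with hE
  have hEc : IsCompact E := hK.inter_right (isClosed_le continuous_const hη.continuous)
  have hiso := isop hΦ pC pS hψ0 hEc hH0 (fun x hx => by
    rw [hψ, Set.indicator_of_mem hx.1.1]; exact hTH _ hx.2)
  have hsub : sl G η s ⊆ {z | z ∈ G ∧ s ≤ η z} := fun z hz => ⟨hz.1, hz.2.le⟩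
  have hwi : IntegrableOn (fun z => ‖deriv Φ z‖ ^ 2) {z | z ∈ G ∧ s ≤ η z} :=
    hwc.continuousOn.integrableOn_compact hK
  have hm : ∀ s, MeasurableSet (sl G η s) := fun s => (isOpen_sl hG hη.continuous s).measurableSet
  have hAE : ∫ z in sl G η (s + h), ‖deriv Φ z‖ ^ 2 ≤ ∫ z in E, ‖deriv Φ z‖ ^ 2 := by
    apply setIntegral_mono_set (hwi.mono_set Set.inter_subset_left)
    · exact Eventually.of_forall fun z => by positivity
    · apply HasSubset.Subset.eventuallyLE
      intro z hz
      exact ⟨⟨hz.1, by have := hz.2; linarith⟩, hz.2.le⟩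
  set f : ℂ → ℝ := G.indicator (fun z => √(T' (η z)) * √(gn2 η z)) with hf
  set g : ℂ → ℝ := G.indicator (fun z => √(T' (η z)) * ‖deriv Φ z‖) with hg
  have hgn0 := gn2_nonneg
  have hfg : ∀ z, f z * g z = √(gn2 ψ z) * ‖deriv Φ z‖ := by
    intro z
    have e : gn2 ψ z = G.indicator (fun z => T' (η z) ^ 2 * gn2 η z) z := by
      have e1 : gn2 ψ z = (dd 1 ψ z) ^ 2 + (dd Complex.I ψ z) ^ 2 := rfl
      rw [e1, pD, pD]
      by_cases hx : z ∈ G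
      · simp only [Set.indicator_of_mem hx]
        have e2 : gn2 η z = (dd 1 η z) ^ 2 + (dd Complex.I η z) ^ 2 := rfl
        rw [e2]; ring
      · simp only [Set.indicator_of_notMem hx]; ring
    rw [e, hf, hg]
    by_cases hx : z ∈ G
    · simp only [Set.indicator_of_mem hx]
      rw [Real.sqrt_mul (sq_nonneg _), Real.sqrt_sq (hT'0 _)]
      have := Real.mul_self_sqrt (hT'0 (η z))
      calc _ = (√(T' (η z)) * √(T' (η z))) * √(gn2 η z) * ‖deriv Φ z‖ := by ring
        _ = _ := by rw [this]
    · simp only [Set.indicator_of_notMem hx]; simp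
  have hff : ∀ z, f z ^ 2 = dX ψ z * dX η z + dY ψ z * dY η z := by
    intro z
    rw [dX_eq, dY_eq, pD, pD, hf]
    by_cases hx : z ∈ G
    · simp only [Set.indicator_of_mem hx]
      rw [mul_pow, Real.sq_sqrt (hT'0 _), Real.sq_sqrt (gn2_nonneg _ _)]
      have e2 : gn2 η z = (dd 1 η z) ^ 2 + (dd Complex.I η z) ^ 2 := rfl
      rw [e2]; ring
    · simp only [Set.indicator_of_notMem hx]; ring
  have hgg : ∀ z, g z ^ 2 = G.indicator (fun z => T' (η z) * ‖deriv Φ z‖ ^ 2) z := by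
    intro z
    rw [hg]
    by_cases hx : z ∈ G
    · simp only [Set.indicator_of_mem hx]
      rw [mul_pow, Real.sq_sqrt (hT'0 _)]
    · simp only [Set.indicator_of_notMem hx]; ring
  set D := sl G η s \ sl G η (s + h) with hD
  have hDm : MeasurableSet D := (hm _).diff (hm _)
  have hgle : ∀ z, g z ^ 2 ≤ D.indicator (fun z => ‖deriv Φ z‖ ^ 2) z := by
    intro z
    rw [hgg]
    have hn : 0 ≤ ‖deriv Φ z‖ ^ 2 := by positivity
    by_cases hx : z ∈ G
    · simp only [Set.indicator_of_mem hx]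
      by_cases hz : z ∈ D
      · rw [Set.indicator_of_mem hz]
        nlinarith [hT'1 (η z)]
      · rw [Set.indicator_of_notMem hz]
        have : T' (η z) = 0 := by
          by_cases h1 : η z ≤ s
          · exact hT's _ h1
          · apply hT'sh
            by_contra h2
            exact hz ⟨⟨hx, not_le.1 h1⟩, fun h3 => by have := h3.2; linarith⟩
        rw [this]; simp
    · simp only [Set.indicator_of_notMem hx]
      exact Set.indicator_nonneg (fun z _ => by positivity) _
  have hDi : IntegrableOn (fun z => ‖deriv Φ z‖ ^ 2) D :=
    hwi.mono_set (Set.diff_subset.trans hsub)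
  have hgm : Measurable g := by
    rw [hg]
    apply Measurable.indicator _ hG.measurableSet
    exact ((Real.continuous_sqrt.comp (hT'c.comp hη.continuous)).mul hdc.norm).measurable
  have hgi : Integrable (fun z => g z ^ 2) := by
    refine Integrable.mono' (hDi.integrable_indicator hDm) (hgm.pow_const 2).aestronglyMeasurable ?_
    refine Eventually.of_forall fun z => ?_
    rw [Real.norm_of_nonneg (sq_nonneg _)]
    exact hgle z
  have hfi : Integrable (fun z => f z ^ 2) := by
    have e : (fun z => f z ^ 2) = fun z => dd 1 ψ z * dd 1 η z + dd Complex.I ψ z * dd Complex.I η z :=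
      funext hff
    rw [e]
    have i1 : ∀ v, Integrable (fun z => dd v ψ z * dd v η z) := fun v =>
      ((dd_continuous pC).mul (dd_continuous hη1)).integrable_of_hasCompactSupport
        (dd_hasCompactSupport pS).mul_right
    exact (i1 1).add (i1 Complex.I)
  have hfgi : Integrable (fun z => f z * g z) := by
    have hfm : Measurable f := by
      rw [hf]
      apply Measurable.indicator _ hG.measurableSet
      exact ((Real.continuous_sqrt.comp (hT'c.comp hη.continuous)).mul
        (Real.continuous_sqrt.comp (gn2_continuous hη1))).measurable
    refine Integrable.mono' (hfi.add hgi) (hfm.mul hgm).aestronglyMeasurable ?_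
    refine Eventually.of_forall fun z => ?_
    rw [Real.norm_eq_abs, abs_mul]
    show |f z| * |g z| ≤ f z ^ 2 + g z ^ 2
    nlinarith [sq_nonneg (|f z| - |g z|), sq_abs (f z), sq_abs (g z), sq_nonneg (f z), sq_nonneg (g z)]
  have hcs := cauchy_schwarz hfi hgi hfgi
  have e3 : ∫ z, f z * g z = ∫ z, √(gn2 ψ z) * ‖deriv Φ z‖ := by
    congr 1; exact funext hfg
  have e4 : ∫ z, f z ^ 2 = ∫ z, ψ z * (-lp η z) := by
    rw [← green1 pC pS hη]; congr 1; exact funext hff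
  have e5 : ∫ z, ψ z * (-lp η z) ≤ h * ∫ z in sl G η s, R z := by
    rw [← integral_const_mul, ← setIntegral_eq_integral_of_forall_compl_eq_zero
      (s := sl G η s) (fun z hz => by rw [hψz z hz, zero_mul])]
    apply setIntegral_mono_on _ (hR.const_mul h) (hm _)
    · intro z hz
      have := hlap z hz; have h2 := hR0 z hz; have h3 := hψ0 z; have h4 := hψh z
      calc ψ z * (-lp η z) ≤ ψ z * R z := mul_le_mul_of_nonneg_left this h3
        _ ≤ h * R z := mul_le_mul_of_nonneg_right h4 h2
    · exact ((pC.continuous.mul (lp_continuous hη).neg).integrable_of_hasCompactSupport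
        pS.mul_right).integrableOn
  have e6 : ∫ z, g z ^ 2 ≤ (∫ z in sl G η s, ‖deriv Φ z‖ ^ 2) - ∫ z in sl G η (s + h), ‖deriv Φ z‖ ^ 2 := by
    rw [← setIntegral_diff (hm _) (hwi.mono_set hsub) (sl_anti (by linarith)),
      ← integral_indicator hDm]
    exact integral_mono hgi (hDi.integrable_indicator hDm) hgle
  have hpi := Real.pi_pos
  calc _ ≤ 4 * π * H ^ 2 * (∫ z in E, ‖deriv Φ z‖ ^ 2) := by gcongr
    _ ≤ (∫ z, √(gn2 ψ z) * ‖deriv Φ z‖) ^ 2 := hiso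
    _ ≤ (∫ z, f z ^ 2) * ∫ z, g z ^ 2 := by rw [← e3]; exact hcs
    _ ≤ _ := by
      apply mul_le_mul (e4.trans_le e5) e6 (integral_nonneg fun z => sq_nonneg _)
      apply mul_nonneg h0.le
      exact setIntegral_nonneg (hm _) hR0

theorem layer {G : Set ℂ} (hG : IsOpen G) {η : ℂ → ℝ} (hη : ContDiff ℝ 2 η) {s h : ℝ}
    (h0 : 0 < h)
    (hK : IsCompact {z | z ∈ G ∧ s ≤ η z}) {R : ℂ → ℝ}
    (hR : IntegrableOn R (sl G η s)) (hR0 : ∀ z ∈ sl G η s, 0 ≤ R z)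
    (hlap : ∀ z ∈ sl G η s, -lp η z ≤ R z)
    {Φ : ℂ → ℂ} (hΦ : Differentiable ℂ Φ) :
    4 * π * h * (∫ z in sl G η (s + h), ‖deriv Φ z‖ ^ 2) ≤
      (∫ z in sl G η s, R z) *
        ((∫ z in sl G η s, ‖deriv Φ z‖ ^ 2) - ∫ z in sl G η (s + h), ‖deriv Φ z‖ ^ 2) := by
  set a := ∫ z in sl G η (s + h), ‖deriv Φ z‖ ^ 2
  have hlim : Tendsto (fun H : ℝ => 4 * π * H ^ 2 * a) (𝓝[<] h) (𝓝 (4 * π * h ^ 2 * a)) := by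
    have : Continuous fun H : ℝ => 4 * π * H ^ 2 * a := by fun_prop
    exact (this.tendsto h).mono_left nhdsWithin_le_nhds
  have hle := le_of_tendsto hlim (b := (h * ∫ z in sl G η s, R z) *
        ((∫ z in sl G η s, ‖deriv Φ z‖ ^ 2) - a)) (by
    have : Set.Ioo 0 h ∈ 𝓝[<] h := Ioo_mem_nhdsLT h0
    filter_upwards [this] with H hH
    exact layer_aux hG hη h0 hH.2 hH.1.le hK hR hR0 hlap hΦ)
  have : h * (4 * π * h * a) ≤ h * ((∫ z in sl G η s, R z) *
        ((∫ z in sl G η s, ‖deriv Φ z‖ ^ 2) - a)) := by linarith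
  exact le_of_mul_le_mul_left this h0

end Ons

namespace Ons

lemma ode_sum {N A : ℝ → ℝ} {s0 s1 ν C h0 : ℝ} (hs : s0 < s1) (h00 : 0 < h0)
    (H : ∀ s h, s0 ≤ s → s + h ≤ s1 → 0 < h → h ≤ h0 →
      N (s + h) - N s ≤ -ν * h + C * (h ^ 2 + √h * (A s - A (s + h)))) :
    N s1 - N s0 ≤ -ν * (s1 - s0) := by
  set L := s1 - s0 with hL
  have hL0 : 0 < L := by rw [hL]; linarith
  have hlim : Tendsto (fun n : ℕ => L / (n : ℝ)) atTop (𝓝 0) :=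
    tendsto_const_div_atTop_nhds_zero_nat L
  have hlim2 : Tendsto (fun n : ℕ => -ν * L + C * (L * (L / (n:ℝ)) + √(L / (n:ℝ)) * (A s0 - A s1)))
      atTop (𝓝 (-ν * L + C * (L * 0 + √0 * (A s0 - A s1)))) := by
    have := ((Real.continuous_sqrt.tendsto _).comp hlim)
    exact ((((hlim.const_mul L).add (this.mul_const _)).const_mul C).const_add _)
  have hle := ge_of_tendsto hlim2 (b := N s1 - N s0) (by
    have h1 : ∀ᶠ n : ℕ in atTop, L / (n : ℝ) ≤ h0 := by
      filter_upwards [hlim.eventually (gt_mem_nhds h00)] with n hn using le_of_lt hn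
    filter_upwards [h1, eventually_gt_atTop 0] with n hn hn0
    have hnpos : (0:ℝ) < n := by exact_mod_cast hn0
    set h := L / (n:ℝ) with hh
    have hpos : 0 < h := by positivity
    have hnh : (n:ℝ) * h = L := by rw [hh]; field_simp
    have key : ∀ k : ℕ, k ≤ n → N (s0 + k * h) - N s0 ≤
        -ν * (k * h) + C * (k * h * h + √h * (A s0 - A (s0 + k * h))) := by
      intro k
      induction k with
      | zero => intro _; simp
      | succ k ih =>
        intro hk
        have i1 := ih (by omega)
        have hkn : ((k:ℝ) + 1) ≤ n := by exact_mod_cast hk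
        have i2 := H (s0 + k * h) h (by have : 0 ≤ (k:ℝ) * h := by positivity
                                        linarith) (by nlinarith) hpos hn
        have e : s0 + ((k+1 : ℕ):ℝ) * h = s0 + k * h + h := by push_cast; ring
        rw [e]; push_cast
        nlinarith
    have := key n le_rfl
    rw [hnh] at this
    have e : s0 + L = s1 := by rw [hL]; ring
    rw [e] at this
    linarith)
  simpa using hle

lemma exp_bd {h : ℝ} (h0 : 0 ≤ h) (h1 : h ≤ 1) : h ≤ exp h - 1 ∧ exp h - 1 ≤ h + h ^ 2 := by
  constructor
  · linarith [Real.add_one_le_exp h]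
  · have := Real.abs_exp_sub_one_sub_id_le (x := h) (by rw [abs_of_nonneg h0]; exact h1)
    linarith [(abs_le.1 this).2]

set_option maxHeartbeats 2000000 in
lemma ode_step {a a' b b' t h α κ c ς ν M : ℝ} (hM : 1 ≤ M) (ha' : 0 ≤ a') (haa : a' ≤ a)
    (ha : a ≤ M) (hb' : 0 ≤ b') (hbb : b' ≤ b) (hb : b ≤ M) (h0 : 0 < h) (h1 : h ≤ 1)
    (ht : 0 ≤ t) (htM : exp t ≤ M) (hα : |α| ≤ M) (hκ : |κ| ≤ M) (hc : |c| ≤ M) (hς : |ς| ≤ M)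
    (hν : 0 ≤ ν) (hνM : ν ≤ M)
    (hlo : exp t * (a - a') ≤ b - b') (hhi : b - b' ≤ exp (t + h) * (a - a'))
    (hD : 0 ≤ (α - c) - κ * (a + a') + ς * (b + b'))
    (hJ : h * (α * a' - κ * a' ^ 2 + ν) - M * h ^ 2 ≤ (a - a') * ((α - c) - 2 * κ * a + 2 * ς * b)) :
    (exp (t + h) * (α * a' - κ * a' ^ 2) - b' * (c - ς * b'))
      - (exp t * (α * a - κ * a ^ 2) - b * (c - ς * b))
    ≤ -ν * h + 30 * M ^ 4 * (h ^ 2 + √h * (a - a')) := by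
  obtain ⟨e1, e2⟩ := exp_bd h0.le h1
  set δ := a - a' with hδ
  have hδ0 : 0 ≤ δ := by rw [hδ]; linarith
  set e := exp t with he
  have he1 : 1 ≤ e := by rw [he]; exact Real.one_le_exp ht
  set J := α * a' - κ * a' ^ 2 with hJd
  have hM2 : M ≤ M ^ 2 := by nlinarith
  have hM3 : M ^ 2 ≤ M ^ 3 := by nlinarith [sq_nonneg M]
  have hM4 : M ^ 3 ≤ M ^ 4 := by nlinarith [pow_pos (by linarith : 0 < M) 3]
  have ha'M : a' ≤ M := by linarith
  have hJb : |J| ≤ 2 * M ^ 3 := by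
    calc |J| ≤ |α * a'| + |κ * a' ^ 2| := abs_sub _ _
      _ = |α| * a' + |κ| * a' ^ 2 := by rw [abs_mul, abs_mul, abs_of_nonneg ha', abs_of_nonneg (sq_nonneg a')]
      _ ≤ M * M + M * M ^ 2 := by gcongr
      _ = M ^ 2 + M ^ 3 := by ring
      _ ≤ 2 * M ^ 3 := by linarith
  rw [Real.exp_add] at hhi ⊢
  rw [← he] at hhi ⊢
  set E := exp h - 1 with hE
  have hEe : exp h = 1 + E := by rw [hE]; ring
  rw [hEe] at hhi ⊢
  set D := (α - c) - κ * (a + a') + ς * (b + b') with hDd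
  set r := (b - b') - e * δ with hr
  have hr0 : 0 ≤ r := by rw [hr]; linarith
  have hhh : h ^ 2 ≤ h := by rw [sq]; exact mul_le_of_le_one_left h0.le h1
  have hE2 : E ≤ 2 * h := by linarith
  have hr1 : r ≤ 2 * M * (h * δ) := by
    have : r ≤ e * E * δ := by rw [hr]; linarith
    calc r ≤ e * E * δ := this
      _ ≤ M * (2 * h) * δ := by gcongr; linarith
      _ = _ := by ring
  have hcb : c - ς * (b + b') ≤ 3 * M ^ 2 := by
    have h2 : |ς * (b + b')| ≤ M * (2 * M) := by
      rw [abs_mul, abs_of_nonneg (by linarith : 0 ≤ b + b')]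
      exact mul_le_mul hς (by linarith) (by linarith) (by linarith)
    have k1 := (abs_le.1 hc).2
    have k2 := (abs_le.1 h2).1
    have k3 : M * (2 * M) = 2 * M ^ 2 := by ring
    linarith
  have hmain : (e * (1 + E) * J - b' * (c - ς * b')) - (e * (α * a - κ * a ^ 2) - b * (c - ς * b))
      = e * (E * J - δ * D) + r * (c - ς * (b + b')) := by
    rw [hr, hDd, hJd, hδ]; ring
  rw [hmain]
  have hrt : r * (c - ς * (b + b')) ≤ 6 * M ^ 3 * (h * δ) := by
    calc _ ≤ r * (3 * M ^ 2) := mul_le_mul_of_nonneg_left hcb hr0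
      _ ≤ (2 * M * (h * δ)) * (3 * M ^ 2) := by gcongr
      _ = _ := by ring
  have hsq : h ≤ √h := by
    rw [Real.le_sqrt' h0]; exact hhh
  have hsq2 : √h * √h = h := Real.mul_self_sqrt h0.le
  have hhd : h * δ ≤ √h * δ := mul_le_mul_of_nonneg_right hsq hδ0
  have hs0 : 0 ≤ √h := Real.sqrt_nonneg _
  have hsd : 0 ≤ √h * δ := by positivity
  have hEJ : E * J ≤ h * J + h ^ 2 * (2 * M ^ 3) := by
    have h3 : (E - h) * J ≤ h ^ 2 * (2 * M ^ 3) := by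
      calc (E - h) * J ≤ (E - h) * |J| := mul_le_mul_of_nonneg_left (le_abs_self _) (by linarith)
        _ ≤ h ^ 2 * (2 * M ^ 3) := by gcongr; linarith
    linarith
  rcases le_total δ (√h) with hc1 | hc1
  · have hdd : δ ^ 2 ≤ √h * δ := by rw [sq]; exact mul_le_mul_of_nonneg_right hc1 hδ0
    have hdiff : δ * ((α - c) - 2 * κ * a + 2 * ς * b) - δ * D ≤ 4 * M ^ 2 * δ ^ 2 := by
      have : δ * ((α - c) - 2 * κ * a + 2 * ς * b) - δ * D = δ * (-κ * δ + ς * (b - b')) := by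
        rw [hDd, hδ]; ring
      rw [this]
      have k1 : -κ * δ ≤ M * δ := by
        have := (abs_le.1 hκ).1
        exact mul_le_mul_of_nonneg_right (by linarith) hδ0
      have k2 : ς * (b - b') ≤ M * (3 * M * δ) := by
        have h5 : b - b' ≤ 3 * M * δ := by
          calc b - b' ≤ e * (1 + E) * δ := hhi
            _ ≤ M * 3 * δ := mul_le_mul_of_nonneg_right
                (mul_le_mul htM (by linarith) (by linarith) (by linarith)) hδ0
            _ = _ := by ring
        calc ς * (b - b') ≤ |ς| * (b - b') := mul_le_mul_of_nonneg_right (le_abs_self _) (by linarith)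
          _ ≤ M * (3 * M * δ) := by gcongr
      have k3 : M * δ ≤ M ^ 2 * δ := mul_le_mul_of_nonneg_right hM2 hδ0
      have k4 : -κ * δ + ς * (b - b') ≤ 4 * M ^ 2 * δ := by linarith
      calc _ ≤ δ * (4 * M ^ 2 * δ) := mul_le_mul_of_nonneg_left k4 hδ0
        _ = _ := by ring
    have hX : E * J - δ * D ≤ - (h * ν) + 3 * M ^ 3 * h ^ 2 + 4 * M ^ 2 * (√h * δ) := by
      have k1 : M ^ 2 * δ ^ 2 ≤ M ^ 2 * (√h * δ) := mul_le_mul_of_nonneg_left hdd (sq_nonneg M)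
      have k2 : M * h ^ 2 ≤ M ^ 3 * h ^ 2 :=
        mul_le_mul_of_nonneg_right (by linarith) (sq_nonneg h)
      linarith
    have hY : e * (E * J - δ * D) ≤ - (h * ν) + M * (3 * M ^ 3 * h ^ 2 + 4 * M ^ 2 * (√h * δ)) := by
      have k0 : 0 ≤ 3 * M ^ 3 * h ^ 2 + 4 * M ^ 2 * (√h * δ) := by positivity
      have k1 : 0 ≤ h * ν := by positivity
      calc e * (E * J - δ * D) ≤ e * (- (h * ν) + (3 * M ^ 3 * h ^ 2 + 4 * M ^ 2 * (√h * δ))) :=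
            mul_le_mul_of_nonneg_left (by linarith) (by linarith)
        _ = - (e * (h * ν)) + e * (3 * M ^ 3 * h ^ 2 + 4 * M ^ 2 * (√h * δ)) := by ring
        _ ≤ _ := by
          have k2 := mul_le_mul_of_nonneg_right htM k0
          have k3 := le_mul_of_one_le_left k1 he1
          linarith
    have p1 : M ^ 3 * (h * δ) ≤ M ^ 4 * (√h * δ) := by gcongr
    have p2 : M ^ 3 * (√h * δ) ≤ M ^ 4 * (√h * δ) := by gcongr
    have p3 : 0 ≤ M ^ 4 * h ^ 2 := by positivity
    have p4 : 0 ≤ M ^ 4 * (√h * δ) := by positivity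
    linarith
  · have hh : h ≤ √h * δ := by
      calc h = √h * √h := hsq2.symm
        _ ≤ _ := mul_le_mul_of_nonneg_left hc1 hs0
    have hX : E * J - δ * D ≤ 4 * M ^ 3 * h := by
      have : E * J ≤ (2 * h) * (2 * M ^ 3) := by
        calc E * J ≤ E * |J| := mul_le_mul_of_nonneg_left (le_abs_self _) (by linarith)
          _ ≤ _ := by gcongr
      have := mul_nonneg hδ0 hD
      linarith
    have hY : e * (E * J - δ * D) ≤ M * (4 * M ^ 3 * h) := by
      calc e * (E * J - δ * D) ≤ e * (4 * M ^ 3 * h) := mul_le_mul_of_nonneg_left hX (by linarith)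
        _ ≤ _ := by gcongr
    have p1 : M ^ 3 * (h * δ) ≤ M ^ 4 * (√h * δ) := by gcongr
    have p2 : M ^ 4 * h ≤ M ^ 4 * (√h * δ) := by gcongr
    have p3 : 0 ≤ M ^ 4 * h ^ 2 := by positivity
    have p5 : ν * h ≤ M ^ 4 * (√h * δ) := by
      have : ν ≤ M ^ 4 := by linarith
      calc ν * h ≤ M ^ 4 * h := by gcongr
        _ ≤ _ := p2
    have p4 : 0 ≤ M ^ 4 * (√h * δ) := by positivity
    linarith

end Ons

namespace Ons

/-- translates of a function as elements of `C(K, F)` -/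
def trc {F : Type*} [TopologicalSpace F] (K : Set ℂ) (G : C(ℂ, F)) : C(ℂ, C(K, F)) :=
  ContinuousMap.curry ⟨fun q : ℂ × K => G (q.1 - q.2),
    G.continuous.comp (continuous_fst.sub (continuous_subtype_val.comp continuous_snd))⟩

lemma trc_apply {F : Type*} [TopologicalSpace F] (K : Set ℂ) (G : C(ℂ, F)) (x : ℂ) (z : K) :
    trc K G x z = G (x - z) := rfl

/-- potential of a functional -/
def pot {K : Set ℂ} [CompactSpace K] (l : C(K, ℝ) →L[ℝ] ℝ) (G : C(ℂ, ℝ)) (x : ℂ) : ℝ :=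
  l (trc K G x)

lemma pot_continuous {K : Set ℂ} [CompactSpace K] (l : C(K, ℝ) →L[ℝ] ℝ) (G : C(ℂ, ℝ)) :
    Continuous (pot l G) := l.continuous.comp (trc K G).continuous

lemma pot_hasFDerivAt {K : Set ℂ} [CompactSpace K] (l : C(K, ℝ) →L[ℝ] ℝ) (G : C(ℂ, ℝ))
    (hG : ContDiff ℝ 1 G) (x : ℂ) :
    HasFDerivAt (pot l G)
      (pot l ⟨dd 1 G, dd_continuous hG⟩ x • Complex.reCLM
        + pot l ⟨dd Complex.I G, dd_continuous hG⟩ x • Complex.imCLM) x := by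
  have hfc : Continuous (fderiv ℝ G) := hG.continuous_fderiv one_ne_zero
  set DG : C(ℂ, ℂ →L[ℝ] ℝ) := ⟨fderiv ℝ G, hfc⟩ with hDG
  rw [hasFDerivAt_iff_isLittleO_nhds_zero, Asymptotics.isLittleO_iff]
  intro c hc
  set c' := c / (‖l‖ + 1) with hc'
  have hc'0 : 0 < c' := by positivity
  have hcont := (Metric.continuousAt_iff (α := ℂ) (β := C(K, ℂ →L[ℝ] ℝ)) (f := trc K DG)
    (a := x)).1 (trc K DG).continuous.continuousAt c' hc'0
  obtain ⟨r, hr, hrr⟩ := hcont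
  filter_upwards [Metric.ball_mem_nhds (0:ℂ) hr] with v hv
  have hv' : ‖v‖ < r := by simpa using hv
  have e : pot l G (x + v) - pot l G x - (pot l ⟨dd 1 G, dd_continuous hG⟩ x • Complex.reCLM
        + pot l ⟨dd Complex.I G, dd_continuous hG⟩ x • Complex.imCLM) v
      = l (trc K G (x + v) - trc K G x - (v.re • trc K ⟨dd 1 G, dd_continuous hG⟩ x
          + v.im • trc K ⟨dd Complex.I G, dd_continuous hG⟩ x)) := by
    simp only [pot, map_sub, map_add, map_smul, add_apply, smul_apply,
      Complex.reCLM_apply, Complex.imCLM_apply, smul_eq_mul]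
    ring
  rw [e]
  have hb : ‖trc K G (x + v) - trc K G x - (v.re • trc K ⟨dd 1 G, dd_continuous hG⟩ x
          + v.im • trc K ⟨dd Complex.I G, dd_continuous hG⟩ x)‖ ≤ c' * ‖v‖ := by
    rw [ContinuousMap.norm_le _ (by positivity)]
    intro z
    have hdv : v.re * dd 1 G (x - z) + v.im * dd Complex.I G (x - z) = fderiv ℝ G (x - z) v := by
      have : v = v.re • (1:ℂ) + v.im • Complex.I := by
        apply Complex.ext <;> simp
      conv_rhs => rw [this]
      rw [map_add, map_smul, map_smul]; rfl
    have hmv := Convex.norm_image_sub_le_of_norm_hasFDerivWithin_le' (𝕜 := ℝ)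
      (f := fun y : ℂ => G (y - z)) (f' := fun y => fderiv ℝ G (y - z)) (s := ball x r) (x := x)
      (y := x + v) (φ := fderiv ℝ G (x - z)) (C := c') ?_ ?_ (convex_ball x r)
      (mem_ball_self hr) (by simpa using hv')
    · simp only [ContinuousMap.sub_apply, ContinuousMap.add_apply, ContinuousMap.smul_apply,
        trc_apply, smul_eq_mul, ContinuousMap.coe_mk, hdv]
      simpa using hmv
    · intro y _
      have h1 : HasFDerivAt (fun y : ℂ => y - (z:ℂ)) (ContinuousLinearMap.id ℝ ℂ) y :=
        (hasFDerivAt_id y).sub_const _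
      have h2 := ((hG.differentiable one_ne_zero) (y - z)).hasFDerivAt.comp y h1
      exact h2.hasFDerivWithinAt
    · intro y hy
      have h1 := hrr hy
      have h2 := (ContinuousMap.dist_lt_iff hc'0).1 h1 z
      rw [dist_eq_norm] at h2
      exact h2.le
  calc _ ≤ ‖l‖ * (c' * ‖v‖) := (l.le_opNorm _).trans (by gcongr)
    _ ≤ (‖l‖ + 1) * (c' * ‖v‖) := by gcongr; linarith
    _ = c * ‖v‖ := by rw [hc']; field_simp

lemma dd_pot {K : Set ℂ} [CompactSpace K] (l : C(K, ℝ) →L[ℝ] ℝ) (G : C(ℂ, ℝ))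
    (hG : ContDiff ℝ 1 G) (v : ℂ) : dd v (pot l G) = pot l ⟨dd v G, dd_continuous hG⟩ := by
  funext x
  have : dd v (pot l G) x = fderiv ℝ (pot l G) x v := rfl
  rw [this, (pot_hasFDerivAt l G hG x).fderiv]
  have e : trc K (⟨dd v G, dd_continuous hG⟩ : C(ℂ, ℝ)) x
      = v.re • trc K ⟨dd 1 G, dd_continuous hG⟩ x
          + v.im • trc K ⟨dd Complex.I G, dd_continuous hG⟩ x := by
    ext z
    simp only [ContinuousMap.add_apply, ContinuousMap.smul_apply,
        trc_apply, smul_eq_mul, ContinuousMap.coe_mk]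
    have : v = v.re • (1:ℂ) + v.im • Complex.I := by
      apply Complex.ext <;> simp
    show fderiv ℝ G (x - z) v = v.re * fderiv ℝ G (x - z) 1 + v.im * fderiv ℝ G (x - z) Complex.I
    conv_lhs => rw [this]
    rw [map_add, map_smul, map_smul]; rfl
  simp only [pot, e, map_add, map_smul, add_apply, smul_apply,
      Complex.reCLM_apply, Complex.imCLM_apply, smul_eq_mul]
  ring

lemma pot_contDiff_one {K : Set ℂ} [CompactSpace K] (l : C(K, ℝ) →L[ℝ] ℝ) (G : C(ℂ, ℝ))
    (hG : ContDiff ℝ 1 G) : ContDiff ℝ 1 (pot l G) := by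
  rw [contDiff_one_iff_fderiv]
  refine ⟨fun x => (pot_hasFDerivAt l G hG x).differentiableAt, ?_⟩
  have : fderiv ℝ (pot l G) = _ := funext fun x => (pot_hasFDerivAt l G hG x).fderiv
  rw [this]
  exact ((pot_continuous _ _).smul continuous_const).add ((pot_continuous _ _).smul continuous_const)

lemma pot_contDiff_two {K : Set ℂ} [CompactSpace K] (l : C(K, ℝ) →L[ℝ] ℝ) (G : C(ℂ, ℝ))
    (hG : ContDiff ℝ 2 G) : ContDiff ℝ 2 (pot l G) := by
  have hG1 : ContDiff ℝ 1 G := hG.of_le (by norm_num)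
  have h := contDiff_succ_iff_fderiv (𝕜 := ℝ) (f := pot l G) (n := 1)
  have e2 : ((1 : WithTop ℕ∞) + 1) = 2 := by norm_num
  rw [e2] at h
  rw [h]
  refine ⟨fun x => (pot_hasFDerivAt l G hG1 x).differentiableAt, by simp, ?_⟩
  have : fderiv ℝ (pot l G) = _ := funext fun x => (pot_hasFDerivAt l G hG1 x).fderiv
  rw [this]
  have h1 : ∀ v, ContDiff ℝ 1 (pot l ⟨dd v G, dd_continuous hG1⟩) := fun v =>
    pot_contDiff_one l _ (dd_contDiff (n := 1) hG)
  exact ((h1 1).smul contDiff_const).add ((h1 Complex.I).smul contDiff_const)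

lemma lp_pot {K : Set ℂ} [CompactSpace K] (l : C(K, ℝ) →L[ℝ] ℝ) (G : C(ℂ, ℝ))
    (hG : ContDiff ℝ 2 G) (x : ℂ) : lp (pot l G) x = pot l ⟨lp G, lp_continuous hG⟩ x := by
  have hG1 : ContDiff ℝ 1 G := hG.of_le (by norm_num)
  have e : lp (pot l G) x = dd 1 (dd 1 (pot l G)) x + dd Complex.I (dd Complex.I (pot l G)) x := rfl
  have h1 : ∀ v, dd v (pot l ⟨dd v G, dd_continuous hG1⟩)
      = pot l ⟨dd v (dd v G), dd_continuous (dd_contDiff (n := 1) hG)⟩ := fun v =>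
    dd_pot l ⟨dd v G, dd_continuous hG1⟩ (dd_contDiff (n := 1) hG) v
  rw [e, dd_pot l G hG1, dd_pot l G hG1, h1, h1]
  unfold pot
  rw [← map_add]
  rfl

/-! The kernel. -/

lemma hasDerivAt_glue {f g f' g' : ℝ → ℝ} (hf : ∀ x ≤ 1, HasDerivAt f (f' x) x)
    (hg : ∀ x, 1 ≤ x → HasDerivAt g (g' x) x) (h1 : f 1 = g 1) (h2 : f' 1 = g' 1) (x : ℝ) :
    HasDerivAt (fun s => if s ≤ 1 then f s else g s) (if x ≤ 1 then f' x else g' x) x := by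
  rcases lt_trichotomy x 1 with h | h | h
  · rw [if_pos h.le]
    apply (hf x h.le).congr_of_eventuallyEq
    filter_upwards [gt_mem_nhds h] with y hy
    rw [if_pos (le_of_lt hy)]
  · subst h
    rw [if_pos le_rfl]
    have k1 : HasDerivWithinAt (fun s => if s ≤ 1 then f s else g s) (f' 1) (Set.Iic 1) 1 :=
      (hf 1 le_rfl).hasDerivWithinAt.congr (fun y hy => if_pos hy) (if_pos le_rfl)
    have k2 : HasDerivWithinAt (fun s => if s ≤ 1 then f s else g s) (f' 1) (Set.Ici 1) 1 := by
      rw [h2]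
      refine (hg 1 le_rfl).hasDerivWithinAt.congr (fun y hy => ?_) (by rw [if_pos le_rfl, h1])
      rcases eq_or_lt_of_le (show (1:ℝ) ≤ y from hy) with hh | hh
      · subst hh; rw [if_pos le_rfl, h1]
      · rw [if_neg (not_le.2 hh)]
    have := k1.union k2
    rwa [Set.Iic_union_Ici, hasDerivWithinAt_univ] at this
  · rw [if_neg (not_le.2 h)]
    apply (hg x h.le).congr_of_eventuallyEq
    filter_upwards [lt_mem_nhds h] with y hy
    rw [if_neg (not_le.2 hy)]

def e0 (s : ℝ) : ℝ := if s ≤ 1 then 2 * s - s ^ 2 / 2 - 3 / 2 else Real.log s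
def e1 (s : ℝ) : ℝ := if s ≤ 1 then 2 - s else s⁻¹
def e2 (s : ℝ) : ℝ := if s ≤ 1 then -1 else -(s ^ 2)⁻¹

lemma e0_deriv (s : ℝ) : HasDerivAt e0 (e1 s) s := by
  apply hasDerivAt_glue
  · intro x _
    have := (((hasDerivAt_id x).const_mul 2).sub (((hasDerivAt_id x).pow 2).div_const 2)).sub_const (3/2)
    refine this.congr_deriv ?_
    simp
  · intro x hx; exact Real.hasDerivAt_log (by linarith)
  · norm_num
  · norm_num

lemma e1_deriv (s : ℝ) : HasDerivAt e1 (e2 s) s := by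
  apply hasDerivAt_glue
  · intro x _
    exact (hasDerivAt_id x).const_sub 2
  · intro x hx; exact hasDerivAt_inv (by linarith)
  · norm_num
  · norm_num

lemma e2_continuous : Continuous e2 := by
  have : e2 = fun s => -((max s 1) ^ 2)⁻¹ := by
    funext s; unfold e2; split_ifs with h
    · rw [max_eq_right h]; norm_num
    · rw [max_eq_left (not_le.1 h).le]
  rw [this]
  refine ((continuous_id.max continuous_const).pow 2).inv₀ ?_ |>.neg
  intro x
  have : (1:ℝ) ≤ max x 1 := le_max_right _ _
  have h2 : 0 < max x 1 := by linarith
  exact (pow_pos h2 2).ne'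

lemma e0_contDiff : ContDiff ℝ 2 e0 := by
  have h1 : ContDiff ℝ 1 e1 := by
    rw [contDiff_one_iff_deriv]
    refine ⟨fun x => (e1_deriv x).differentiableAt, ?_⟩
    rw [show deriv e1 = e2 from funext fun x => (e1_deriv x).deriv]
    exact e2_continuous
  have e2' : ((1 : WithTop ℕ∞) + 1) = 2 := by norm_num
  have h := contDiff_succ_iff_deriv (𝕜 := ℝ) (f := e0) (n := 1)
  rw [e2'] at h
  rw [h]
  refine ⟨fun x => (e0_deriv x).differentiableAt, by simp, ?_⟩
  rw [show deriv e0 = e1 from funext fun x => (e0_deriv x).deriv]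
  exact h1

def Ek (δ : ℝ) : C(ℂ, ℝ) := ⟨fun z => e0 (ns z / δ ^ 2),
  e0_contDiff.continuous.comp (continuous_ns.div_const _)⟩

lemma Ek_contDiff (δ : ℝ) : ContDiff ℝ 2 (Ek δ) :=
  e0_contDiff.comp (contDiff_ns.div_const _)

lemma lp_Ek {δ : ℝ} (hδ : 0 < δ) (z : ℂ) :
    lp (Ek δ) z = 8 / δ ^ 2 * max 0 (1 - ns z / δ ^ 2) := by
  have h := lp_radial (g := fun s => e0 (s / δ ^ 2)) (g' := fun s => e1 (s / δ ^ 2) / δ ^ 2)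
    (g'' := e2 (ns z / δ ^ 2) / δ ^ 2 / δ ^ 2) (z := z)
    (Eventually.of_forall fun s => by
      have := (e0_deriv (s / δ ^ 2)).comp s ((hasDerivAt_id s).div_const (δ ^ 2))
      refine this.congr_deriv ?_
      ring)
    (by
      have := ((e1_deriv (ns z / δ ^ 2)).comp (ns z) ((hasDerivAt_id (ns z)).div_const (δ ^ 2))).div_const (δ ^ 2)
      refine this.congr_deriv ?_
      ring)
  have e : (Ek δ : ℂ → ℝ) = fun z => e0 (ns z / δ ^ 2) := rfl
  rw [e]
  refine h.trans ?_
  unfold e1 e2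
  have hd : δ ^ 2 ≠ 0 := by positivity
  split_ifs with hh
  · rw [max_eq_right (by linarith)]; field_simp; ring
  · rw [max_eq_left (by linarith [not_le.1 hh])]
    have : ns z ≠ 0 := by
      intro h0; rw [h0] at hh; simp at hh
    field_simp; ring

lemma Ek_far {δ : ℝ} (hδ : 0 < δ) {z : ℂ} (hz : δ ≤ ‖z‖) :
    Ek δ z = Real.log (ns z) - Real.log (δ ^ 2) := by
  have h1 : δ ^ 2 ≤ ns z := by rw [ns_eq]; gcongr
  have h2 : (0:ℝ) < δ ^ 2 := by positivity
  have h3 : 1 ≤ ns z / δ ^ 2 := by rwa [le_div_iff₀ h2, one_mul]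
  rw [← Real.log_div (by linarith) h2.ne']
  show e0 _ = _
  unfold e0
  split_ifs with h
  · have : ns z / δ ^ 2 = 1 := le_antisymm h h3
    rw [this]; norm_num
  · rfl

lemma dd_Ek_far {δ : ℝ} (hδ : 0 < δ) {z : ℂ} (hz : δ ≤ ‖z‖) (v : ℂ) :
    dd v (Ek δ) z = 2 * (v / z).re := by
  have h1 : δ ^ 2 ≤ ns z := by rw [ns_eq]; gcongr
  have h2 : (0:ℝ) < δ ^ 2 := by positivity
  have h3 : 1 ≤ ns z / δ ^ 2 := by rwa [le_div_iff₀ h2, one_mul]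
  have hn : HasFDerivAt (fun y => ns y / δ ^ 2) ((δ ^ 2)⁻¹ • fderiv ℝ ns z) z := by
    have := ((((contDiff_ns (n := 1)).differentiable one_ne_zero) z).hasFDerivAt.mul_const (δ ^ 2)⁻¹)
    simpa only [div_eq_mul_inv] using this
  have hd : HasFDerivAt (Ek δ) (e1 (ns z / δ ^ 2) • (δ ^ 2)⁻¹ • fderiv ℝ ns z) z :=
    HasDerivAt.comp_hasFDerivAt (h₂ := e0) z (e0_deriv (ns z / δ ^ 2)) hn
  have e : dd v (Ek δ) z = fderiv ℝ (Ek δ) z v := rfl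
  rw [e, hd.fderiv]
  have e' : fderiv ℝ ns z v = _ := dd_ns v z
  have e1v : e1 (ns z / δ ^ 2) = (ns z / δ ^ 2)⁻¹ := by
    unfold e1; split_ifs with h
    · have : ns z / δ ^ 2 = 1 := le_antisymm h h3
      rw [this]; norm_num
    · rfl
  simp only [smul_apply, smul_eq_mul, e', e1v]
  rw [Complex.div_re]
  have : Complex.normSq z = ns z := by rw [Complex.normSq_eq_norm_sq, ns_eq]
  rw [this]
  have : ns z ≠ 0 := by linarith
  field_simp

end Ons

namespace Ons

def polyRe (K : Set ℂ) (P : Polynomial ℂ) : C(K, ℝ) :=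
  ⟨fun z => (P.eval (z:ℂ)).re, Complex.continuous_re.comp
    (P.continuous.comp continuous_subtype_val)⟩

def mulRe (v : ℂ) : C(ℂ, ℝ) := ⟨fun w => (v * w).re,
  Complex.continuous_re.comp (continuous_const.mul continuous_id)⟩

lemma runge {K : Set ℂ} [CompactSpace K] (hKc : IsPreconnected Kᶜ) (l : C(K, ℝ) →L[ℝ] ℝ)
    (hl : ∀ P, l (polyRe K P) = 0) (v : ℂ) {x : ℂ} (hx : x ∉ K) (u : C(K, ℂ))
    (hu : ∀ z : K, u z = (x - z)⁻¹) : l ((mulRe v).comp u) = 0 := by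
  set ι : C(K, ℂ) := ⟨fun z => (z:ℂ), continuous_subtype_val⟩ with hι
  set S : Subalgebra ℂ C(K, ℂ) := (Algebra.adjoin ℂ {ι}).topologicalClosure with hS
  have hSc : IsClosed (S : Set C(K, ℂ)) := Subalgebra.isClosed_topologicalClosure _
  have hιS : ι ∈ S := Subalgebra.le_topologicalClosure _ (Algebra.subset_adjoin rfl)
  have hspec : spectrum ℂ ι = K := by
    rw [ContinuousMap.spectrum_eq_range]
    ext y; constructor
    · rintro ⟨z, rfl⟩; exact z.2
    · intro hy; exact ⟨⟨y, hy⟩, rfl⟩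
  have hsp := Subalgebra.spectrum_eq_of_isPreconnected_compl (𝕜 := ℂ) (S := S) (hS := hSc) ⟨ι, hιS⟩
    (by show IsPreconnected (spectrum ℂ ι)ᶜ; rw [hspec]; exact hKc)
  have hxn : x ∉ spectrum ℂ (⟨ι, hιS⟩ : S) := by
    rw [hsp]; show x ∉ spectrum ℂ ι; rw [hspec]; exact hx
  rw [spectrum.notMem_iff] at hxn
  obtain ⟨w, hw⟩ := hxn
  have hmul : (w : S) * ((w⁻¹ : Sˣ) : S) = 1 := w.mul_inv
  rw [hw] at hmul
  have hmul' := congrArg (fun q : S => (q : C(K, ℂ))) hmul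
  have huS : u = (((w⁻¹ : Sˣ) : S) : C(K, ℂ)) := by
    ext z
    have h1 : (x - z) * (((w⁻¹ : Sˣ) : S) : C(K, ℂ)) z = 1 := by
      have := congrArg (fun q : C(K, ℂ) => q z) hmul'
      show (x - ι z) * (((w⁻¹ : Sˣ) : S) : C(K, ℂ)) z = 1
      simpa using this
    rw [hu z, eq_comm]
    exact eq_inv_of_mul_eq_one_right h1
  have huS' : u ∈ S := huS ▸ SetLike.coe_mem _
  have hcont : Continuous fun f : C(K, ℂ) => l ((mulRe v).comp f) :=
    l.continuous.comp (ContinuousMap.continuous_postcomp _)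
  have hcl : IsClosed {f : C(K, ℂ) | l ((mulRe v).comp f) = 0} :=
    isClosed_eq hcont continuous_const
  have hsub : (Algebra.adjoin ℂ {ι} : Set C(K, ℂ)) ⊆ {f : C(K, ℂ) | l ((mulRe v).comp f) = 0} := by
    intro f hf
    rw [SetLike.mem_coe, Algebra.adjoin_singleton_eq_range_aeval] at hf
    obtain ⟨P, rfl⟩ := hf
    have : (mulRe v).comp (Polynomial.aeval ι P) = polyRe K (Polynomial.C v * P) := by
      ext z
      have e : (Polynomial.aeval ι P) z = P.eval (z:ℂ) := by
        rw [Polynomial.aeval_continuousMap_apply]; rfl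
      simp [mulRe, polyRe, e]
    show l _ = 0
    erw [this]; exact hl _
  have : closure (Algebra.adjoin ℂ {ι} : Set C(K, ℂ)) ⊆ {f : C(K, ℂ) | l ((mulRe v).comp f) = 0} :=
    closure_minimal hsub hcl
  exact this huS'

lemma l_const {K : Set ℂ} [CompactSpace K] (l : C(K, ℝ) →L[ℝ] ℝ)
    (hl : ∀ P, l (polyRe K P) = 0) (c : ℝ) : l (ContinuousMap.const K c) = 0 := by
  have : ContinuousMap.const K c = polyRe K (Polynomial.C (c:ℂ)) := by
    ext z; simp [polyRe]
  rw [this, hl]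

lemma pot_indep {K : Set ℂ} [CompactSpace K] (l : C(K, ℝ) →L[ℝ] ℝ)
    (hl : ∀ P, l (polyRe K P) = 0) {x : ℂ} {d d' : ℝ} (hd : 0 < d) (hd' : 0 < d')
    (h : ∀ z ∈ K, d ≤ ‖x - z‖) (h' : ∀ z ∈ K, d' ≤ ‖x - z‖) :
    pot l (Ek d) x = pot l (Ek d') x := by
  have : trc K (Ek d) x = trc K (Ek d') x
      + ContinuousMap.const K (Real.log (d' ^ 2) - Real.log (d ^ 2)) := by
    ext z
    simp only [trc_apply, ContinuousMap.add_apply, ContinuousMap.const_apply]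
    rw [Ek_far hd (h z z.2), Ek_far hd' (h' z z.2)]; ring
  unfold pot
  rw [this, map_add, l_const l hl, add_zero]

lemma dd_pot_zero {K : Set ℂ} [CompactSpace K] (hKc : IsPreconnected Kᶜ) (l : C(K, ℝ) →L[ℝ] ℝ)
    (hl : ∀ P, l (polyRe K P) = 0) {x : ℂ} {d : ℝ} (hd : 0 < d)
    (h : ∀ z ∈ K, d ≤ ‖x - z‖) (v : ℂ) : dd v (pot l (Ek d)) x = 0 := by
  have hE1 : ContDiff ℝ 1 (Ek d) := (Ek_contDiff d).of_le (by norm_num)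
  rw [dd_pot l _ hE1]
  have hx : x ∉ K := fun hx => by have := h x hx; simp at this; linarith
  have hne : ∀ z : K, x - (z:ℂ) ≠ 0 := fun z hz => hx (by
    rw [sub_eq_zero] at hz; rw [hz]; exact z.2)
  set u : C(K, ℂ) := ⟨fun z => (x - (z:ℂ))⁻¹,
    (continuous_const.sub continuous_subtype_val).inv₀ hne⟩ with hu
  have hr := runge hKc l hl v hx u (fun z => rfl)
  have : trc K (⟨dd v (Ek d), dd_continuous hE1⟩ : C(ℂ, ℝ)) x = (2:ℝ) • (mulRe v).comp u := by
    ext z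
    have e : trc K (⟨dd v (Ek d), dd_continuous hE1⟩ : C(ℂ, ℝ)) x z = dd v (Ek d) (x - z) := rfl
    rw [e, dd_Ek_far hd (h z z.2)]
    simp only [mulRe, hu, ContinuousMap.smul_apply, ContinuousMap.comp_apply, ContinuousMap.coe_mk,
      smul_eq_mul, div_eq_mul_inv]
  unfold pot
  rw [this, map_smul, hr, smul_zero]

lemma pot_vanish {K : Set ℂ} [CompactSpace K] (hK : IsCompact K) (hne : K.Nonempty)
    (hKc : IsPreconnected Kᶜ) (l : C(K, ℝ) →L[ℝ] ℝ)
    (hl : ∀ P, l (polyRe K P) = 0) {x : ℂ} {d : ℝ} (hd : 0 < d)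
    (h : ∀ z ∈ K, d ≤ ‖x - z‖) : pot l (Ek d) x = 0 := by
  set H : ℂ → ℝ := fun x => pot l (Ek (infDist x K)) x with hH
  have hpos : ∀ x ∈ Kᶜ, 0 < infDist x K := fun x hx =>
    (hK.isClosed.notMem_iff_infDist_pos hne).1 hx
  have hinf : ∀ x z, z ∈ K → infDist x K ≤ ‖x - z‖ := fun x z hz => by
    rw [← dist_eq_norm]; exact infDist_le_dist_of_mem hz
  have hloc : ∀ x ∈ Kᶜ, H =ᶠ[𝓝 x] pot l (Ek (infDist x K / 2)) := by
    intro x hx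
    have hp := hpos x hx
    filter_upwards [Metric.ball_mem_nhds x (half_pos hp)] with y hy
    have hyd : infDist x K / 2 ≤ infDist y K := by
      have := infDist_le_infDist_add_dist (s := K) (x := x) (y := y)
      rw [mem_ball, dist_comm] at hy; linarith
    apply pot_indep l hl (by linarith) (by linarith) (hinf y)
    intro z hz; exact hyd.trans (hinf y z hz)
  have hd1 : DifferentiableOn ℝ H Kᶜ := by
    intro y hy
    have h1 : ContDiff ℝ 1 (pot l (Ek (infDist y K / 2))) :=
      pot_contDiff_one l _ ((Ek_contDiff _).of_le (by norm_num))
    exact ((h1.differentiable one_ne_zero y).congr_of_eventuallyEq (hloc y hy)).differentiableWithinAt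
  have hd0 : Set.EqOn (fderiv ℝ H) 0 Kᶜ := by
    intro y hy
    rw [(hloc y hy).fderiv_eq]
    ext1 v
    refine dd_pot_zero hKc l hl (half_pos (hpos y hy)) ?_ v
    intro z hz; have := hinf y z hz; have := hpos y hy; linarith
  have hconst : ∀ y ∈ Kᶜ, ∀ y' ∈ Kᶜ, H y = H y' := fun y hy y' hy' =>
    hK.isClosed.isOpen_compl.is_const_of_fderiv_eq_zero hKc hd1 hd0 hy hy'
  have hxK : x ∈ Kᶜ := fun hx => by have := h x hx; simp at this; linarith
  have e0 : pot l (Ek d) x = H x := pot_indep l hl hd (hpos x hxK) h (hinf x)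
  rw [e0]
  obtain ⟨R, hR⟩ := hK.isBounded.exists_norm_le
  set R' := max R 1 with hR'
  have hR'1 : 1 ≤ R' := le_max_right _ _
  have hRz : ∀ z ∈ K, ‖z‖ ≤ R' := fun z hz => (hR z hz).trans (le_max_left _ _)
  have hbound : ∀ n : ℕ, 2 ≤ n → |H x| ≤ ‖l‖ * 4 * (1 / (n:ℝ)) := by
    intro n hn
    have hn' : (2:ℝ) ≤ n := by exact_mod_cast hn
    set y : ℂ := ((n * R' : ℝ) : ℂ) with hy
    have hyn : ‖y‖ = n * R' := by rw [hy, Complex.norm_real, Real.norm_of_nonneg (by positivity)]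
    have hyK : y ∈ Kᶜ := fun hyK => by
      have := hRz y hyK; rw [hyn] at this; nlinarith
    rw [hconst x hxK y hyK]
    have hp := hpos y hyK
    have e : trc K (Ek (infDist y K)) y =
        (trc K (Ek (infDist y K)) y - ContinuousMap.const K (Real.log (ns y) - Real.log (infDist y K ^ 2)))
        + ContinuousMap.const K (Real.log (ns y) - Real.log (infDist y K ^ 2)) := by abel
    have e2 : H y = l (trc K (Ek (infDist y K)) y - ContinuousMap.const K (Real.log (ns y) - Real.log (infDist y K ^ 2))) := by
      rw [hH]; simp only [pot]
      rw [map_sub, l_const l hl, sub_zero]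
    rw [e2, ← Real.norm_eq_abs, mul_assoc]
    refine (l.le_opNorm _).trans ?_
    gcongr
    rw [ContinuousMap.norm_le _ (by positivity)]
    intro z
    rw [ContinuousMap.sub_apply, trc_apply, Ek_far hp (hinf y z z.2), ContinuousMap.const_apply]
    have hz := hRz z z.2
    set u := 1 / (n:ℝ) with hu
    have hu0 : 0 < u := by positivity
    have hu1 : u ≤ 1/2 := by rw [hu]; gcongr
    have hRy : R' = u * ‖y‖ := by rw [hyn, hu]; field_simp
    have hy0 : 0 < ‖y‖ := by rw [hyn]; positivity
    have h1 : (1 - u) * ‖y‖ ≤ ‖y - z‖ := by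
      have := norm_sub_norm_le y (z:ℂ); nlinarith
    have h2 : ‖y - z‖ ≤ (1 + u) * ‖y‖ := by
      have := norm_sub_le y (z:ℂ); nlinarith
    have hyz0 : 0 < ‖y - z‖ := by nlinarith
    have e3 : Real.log (ns (y - z)) - Real.log (infDist y K ^ 2) - (Real.log (ns y) - Real.log (infDist y K ^ 2))
        = 2 * Real.log (‖y - z‖ / ‖y‖) := by
      rw [ns_eq, ns_eq, Real.log_div hyz0.ne' hy0.ne']; simp only [Real.log_pow]; push_cast; ring
    rw [e3]
    set t := ‖y - z‖ / ‖y‖ with ht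
    have t1 : 1 - u ≤ t := by rw [ht, le_div_iff₀ hy0]; exact h1
    have t2 : t ≤ 1 + u := by rw [ht, div_le_iff₀ hy0]; exact h2
    have t0 : 0 < t := by linarith
    have l1 := Real.log_le_sub_one_of_pos t0
    have l2 := Real.one_sub_inv_le_log_of_pos t0
    have l3 : t⁻¹ ≤ 1 + 2 * u := by
      rw [inv_le_iff_one_le_mul₀ t0]; nlinarith
    rw [Real.norm_eq_abs, abs_le]; constructor <;> linarith
  have hlim : Tendsto (fun n : ℕ => ‖l‖ * 4 * (1 / (n:ℝ))) atTop (𝓝 (‖l‖ * 4 * 0)) :=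
    tendsto_one_div_atTop_nhds_zero_nat.const_mul _
  have := ge_of_tendsto hlim (by
    filter_upwards [eventually_ge_atTop 2] with n hn using hbound n hn)
  simpa using this

end Ons

section
open Pointwise
namespace Ons

/-- smooth positive part -/
def Th (κ s : ℝ) : ℝ := (s + √(s ^ 2 + κ ^ 2) - κ) / 2
def th (κ s : ℝ) : ℝ := (1 + s / √(s ^ 2 + κ ^ 2)) / 2
def th' (κ s : ℝ) : ℝ := ((√(s ^ 2 + κ ^ 2) - s * (s / √(s ^ 2 + κ ^ 2))) / (√(s ^ 2 + κ ^ 2)) ^ 2) / 2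

section
variable {κ : ℝ}

lemma q_pos (hκ : 0 < κ) (s : ℝ) : 0 < √(s ^ 2 + κ ^ 2) := Real.sqrt_pos.2 (by positivity)

lemma abs_le_q (s : ℝ) : |s| ≤ √(s ^ 2 + κ ^ 2) := Real.abs_le_sqrt (by nlinarith [sq_nonneg κ])

lemma q_deriv (hκ : 0 < κ) (s : ℝ) :
    HasDerivAt (fun s => √(s ^ 2 + κ ^ 2)) (s / √(s ^ 2 + κ ^ 2)) s := by
  have h := (((hasDerivAt_id s).pow 2).add_const (κ ^ 2)).sqrt (by simp; positivity)
  have hq := q_pos hκ s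
  refine h.congr_deriv ?_
  have e : (2:ℕ) * (id s) ^ (2 - 1) * 1 / (2 * √(s ^ 2 + κ ^ 2)) = s / √(s ^ 2 + κ ^ 2) := by
    simp only [id]; norm_num; field_simp
  exact e

lemma Th_deriv (hκ : 0 < κ) (s : ℝ) : HasDerivAt (Th κ) (th κ s) s := by
  have h := (((hasDerivAt_id s).add (q_deriv hκ s)).sub_const κ).div_const 2
  exact h

lemma th_deriv (hκ : 0 < κ) (s : ℝ) : HasDerivAt (th κ) (th' κ s) s := by
  have h := (((hasDerivAt_id s).div (q_deriv hκ s) (q_pos hκ s).ne').const_add 1).div_const 2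
  refine h.congr_deriv ?_
  simp only [id, th', one_mul]

lemma Th_contDiff (hκ : 0 < κ) : ContDiff ℝ 2 (Th κ) := by
  unfold Th
  refine ContDiff.div_const (ContDiff.sub (contDiff_id.add (ContDiff.sqrt ?_ ?_)) contDiff_const) _
  · exact (contDiff_id.pow 2).add contDiff_const
  · intro x; positivity

lemma th_nonneg (hκ : 0 < κ) (s : ℝ) : 0 ≤ th κ s := by
  unfold th
  have : -1 ≤ s / √(s ^ 2 + κ ^ 2) := by
    rw [le_div_iff₀ (q_pos hκ s)]; have := abs_le_q (κ := κ) s; have := abs_le.1 this; linarith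
  linarith

lemma th_le_one (hκ : 0 < κ) (s : ℝ) : th κ s ≤ 1 := by
  unfold th
  have : s / √(s ^ 2 + κ ^ 2) ≤ 1 := by
    rw [div_le_iff₀ (q_pos hκ s)]; have := abs_le_q (κ := κ) s; have := abs_le.1 this; linarith
  linarith

lemma th'_nonneg (hκ : 0 < κ) (s : ℝ) : 0 ≤ th' κ s := by
  unfold th'
  have hq := q_pos hκ s
  have : s * (s / √(s ^ 2 + κ ^ 2)) ≤ √(s ^ 2 + κ ^ 2) := by
    rw [← mul_div_assoc, div_le_iff₀ hq, Real.mul_self_sqrt (by positivity)]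
    nlinarith [sq_nonneg κ]
  have : 0 ≤ √(s ^ 2 + κ ^ 2) - s * (s / √(s ^ 2 + κ ^ 2)) := by linarith
  positivity

lemma Th_zero (hκ : 0 < κ) : Th κ 0 = 0 := by
  unfold Th
  have : √(0 ^ 2 + κ ^ 2) = κ := by rw [show (0:ℝ) ^ 2 + κ ^ 2 = κ ^ 2 by ring, Real.sqrt_sq hκ.le]
  rw [this]; ring

lemma Th_ge (hκ : 0 < κ) (s : ℝ) : -(κ / 2) ≤ Th κ s := by
  unfold Th
  have := abs_le.1 (abs_le_q (κ := κ) s); linarith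

lemma sub_Th_le (hκ : 0 < κ) (s : ℝ) : s - Th κ s ≤ κ / 2 := by
  unfold Th
  have := abs_le.1 (abs_le_q (κ := κ) s); linarith
end

lemma lift_aux {K : Set ℂ} [CompactSpace K] (hK : IsCompact K) (hne : K.Nonempty)
    (hKc : IsPreconnected Kᶜ) {N : Set ℂ} (hN : IsOpen N) (hKN : K ⊆ N) {v0 V : ℂ → ℝ}
    (hv0 : ContDiff ℝ 2 v0) (hV : ContDiff ℝ 2 V) (h1 : ∀ z ∈ N, 0 ≤ lp v0 z)
    (h2 : ∀ z ∈ N, lp V z ≤ 0) (h3 : ∀ z ∈ N, v0 z ≤ V z)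
    (l : C(K, ℝ) →L[ℝ] ℝ) (hl : ∀ P, l (polyRe K P) = 0) {m : ℝ} (hm0 : 0 < m)
    (hm : ∀ g : C(K, ℝ), (∀ z : K, v0 z ≤ g z ∧ g z ≤ V z) → m ≤ l g) : False := by
  set σ := m / (2 * (‖l‖ + 1)) with hσ
  have hσ0 : 0 < σ := by positivity
  obtain ⟨δ1, hδ1, hδ1N⟩ := hK.exists_cthickening_subset_open hN hKN
  have huc : ∀ v : ℂ → ℝ, Continuous v → ∃ δ > 0, ∀ z ∈ K, ∀ x, ‖x - z‖ < δ → |v x - v z| ≤ σ := by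
    intro v hv
    have := hK.uniformContinuousAt_of_continuousAt v (fun a _ => hv.continuousAt)
      (Metric.dist_mem_uniformity hσ0)
    obtain ⟨δ, hδ, h⟩ := Metric.mem_uniformity_dist.1 this
    refine ⟨δ, hδ, fun z hz x hx => ?_⟩
    have := h (a := z) (b := x) (by rw [dist_comm, dist_eq_norm]; exact hx) hz
    simp only [Set.mem_setOf_eq] at this
    rw [dist_comm, Real.dist_eq] at this
    exact this.le
  obtain ⟨δ2, hδ2, hu2⟩ := huc v0 hv0.continuous
  obtain ⟨δ3, hδ3, hu3⟩ := huc V hV.continuous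
  set δ := min δ1 (min δ2 δ3) with hδ
  have hδ0 : 0 < δ := lt_min hδ1 (lt_min hδ2 hδ3)
  have hδl1 : δ ≤ δ1 := min_le_left _ _
  have hδl2 : δ ≤ δ2 := (min_le_right _ _).trans (min_le_left _ _)
  have hδl3 : δ ≤ δ3 := (min_le_right _ _).trans (min_le_right _ _)
  set D := cthickening δ K with hD
  have hDc : IsCompact D := hK.cthickening
  have hDN : D ⊆ N := (cthickening_mono hδl1 K).trans hδ1N
  have hfar : ∀ x ∉ D, ∀ z ∈ K, δ ≤ ‖x - z‖ := by
    intro x hx z hz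
    by_contra h
    apply hx
    rw [hD]
    exact mem_cthickening_of_dist_le x z δ K hz (by rw [dist_eq_norm]; exact (not_le.1 h).le)
  set p := pot l (Ek δ) with hp
  have hpC : ContDiff ℝ 2 p := pot_contDiff_two l _ (Ek_contDiff δ)
  have hpz : ∀ x ∉ D, p x = 0 := fun x hx => pot_vanish hK hne hKc l hl hδ0 (hfar x hx)
  have hps : HasCompactSupport p := HasCompactSupport.intro hDc hpz
  set ρ : C(ℂ, ℝ) := ⟨lp (Ek δ), lp_continuous (Ek_contDiff δ)⟩ with hρ
  have hρv : ∀ z, ρ z = 8 / δ ^ 2 * max 0 (1 - ns z / δ ^ 2) := fun z => lp_Ek hδ0 z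
  have hρ0 : ∀ z, 0 ≤ ρ z := fun z => by rw [hρv]; positivity
  have hρz : ∀ z, δ ≤ ‖z‖ → ρ z = 0 := fun z hz => by
    rw [hρv, max_eq_left, mul_zero]
    have : 1 ≤ ns z / δ ^ 2 := by
      rw [le_div_iff₀ (by positivity), one_mul, ns_eq]; gcongr
    linarith
  have hρs : HasCompactSupport ρ := HasCompactSupport.intro (isCompact_closedBall (0:ℂ) δ)
    (fun x hx => hρz x (by simp at hx; exact hx.le))
  set c := ∫ z, ρ z with hc
  have hc0 : 0 < c := by
    apply Continuous.integral_pos_of_hasCompactSupport_nonneg_nonzero (x := 0) ρ.continuous hρs hρ0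
    rw [hρv]; simp [ns]; positivity
  have hlp : ∀ x, lp p x = pot l ρ x := fun x => lp_pot l _ (Ek_contDiff δ) x
  have htr0 : ∀ x ∉ D, trc K ρ x = 0 := by
    intro x hx; ext z
    rw [trc_apply]; exact hρz _ (hfar x hx z z.2)
  set I := ∫ x in D, (|lp v0 x| + |lp V x|) with hI
  have hI0 : 0 ≤ I := integral_nonneg fun x => by positivity
  -- main estimate
  have main : ∀ κ : ℝ, 0 < κ → c * (m / 2) ≤ κ / 2 * I := by
    intro κ hκ
    set g : ℂ → ℝ := fun x => v0 x + (V x - v0 x) * th κ (p x) with hg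
    have hthc : Continuous (th κ) := continuous_iff_continuousAt.2 fun s => (th_deriv hκ s).continuousAt
    have hgc : Continuous g :=
      hv0.continuous.add ((hV.continuous.sub hv0.continuous).mul (hthc.comp hpC.continuous))
    -- upper bound
    set Q : ℂ → ℝ := fun x => Th κ (p x) with hQ
    have hQC : ContDiff ℝ 2 Q := (Th_contDiff hκ).comp hpC
    have hQz : ∀ x ∉ D, Q x = 0 := fun x hx => by
      show Th κ (p x) = 0
      rw [hpz x hx, Th_zero hκ]
    have hQs : HasCompactSupport Q := HasCompactSupport.intro hDc hQz
    have hlpQ : ∀ x, lp Q x = th κ (p x) * lp p x + th' κ (p x) * gn2 p x := fun x =>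
      lp_comp hpC.contDiffAt (Eventually.of_forall fun s => Th_deriv hκ s) (th_deriv hκ (p x))
    have hgn0 : ∀ x ∉ D, gn2 p x = 0 := by
      intro x hx
      have hev : p =ᶠ[𝓝 x] fun _ => 0 := by
        filter_upwards [hDc.isClosed.isOpen_compl.mem_nhds hx] with y hy using hpz y hy
      have hf : fderiv ℝ p x = 0 := by rw [hev.fderiv_eq]; simp
      have : gn2 p x = (fderiv ℝ p x 1) ^ 2 + (fderiv ℝ p x Complex.I) ^ 2 := rfl
      rw [this, hf]; simp
    have hlpc : Continuous (lp p) := lp_continuous hpC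
    have hlps : HasCompactSupport (lp p) := HasCompactSupport.intro hDc fun x hx => by
      rw [hlp]; unfold pot; rw [htr0 x hx, map_zero]
    have hlpQs : HasCompactSupport (lp Q) := HasCompactSupport.intro hDc fun x hx => by
      rw [hlpQ, hgn0 x hx, hlp]; unfold pot; rw [htr0 x hx, map_zero]; ring
    have hVv : ContDiff ℝ 2 (fun x => V x - v0 x) := hV.sub hv0
    have i1 : Integrable (fun x => g x * lp p x) :=
      (hgc.mul hlpc).integrable_of_hasCompactSupport hlps.mul_left
    have i2 : Integrable (fun x => v0 x * lp p x) :=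
      (hv0.continuous.mul hlpc).integrable_of_hasCompactSupport hlps.mul_left
    have i3 : Integrable (fun x => (V x - v0 x) * lp Q x) :=
      (hVv.continuous.mul (lp_continuous hQC)).integrable_of_hasCompactSupport hlpQs.mul_left
    have i4 : Integrable (fun x => p x * lp v0 x) :=
      (hpC.continuous.mul (lp_continuous hv0)).integrable_of_hasCompactSupport hps.mul_right
    have i5 : Integrable (fun x => Q x * lp (fun x => V x - v0 x) x) :=
      (hQC.continuous.mul (lp_continuous hVv)).integrable_of_hasCompactSupport hQs.mul_right
    have hDi : IntegrableOn (fun x => κ / 2 * (|lp v0 x| + |lp V x|)) D :=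
      (continuous_const.mul ((lp_continuous hv0).abs.add (lp_continuous hV).abs)).continuousOn.integrableOn_compact hDc
    have hup : ∫ x, g x * lp p x ≤ κ / 2 * I := by
      calc ∫ x, g x * lp p x ≤ ∫ x, (v0 x * lp p x + (V x - v0 x) * lp Q x) := by
            apply integral_mono i1 (i2.add i3)
            intro x
            have hnn : 0 ≤ (V x - v0 x) * (th' κ (p x) * gn2 p x) := by
              by_cases hx : x ∈ D
              · have := h3 x (hDN hx)
                have := th'_nonneg hκ (p x); have := gn2_nonneg p x
                apply mul_nonneg (by linarith) (by positivity)
              · rw [hgn0 x hx]; simp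
            show g x * lp p x ≤ v0 x * lp p x + (V x - v0 x) * lp Q x
            rw [hlpQ, hg]; simp only; linarith
        _ = ∫ x, (p x * lp v0 x + Q x * lp (fun x => V x - v0 x) x) := by
            rw [integral_add i2 i3, integral_add i4 i5, green2 hv0 hpC hps, green2 hVv hQC hQs]
        _ ≤ ∫ x, D.indicator (fun x => κ / 2 * (|lp v0 x| + |lp V x|)) x := by
            apply integral_mono (i4.add i5) (hDi.integrable_indicator hDc.measurableSet)
            intro x
            show p x * lp v0 x + Q x * lp (fun x => V x - v0 x) x ≤ _
            by_cases hx : x ∈ D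
            · rw [Set.indicator_of_mem hx, lp_sub hV.contDiffAt hv0.contDiffAt]
              have a1 := h1 x (hDN hx); have a2 := h2 x (hDN hx)
              have b1 := Th_ge hκ (p x); have b2 := sub_Th_le hκ (p x)
              rw [abs_of_nonneg a1, abs_of_nonpos a2]
              have c1 := mul_le_mul_of_nonneg_right b2 a1
              have c2 := mul_le_mul_of_nonpos_right b1 a2
              simp only [hQ]; linarith
            · rw [Set.indicator_of_notMem hx, hpz x hx, hQz x hx]; simp
        _ = κ / 2 * I := by
            rw [integral_indicator hDc.measurableSet, integral_const_mul]
    -- representation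
    set φ : ℂ → C(K, ℝ) := fun x => g x • trc K ρ x with hφ
    have hφc : Continuous φ := hgc.smul (trc K ρ).continuous
    have hφs : HasCompactSupport φ := HasCompactSupport.intro hDc fun x hx => by
      simp only [hφ]; rw [htr0 x hx, smul_zero]
    have hφi : Integrable φ := hφc.integrable_of_hasCompactSupport hφs
    set Gs := ∫ x, φ x with hGs
    have hlG : l Gs = ∫ x, g x * lp p x := by
      rw [hGs, ← l.integral_comp_comm hφi]
      congr 1; funext x
      rw [hφ, map_smul, hlp, smul_eq_mul]; rfl
    have hGz : ∀ z : K, Gs z = ∫ x, g x * ρ (x - z) := by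
      intro z
      have := (ContinuousMap.evalCLM ℝ z).integral_comp_comm hφi
      have e : (ContinuousMap.evalCLM ℝ z) (∫ x, φ x) = Gs z := rfl
      rw [e] at this
      rw [← this]
      rfl
    have hρt : ∀ z : ℂ, Integrable (fun x => ρ (x - z)) := fun z =>
      (ρ.continuous.integrable_of_hasCompactSupport hρs).comp_sub_right z
    have hρti : ∀ z : ℂ, ∫ x, ρ (x - z) = c := fun z => integral_sub_right_eq_self _ z
    have hgρ : ∀ z : ℂ, Integrable (fun x => g x * ρ (x - z)) := fun z => by
      have hcs : HasCompactSupport fun x => ρ (x - z) := hρs.comp_homeomorph (Homeomorph.subRight z)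
      exact (hgc.mul (ρ.continuous.comp (continuous_id.sub continuous_const))).integrable_of_hasCompactSupport
        hcs.mul_left
    have hpt : ∀ z : K, ∀ x : ℂ, (v0 z - σ) * ρ (x - z) ≤ g x * ρ (x - z) ∧
        g x * ρ (x - z) ≤ (V z + σ) * ρ (x - z) := by
      intro z x
      by_cases hx : δ ≤ ‖x - z‖
      · rw [hρz _ hx]; simp
      · have hx' := not_le.1 hx
        have hxD : x ∈ D := mem_cthickening_of_dist_le x z δ K z.2 (by rw [dist_eq_norm]; exact hx'.le)
        have hv := h3 x (hDN hxD)
        have t0 := th_nonneg hκ (p x); have t1 := th_le_one hκ (p x)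
        have w1 := abs_le.1 (hu2 z z.2 x (by linarith))
        have w2 := abs_le.1 (hu3 z z.2 x (by linarith))
        have g1 : v0 x ≤ g x := by
          simp only [hg]
          have := mul_nonneg (sub_nonneg.2 hv) t0; linarith
        have g2 : g x ≤ V x := by
          simp only [hg]
          have := mul_le_mul_of_nonneg_left t1 (sub_nonneg.2 hv); linarith
        exact ⟨mul_le_mul_of_nonneg_right (by linarith) (hρ0 _),
          mul_le_mul_of_nonneg_right (by linarith) (hρ0 _)⟩
    have hlow : ∀ z : K, (v0 z - σ) * c ≤ Gs z := fun z => by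
      rw [hGz, ← hρti z, ← integral_const_mul]
      exact integral_mono ((hρt z).const_mul _) (hgρ z) fun x => (hpt z x).1
    have hupp : ∀ z : K, Gs z ≤ (V z + σ) * c := fun z => by
      rw [hGz, ← hρti z, ← integral_const_mul]
      exact integral_mono (hgρ z) ((hρt z).const_mul _) fun x => (hpt z x).2
    set Gc : C(K, ℝ) := c⁻¹ • Gs with hGc
    have hGcz : ∀ z : K, v0 z - σ ≤ Gc z ∧ Gc z ≤ V z + σ := fun z => by
      have e : Gc z = Gs z / c := by rw [hGc, ContinuousMap.smul_apply, smul_eq_mul]; ring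
      rw [e, le_div_iff₀ hc0, div_le_iff₀ hc0]
      exact ⟨hlow z, hupp z⟩
    set v0K : C(K, ℝ) := ⟨fun z => v0 z, hv0.continuous.comp continuous_subtype_val⟩ with hv0K
    set VK : C(K, ℝ) := ⟨fun z => V z, hV.continuous.comp continuous_subtype_val⟩ with hVK
    set gt : C(K, ℝ) := (Gc ⊓ VK) ⊔ v0K with hgt
    have hgtz : ∀ z : K, gt z = max (min (Gc z) (V z)) (v0 z) := fun z => rfl
    have hgtm : m ≤ l gt := hm gt fun z => by
      rw [hgtz]
      exact ⟨le_max_right _ _, max_le (min_le_right _ _) (h3 z (hKN z.2))⟩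
    have hdiff : ‖Gc - gt‖ ≤ σ := by
      rw [ContinuousMap.norm_le _ hσ0.le]
      intro z
      rw [ContinuousMap.sub_apply, hgtz, Real.norm_eq_abs, abs_le]
      have := hGcz z
      have hh := h3 z (hKN z.2)
      rcases le_total (Gc z) (V z) with k | k
      · rw [min_eq_left k]
        rcases le_total (Gc z) (v0 z) with k' | k'
        · rw [max_eq_right k']; constructor <;> linarith
        · rw [max_eq_left k']; constructor <;> linarith
      · rw [min_eq_right k, max_eq_left hh]; constructor <;> linarith
    have hlGc : m / 2 ≤ l Gc := by
      have e : l Gc = l gt + l (Gc - gt) := by rw [← map_add]; congr 1; abel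
      have h5 : |l (Gc - gt)| ≤ ‖l‖ * σ := by
        rw [← Real.norm_eq_abs]
        exact (l.le_opNorm _).trans (mul_le_mul_of_nonneg_left hdiff (norm_nonneg _))
      have h6 : ‖l‖ * σ ≤ m / 2 := by
        have hn := norm_nonneg l
        rw [hσ, ← mul_div_assoc, div_le_div_iff₀ (by positivity) (by norm_num)]
        nlinarith
      have := (abs_le.1 h5).1
      rw [e]; linarith
    have hlGs : l Gs = c * l Gc := by
      rw [hGc, map_smul, smul_eq_mul]; field_simp
    calc c * (m / 2) ≤ c * l Gc := mul_le_mul_of_nonneg_left hlGc hc0.le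
      _ = ∫ x, g x * lp p x := by rw [← hlGs, hlG]
      _ ≤ _ := hup
  have := main (c * m / (I + 1)) (by positivity)
  have h7 : c * m / (I + 1) * I < c * m := by
    rw [div_mul_eq_mul_div, div_lt_iff₀ (by positivity)]
    nlinarith [mul_pos hc0 hm0]
  linarith

theorem lift {K : Set ℂ} (hK : IsCompact K)
    (hKc : IsPreconnected Kᶜ) {N : Set ℂ} (hN : IsOpen N) (hKN : K ⊆ N) {v0 V : ℂ → ℝ}
    (hv0 : ContDiff ℝ 2 v0) (hV : ContDiff ℝ 2 V) (h1 : ∀ z ∈ N, 0 ≤ lp v0 z)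
    (h2 : ∀ z ∈ N, lp V z ≤ 0) (h3 : ∀ z ∈ N, v0 z ≤ V z) {ε : ℝ} (hε : 0 < ε) :
    ∃ P : Polynomial ℂ, ∀ z ∈ K, v0 z - ε < (P.eval z).re ∧ (P.eval z).re < V z + ε := by
  rcases K.eq_empty_or_nonempty with hemp | hne
  · exact ⟨0, by rw [hemp]; simp⟩
  haveI : CompactSpace K := isCompact_iff_compactSpace.1 hK
  by_contra hcon
  push Not at hcon
  set S0 : Set C(K, ℝ) := {g | ∀ z : K, v0 z ≤ g z ∧ g z ≤ V z} with hS0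
  have hS0c : Convex ℝ S0 := by
    intro g hg g' hg' a b ha hb hab z
    have := hg z; have := hg' z
    simp only [ContinuousMap.add_apply, ContinuousMap.smul_apply, smul_eq_mul]
    have e : b = 1 - a := by linarith
    subst e
    constructor <;> nlinarith
  set S : Set C(K, ℝ) := S0 + ball (0 : C(K, ℝ)) ε with hS
  have hSo : IsOpen S := isOpen_ball.add_left
  have hSc : Convex ℝ S := hS0c.add (convex_ball _ _)
  set T : Set C(K, ℝ) := Set.range (polyRe K) with hT
  have hTadd : ∀ P Q : Polynomial ℂ, polyRe K (P + Q) = polyRe K P + polyRe K Q := by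
    intro P Q; ext z; simp [polyRe]
  have hTsmul : ∀ (a : ℝ) (P : Polynomial ℂ), polyRe K (Polynomial.C (a:ℂ) * P) = a • polyRe K P := by
    intro a P; ext z; simp [polyRe]
  have hTc : Convex ℝ T := by
    rintro _ ⟨P, rfl⟩ _ ⟨Q, rfl⟩ a b _ _ _
    exact ⟨Polynomial.C (a:ℂ) * P + Polynomial.C (b:ℂ) * Q, by rw [hTadd, hTsmul, hTsmul]⟩
  have hdisj : Disjoint S T := by
    rw [Set.disjoint_left]
    rintro _ ⟨g, hg, k, hk, rfl⟩ ⟨P, hP⟩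
    obtain ⟨z, hz, hzz⟩ := hcon P
    have e : (P.eval z).re = g ⟨z, hz⟩ + k ⟨z, hz⟩ :=
      congrArg (fun q : C(K, ℝ) => q ⟨z, hz⟩) hP
    have hkn : ‖k‖ < ε := by simpa using hk
    have hkz := abs_lt.1 ((Real.norm_eq_abs _ ▸ k.norm_coe_le_norm ⟨z, hz⟩).trans_lt hkn)
    have hgz := hg ⟨z, hz⟩
    have := hzz (by rw [e]; simp only at hgz; linarith)
    rw [e] at this
    simp only at hgz; linarith
  obtain ⟨f, u, hf1, hf2⟩ := geometric_hahn_banach_open hSc hSo hTc hdisj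
  have hf0 : ∀ P, f (polyRe K P) = 0 := by
    intro P
    by_contra hne0
    have h5 : ∀ a : ℝ, u ≤ a * f (polyRe K P) := fun a => by
      have := hf2 _ ⟨Polynomial.C (a:ℂ) * P, rfl⟩
      rwa [hTsmul, map_smul, smul_eq_mul] at this
    have := h5 ((u - 1) / f (polyRe K P))
    rw [div_mul_cancel₀ _ hne0] at this
    linarith
  have hu0 : u ≤ 0 := by
    have := hf2 _ ⟨0, rfl⟩; rwa [hf0] at this
  have hfS : ∀ a ∈ S, f a < 0 := fun a ha => (hf1 a ha).trans_le hu0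
  set v0K : C(K, ℝ) := ⟨fun z => v0 z, hv0.continuous.comp continuous_subtype_val⟩ with hv0K
  have hv0S : v0K ∈ S0 := fun z => ⟨le_rfl, h3 z (hKN z.2)⟩
  have hS0S : ∀ g ∈ S0, ∀ k, ‖k‖ < ε → g + k ∈ S := fun g hg k hk =>
    Set.add_mem_add hg (by simpa using hk)
  have hfv : f v0K < 0 := by
    have := hfS _ (hS0S v0K hv0S 0 (by simpa using hε)); simpa using this
  obtain ⟨a, ha0, ha⟩ : ∃ a : ℝ, 0 < a ∧ ‖a • v0K‖ < ε := by
    refine ⟨ε / (2 * (‖v0K‖ + 1)), by positivity, ?_⟩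
    rw [norm_smul, Real.norm_of_nonneg (by positivity), div_mul_eq_mul_div, div_lt_iff₀ (by positivity)]
    nlinarith [norm_nonneg v0K]
  refine lift_aux hK hne hKc hN hKN hv0 hV h1 h2 h3 (-f) (fun P => by simp [hf0])
    (m := a * (-f v0K)) (by nlinarith) ?_
  intro g hg
  have := hfS _ (hS0S g hg (-(a • v0K)) (by rwa [norm_neg]))
  rw [map_add, map_neg, map_smul, smul_eq_mul] at this
  simp only [neg_apply]
  linarith

end Ons
end

namespace Ons

lemma lp_polyRe (P : Polynomial ℂ) (z : ℂ) : lp (fun z => (P.eval z).re) z = 0 := by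
  have h : ∀ (Q : Polynomial ℂ) (v c z : ℂ),
      dd v (fun z => (c * Q.eval z).re) z = (c * v * Q.derivative.eval z).re := by
    intro Q v c z
    have h1 : HasDerivAt (fun z => c * Q.eval z) (c * Q.derivative.eval z) z :=
      (Q.hasDerivAt z).const_mul c
    have h2 := h1.hasFDerivAt.restrictScalars ℝ
    have h3 := Complex.reCLM.hasFDerivAt.comp z h2
    have h4 : dd v (fun z => (c * Q.eval z).re) z = _ := congrArg (fun L => L v) h3.fderiv
    rw [h4]
    simp only [ContinuousLinearMap.comp_apply, Complex.reCLM_apply,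
      ContinuousLinearMap.coe_restrictScalars', ContinuousLinearMap.toSpanSingleton_apply,
      smul_eq_mul]
    congr 1; ring
  have e1 : ∀ v, dd v (fun z => (P.eval z).re) = fun z => (v * P.derivative.eval z).re := by
    intro v; funext z
    have := h P v 1 z
    simpa only [one_mul] using this
  show dd 1 (dd 1 _) z + dd Complex.I (dd Complex.I _) z = 0
  rw [e1, e1, h, h, Complex.I_mul_I]
  simp

lemma exists_holo (P : Polynomial ℂ) : ∃ Φ : ℂ → ℂ, Differentiable ℂ Φ ∧
    ∀ z, ‖deriv Φ z‖ ^ 2 = exp ((P.eval z).re) := by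
  have hd : Differentiable ℂ (fun z => Complex.exp (P.eval z / 2)) :=
    (P.differentiable.div_const 2).cexp
  obtain ⟨Φ, hΦ⟩ := hd.isExactOn_univ
  refine ⟨Φ, fun z => (hΦ z trivial).differentiableAt, fun z => ?_⟩
  rw [(hΦ z trivial).deriv, Complex.norm_exp, ← Real.exp_nat_mul]
  congr 1
  rw [show (P.eval z / 2) = P.eval z / ((2:ℝ):ℂ) by norm_num, Complex.div_ofReal_re]
  push_cast; ring

/-- a hole-free nodal domain -/
structure Nod (u1 u2 f g : ℂ → ℝ) (Ω : Set ℂ) : Prop where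
  hu1 : ContDiff ℝ 2 u1
  hu2 : ContDiff ℝ 2 u2
  heq1 : ∀ z, lp u1 z + exp (u1 z) = f z
  heq2 : ∀ z, lp u2 z + exp (u2 z) = f z
  hf : Continuous f
  hO : IsOpen Ω
  hne : Ω.Nonempty
  hpos : ∀ z ∈ Ω, u1 z < u2 z
  hK : ∀ t > 0, IsCompact {z | z ∈ Ω ∧ t ≤ u2 z - u1 z}
  hKc : ∀ t > 0, IsPreconnected {z | z ∈ Ω ∧ t ≤ u2 z - u1 z}ᶜ
  i1 : IntegrableOn (fun z => exp (u1 z)) Ω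
  i2 : IntegrableOn (fun z => exp (u2 z)) Ω
  hg : IntegrableOn g Ω
  hg0 : ∀ z, 0 ≤ g z
  hgf : ∀ z, - f z ≤ g z

namespace Nod
variable {u1 u2 f g : ℂ → ℝ} {Ω : Set ℂ}

lemma hφ (n : Nod u1 u2 f g Ω) : ContDiff ℝ 2 (fun z => u2 z - u1 z) := n.hu2.sub n.hu1

lemma lpφ (n : Nod u1 u2 f g Ω) (z : ℂ) : lp (fun z => u2 z - u1 z) z = exp (u1 z) - exp (u2 z) := by
  rw [lp_sub n.hu2.contDiffAt n.hu1.contDiffAt]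
  have := n.heq1 z; have := n.heq2 z; linarith

lemma exC (n : Nod u1 u2 f g Ω) {τ : ℝ} (hτ : 0 < τ) : ∃ C : ℝ, 0 < C ∧ ∀ z ∈ Ω, τ ≤ u2 z - u1 z →
    |lp u1 z| ≤ C * (exp (u2 z) - exp (u1 z)) := by
  have hcont : ContinuousOn (fun z => |lp u1 z| / (exp (u2 z) - exp (u1 z)))
      {z | z ∈ Ω ∧ τ ≤ u2 z - u1 z} := by
    refine ContinuousOn.div (lp_continuous n.hu1).abs.continuousOn
      (n.hu2.continuous.rexp.sub n.hu1.continuous.rexp).continuousOn ?_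
    intro z hz
    have := exp_lt_exp.2 (n.hpos z hz.1)
    exact (sub_pos.2 this).ne'
  obtain ⟨C, hC⟩ := (n.hK τ hτ).bddAbove_image hcont
  refine ⟨max C 1, by positivity, fun z hz hz2 => ?_⟩
  have h1 := hC ⟨z, ⟨hz, hz2⟩, rfl⟩
  have h2 := sub_pos.2 (exp_lt_exp.2 (n.hpos z hz))
  have h3 : |lp u1 z| / (exp (u2 z) - exp (u1 z)) ≤ max C 1 := h1.trans (le_max_left _ _)
  rwa [div_le_iff₀ h2] at h3

/-- harmonic approximation -/
lemma approx (n : Nod u1 u2 f g Ω) {τ t C ε : ℝ} (hτ : 0 < τ) (hτt : τ < t) (hC0 : 0 < C)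
    (hC : ∀ z ∈ Ω, τ ≤ u2 z - u1 z → |lp u1 z| ≤ C * (exp (u2 z) - exp (u1 z))) (hε : 0 < ε) :
    ∃ P : Polynomial ℂ, ∀ z ∈ Ω, t ≤ u2 z - u1 z →
      |(P.eval z).re - u1 z| < C * (u2 z - u1 z - t) + 2 * ε := by
  have hv : ContDiff ℝ 2 (fun z => C * (u2 z - u1 z)) := contDiff_const.mul n.hφ
  have hlC : ∀ z, lp (fun z => C * (u2 z - u1 z)) z = C * (exp (u1 z) - exp (u2 z)) := fun z => by
    rw [lp_const_mul C n.hφ.contDiffAt, n.lpφ]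
  have hcc : ContDiff ℝ 2 (fun _ : ℂ => C * t - ε) := contDiff_const
  have hw : ContDiff ℝ 2 (fun z => C * (u2 z - u1 z) - (C * t - ε)) := hv.sub hcc
  have hlw : ∀ z, lp (fun z => C * (u2 z - u1 z) - (C * t - ε)) z =
      C * (exp (u1 z) - exp (u2 z)) := fun z => by
    rw [lp_sub hv.contDiffAt hcc.contDiffAt, hlC, lp_const, sub_zero]
  have hN : IsOpen {z | z ∈ Ω ∧ max τ (t - ε / C) < u2 z - u1 z} :=
    isOpen_sl n.hO n.hφ.continuous _
  have hCε : ∀ z : ℂ, t - ε / C < u2 z - u1 z → 0 < C * (u2 z - u1 z) - (C * t - ε) := by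
    intro z hz
    have := mul_lt_mul_of_pos_left hz hC0
    rw [mul_sub, mul_div_cancel₀ _ hC0.ne'] at this
    linarith
  obtain ⟨P, hP⟩ := lift (n.hK t (hτ.trans hτt)) (n.hKc t (hτ.trans hτt)) hN (by
      intro z hz
      refine ⟨hz.1, max_lt (hτt.trans_le hz.2) ?_⟩
      have : 0 < ε / C := by positivity
      have := hz.2; linarith)
    (v0 := fun z => u1 z - (C * (u2 z - u1 z) - (C * t - ε)))
    (V := fun z => u1 z + (C * (u2 z - u1 z) - (C * t - ε)))
    (n.hu1.sub hw) (n.hu1.add hw)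
    (by
      intro z hz
      rw [lp_sub n.hu1.contDiffAt hw.contDiffAt, hlw]
      have := neg_le_of_abs_le (hC z hz.1 ((le_max_left _ _).trans hz.2.le)); linarith)
    (by
      intro z hz
      rw [lp_add n.hu1.contDiffAt hw.contDiffAt, hlw]
      have := le_of_abs_le (hC z hz.1 ((le_max_left _ _).trans hz.2.le)); linarith)
    (by
      intro z hz
      have := hCε z ((le_max_right _ _).trans_lt hz.2)
      linarith) hε
  refine ⟨P, fun z hz hz2 => ?_⟩
  have := hP z ⟨hz, hz2⟩
  rw [abs_lt]
  constructor <;> linarith [this.1, this.2]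

end Nod
end Ons

namespace Ons

lemma diff_le {S S' : Set ℂ} (hS' : MeasurableSet S') (hS : MeasurableSet S)
    (hss : S' ⊆ S) {p r : ℂ → ℝ}
    (hp : IntegrableOn p S) (hr : IntegrableOn r S) (c : ℝ)
    (h : ∀ z ∈ S, z ∉ S' → p z ≤ c * r z) :
    (∫ z in S, p z) - (∫ z in S', p z) ≤ c * ((∫ z in S, r z) - ∫ z in S', r z) := by
  rw [← integral_diff hS' hp hss, ← integral_diff hS' hr hss, ← integral_const_mul]
  refine setIntegral_mono_on (hp.mono_set Set.diff_subset)
    ((hr.mono_set Set.diff_subset).const_mul c) (hS.diff hS') ?_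
  intro z hz; exact h z hz.1 hz.2

lemma le_diff {S S' : Set ℂ} (hS' : MeasurableSet S') (hS : MeasurableSet S)
    (hss : S' ⊆ S) {p r : ℂ → ℝ}
    (hp : IntegrableOn p S) (hr : IntegrableOn r S) (c : ℝ)
    (h : ∀ z ∈ S, z ∉ S' → c * r z ≤ p z) :
    c * ((∫ z in S, r z) - ∫ z in S', r z) ≤ (∫ z in S, p z) - (∫ z in S', p z) := by
  rw [← integral_diff hS' hp hss, ← integral_diff hS' hr hss, ← integral_const_mul]
  refine setIntegral_mono_on ((hr.mono_set Set.diff_subset).const_mul c)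
    (hp.mono_set Set.diff_subset) (hS.diff hS') ?_
  intro z hz; exact h z hz.1 hz.2

namespace Nod
variable {u1 u2 f g : ℂ → ℝ} {Ω : Set ℂ}

lemma bol_inner (n : Nod u1 u2 f g Ω) {t s0 θ : ℝ} (ht : 0 < t) (hs0 : 0 < s0) (hθ0 : 0 ≤ θ) (hθ1 : θ ≤ 1)
    (hθ : ∀ z ∈ sl Ω (fun z => u2 z - u1 z) t, exp (u1 z) - f z ≤ θ * exp (u1 z) + g z)
    (P : Polynomial ℂ)
    (hb : ∀ z ∈ Ω, u2 z - u1 z = t → u1 z - (P.eval z).re < s0) :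
    (∫ z in sl Ω (fun z => u2 z - u1 z) t, exp (u1 z)) *
      (8 * π - 2 * (∫ z in Ω, g z) - θ * ∫ z in sl Ω (fun z => u2 z - u1 z) t, exp (u1 z)) ≤
    8 * π * exp s0 * ∫ z in sl Ω (fun z => u2 z - u1 z) t, exp ((P.eval z).re) := by
  obtain ⟨Φ, hΦ, hΦn⟩ := exists_holo P
  set q : ℂ → ℝ := fun z => (P.eval z).re with hq
  have hqc : ContDiff ℝ 2 q := by
    have : ContDiff ℝ 2 (fun z : ℂ => P.eval z) :=
      (P.differentiable.contDiff (n := 2)).restrict_scalars ℝ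
    exact Complex.reCLM.contDiff.comp this
  set G := sl Ω (fun z => u2 z - u1 z) t with hG
  set η : ℂ → ℝ := fun z => u1 z - q z with hη
  have hGo : IsOpen G := isOpen_sl n.hO n.hφ.continuous t
  have hηc : ContDiff ℝ 2 η := n.hu1.sub hqc
  have hK := n.hK t ht
  set K := {z | z ∈ Ω ∧ t ≤ u2 z - u1 z} with hKdef
  have hGK : G ⊆ K := fun z hz => ⟨hz.1, hz.2.le⟩
  have hGΩ : G ⊆ Ω := fun z hz => hz.1
  obtain ⟨T, hT⟩ := hK.bddAbove_image hηc.continuous.continuousOn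
  set s1 := max (s0 + 1) (T + 1) with hs1
  have hs01 : s0 < s1 := lt_of_lt_of_le (by linarith) (le_max_left _ _)
  have iq : IntegrableOn (fun z => exp (q z)) G :=
    (hqc.continuous.rexp.continuousOn.integrableOn_compact hK).mono_set hGK
  have iu : IntegrableOn (fun z => exp (u1 z)) G := n.i1.mono_set hGΩ
  have hslG : ∀ s, sl G η s ⊆ G := fun s z hz => hz.1
  have hslo : ∀ s, IsOpen (sl G η s) := fun s => isOpen_sl hGo hηc.continuous s
  set A : ℝ → ℝ := fun s => ∫ z in sl G η s, exp (q z) with hA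
  set B : ℝ → ℝ := fun s => ∫ z in sl G η s, exp (u1 z) with hB
  set F := ∫ z in Ω, g z with hF
  have hF0 : 0 ≤ F := setIntegral_nonneg n.hO.measurableSet (fun z _ => n.hg0 z)
  have hemp : sl G η s1 = ∅ := by
    ext z
    simp only [Set.mem_empty_iff_false, iff_false]
    rintro ⟨h1, h2⟩
    have := hT ⟨z, hGK h1, rfl⟩
    have : T + 1 ≤ s1 := le_max_right _ _
    linarith
  have hA1 : A s1 = 0 := by simp only [hA, hemp, setIntegral_empty]
  have hB1 : B s1 = 0 := by simp only [hB, hemp, setIntegral_empty]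
  have hA0 : ∀ s, 0 ≤ A s := fun s => setIntegral_nonneg (hslo s).measurableSet (fun z _ => (exp_pos _).le)
  have hB0 : ∀ s, 0 ≤ B s := fun s => setIntegral_nonneg (hslo s).measurableSet (fun z _ => (exp_pos _).le)
  have hmonoA : ∀ s s', s ≤ s' → A s' ≤ A s := fun s s' h =>
    setIntegral_mono_set (iq.mono_set (hslG s)) (ae_of_all _ fun z => (exp_pos _).le)
      (sl_anti h).eventuallyLE
  have hmonoB : ∀ s s', s ≤ s' → B s' ≤ B s := fun s s' h =>
    setIntegral_mono_set (iu.mono_set (hslG s)) (ae_of_all _ fun z => (exp_pos _).le)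
      (sl_anti h).eventuallyLE
  have hlayer : ∀ s h, s0 ≤ s → 0 < h → 4 * π * h * A (s + h) ≤ (θ * B s + F) * (A s - A (s + h)) := by
    intro s h hs hh
    have hcomp : IsCompact {z | z ∈ G ∧ s ≤ η z} := by
      have e : {z | z ∈ G ∧ s ≤ η z} = K ∩ η ⁻¹' (Set.Ici s) := by
        ext z
        constructor
        · rintro ⟨h1, h2⟩; exact ⟨hGK h1, h2⟩
        · rintro ⟨h1, h2⟩
          refine ⟨⟨h1.1, lt_of_le_of_ne h1.2 fun he => ?_⟩, h2⟩
          have := hb z h1.1 he.symm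
          have h2' : s ≤ η z := h2
          simp only [hη, hq] at h2'
          linarith
      rw [e]
      exact hK.inter_right (isClosed_Ici.preimage hηc.continuous)
    have hRi : IntegrableOn (fun z => θ * exp (u1 z) + g z) (sl G η s) :=
      ((iu.mono_set (hslG s)).const_mul θ).add (n.hg.mono_set ((hslG s).trans hGΩ))
    have h1 := layer hGo hηc hh hcomp hRi
      (fun z _ => add_nonneg (mul_nonneg hθ0 (exp_pos _).le) (n.hg0 z))
      (fun z hz => by
        have := hθ z (hslG s hz)
        have e : lp η z = lp u1 z := by
          rw [hη, lp_sub n.hu1.contDiffAt hqc.contDiffAt, hq, lp_polyRe, sub_zero]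
        have := n.heq1 z
        rw [e]; linarith) hΦ
    simp only [hΦn] at h1
    refine h1.trans ?_
    refine mul_le_mul_of_nonneg_right ?_ (sub_nonneg.2 (hmonoA _ _ (by linarith)))
    rw [integral_add ((iu.mono_set (hslG s)).const_mul θ) (n.hg.mono_set ((hslG s).trans hGΩ)),
      integral_const_mul]
    refine add_le_add le_rfl ?_
    exact setIntegral_mono_set n.hg (ae_of_all _ fun z => n.hg0 z)
      ((hslG s).trans hGΩ).eventuallyLE
  have hexp : ∀ z, exp (u1 z) = exp (η z) * exp (q z) := fun z => by
    rw [← exp_add]; simp [hη]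
  set c := 8 * π - 2 * F with hc
  have hN : (exp s1 * (8 * π * A s1 - 0 * A s1 ^ 2) - B s1 * (c - θ * B s1)) -
      (exp s0 * (8 * π * A s0 - 0 * A s0 ^ 2) - B s0 * (c - θ * B s0)) ≤ -0 * (s1 - s0) := by
    set M := 1 + A s0 + B s0 + exp s1 + 8 * π + |c| with hM
    have := hA0 s0; have := hB0 s0; have := exp_pos s1; have := pi_pos; have := abs_nonneg c
    refine ode_sum (N := fun s => exp s * (8 * π * A s - 0 * A s ^ 2) - B s * (c - θ * B s))
      (A := A) (C := 30 * M ^ 4) hs01 one_pos ?_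
    intro s h hs hsh hh hh1
    have hss : s ≤ s + h := by linarith
    have hAA := hmonoA s0 s hs
    have hBB := hmonoB s0 s hs
    have he : exp s ≤ exp s1 := exp_le_exp.2 (by linarith)
    refine ode_step (M := M) (by linarith) (hA0 _) (hmonoA _ _ hss) (by linarith)
      (hB0 _) (hmonoB _ _ hss) (by linarith) hh hh1 (by linarith) (by linarith)
      (by rw [abs_of_pos (by positivity)]; linarith) (by rw [abs_zero]; linarith) (by linarith)
      (by rw [abs_of_nonneg hθ0]; linarith) le_rfl (by linarith) ?_ ?_ ?_ ?_
    · refine le_diff (hslo _).measurableSet (hslo _).measurableSet (sl_anti hss)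
        (iu.mono_set (hslG s)) (iq.mono_set (hslG s)) _ ?_
      intro z hz _
      rw [hexp]
      exact mul_le_mul_of_nonneg_right (exp_le_exp.2 hz.2.le) (exp_pos _).le
    · refine diff_le (hslo _).measurableSet (hslo _).measurableSet (sl_anti hss)
        (iu.mono_set (hslG s)) (iq.mono_set (hslG s)) _ ?_
      intro z hz hz'
      rw [hexp]
      refine mul_le_mul_of_nonneg_right (exp_le_exp.2 ?_) (exp_pos _).le
      by_contra hcon
      exact hz' ⟨hz.1, not_le.1 hcon⟩
    · have h3 := mul_nonneg hθ0 (add_nonneg (hB0 s) (hB0 (s + h)))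
      rw [hc]; linarith
    · have h3 := hlayer s h hs hh
      have h4 : 0 ≤ M * h ^ 2 := mul_nonneg (by linarith) (sq_nonneg h)
      rw [hc]
      have e : (A s - A (s + h)) * (8 * π - (8 * π - 2 * F) - 2 * 0 * A s + 2 * θ * B s) =
        2 * ((θ * B s + F) * (A s - A (s + h))) := by ring
      rw [e]
      have e2 : h * (8 * π * A (s + h) - 0 * A (s + h) ^ 2 + 0) = 2 * (4 * π * h * A (s + h)) := by ring
      rw [e2]; linarith
  rw [hA1, hB1] at hN
  have hmain : B s0 * (c - θ * B s0) ≤ 8 * π * exp s0 * A s0 := by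
    have e : exp s0 * (8 * π * A s0 - 0 * A s0 ^ 2) = 8 * π * exp s0 * A s0 := by ring
    rw [e] at hN; linarith
  have hy := diff_le (hslo s0).measurableSet hGo.measurableSet (hslG s0) iu iq (exp s0) (by
    intro z hz hz'
    rw [hexp]
    refine mul_le_mul_of_nonneg_right (exp_le_exp.2 ?_) (exp_pos _).le
    by_contra hcon
    exact hz' ⟨hz, not_le.1 hcon⟩)
  set m := ∫ z in G, exp (u1 z) with hm
  set Aq := ∫ z in G, exp (q z) with hAq
  have hBm : B s0 ≤ m := setIntegral_mono_set iu (ae_of_all _ fun z => (exp_pos _).le)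
      (hslG s0).eventuallyLE
  set y := m - B s0 with hydef
  have hym : m = B s0 + y := by rw [hydef]; ring
  have hy0 : 0 ≤ y := by linarith
  have hy2 : y ≤ exp s0 * (Aq - A s0) := hy
  have h5 : 0 ≤ θ * (2 * B s0 * y + y ^ 2) :=
    mul_nonneg hθ0 (add_nonneg (mul_nonneg (mul_nonneg two_pos.le (hB0 _)) hy0) (sq_nonneg y))
  have h6 : c * y ≤ 8 * π * y := mul_le_mul_of_nonneg_right (by rw [hc]; linarith) hy0
  have h7 : 8 * π * y ≤ 8 * π * (exp s0 * (Aq - A s0)) :=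
    mul_le_mul_of_nonneg_left hy2 (by positivity)
  calc m * (c - θ * m) = B s0 * (c - θ * B s0) + c * y - θ * (2 * B s0 * y + y ^ 2) := by
        rw [hym]; ring
    _ ≤ 8 * π * exp s0 * A s0 + 8 * π * (exp s0 * (Aq - A s0)) := by linarith
    _ = 8 * π * exp s0 * Aq := by ring

lemma bol_step (n : Nod u1 u2 f g Ω) {τ t h C θ : ℝ} (hτ : 0 < τ) (hτt : τ < t) (hh : 0 < h) (hC0 : 0 < C)
    (hC : ∀ z ∈ Ω, τ ≤ u2 z - u1 z → |lp u1 z| ≤ C * (exp (u2 z) - exp (u1 z)))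
    (hθ0 : 0 ≤ θ) (hθ1 : θ ≤ 1)
    (hθ : ∀ z ∈ sl Ω (fun z => u2 z - u1 z) t, exp (u1 z) - f z ≤ θ * exp (u1 z) + g z) :
    h * ((∫ z in sl Ω (fun z => u2 z - u1 z) (t + h), exp (u1 z)) *
      (8 * π - 2 * (∫ z in Ω, g z) -
        θ * ∫ z in sl Ω (fun z => u2 z - u1 z) (t + h), exp (u1 z))) ≤
    2 * exp (2 * (C * h)) *
      (((∫ z in sl Ω (fun z => u2 z - u1 z) t, exp (u2 z)) -
        (∫ z in sl Ω (fun z => u2 z - u1 z) t, exp (u1 z))) *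
      ((∫ z in sl Ω (fun z => u2 z - u1 z) t, exp (u1 z)) -
        (∫ z in sl Ω (fun z => u2 z - u1 z) (t + h), exp (u1 z)))) := by
  have ht : 0 < t := hτ.trans hτt
  have key : ∀ ε > 0, h * ((∫ z in sl Ω (fun z => u2 z - u1 z) (t + h), exp (u1 z)) *
      (8 * π - 2 * (∫ z in Ω, g z) -
        θ * ∫ z in sl Ω (fun z => u2 z - u1 z) (t + h), exp (u1 z))) ≤
    2 * exp (2 * (C * h + 2 * ε)) *
      (((∫ z in sl Ω (fun z => u2 z - u1 z) t, exp (u2 z)) -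
        (∫ z in sl Ω (fun z => u2 z - u1 z) t, exp (u1 z))) *
      ((∫ z in sl Ω (fun z => u2 z - u1 z) t, exp (u1 z)) -
        (∫ z in sl Ω (fun z => u2 z - u1 z) (t + h), exp (u1 z)))) := by
    intro ε hε
    obtain ⟨P, hP⟩ := n.approx hτ hτt hC0 hC hε
    obtain ⟨Φ, hΦ, hΦn⟩ := exists_holo P
    have hslΩ : ∀ s, sl Ω (fun z => u2 z - u1 z) s ⊆ Ω := fun s z hz => hz.1
    have hslo : ∀ s, IsOpen (sl Ω (fun z => u2 z - u1 z) s) :=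
      fun s => isOpen_sl n.hO n.hφ.continuous s
    have hs0 : 0 < C * h + 2 * ε := by positivity
    have hin := n.bol_inner (t := t + h) (by linarith) hs0 hθ0 hθ1
      (fun z hz => hθ z (sl_anti (by linarith) hz)) P (by
        intro z hz hzt
        have := (abs_lt.1 (hP z hz (by linarith))).1
        rw [hzt] at this
        have e : C * (t + h - t) = C * h := by ring
        rw [e] at this; linarith)
    have hl := layer n.hO n.hφ hh (n.hK t ht)
      (R := fun z => exp (u2 z) - exp (u1 z))
      ((n.i2.mono_set (hslΩ t)).sub (n.i1.mono_set (hslΩ t)))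
      (fun z hz => sub_nonneg.2 (exp_le_exp.2 (n.hpos z hz.1).le))
      (fun z _ => by rw [n.lpφ]; linarith) hΦ
    simp only [hΦn] at hl
    rw [integral_sub (n.i2.mono_set (hslΩ t)) (n.i1.mono_set (hslΩ t))] at hl
    have iq : IntegrableOn (fun z => exp (P.eval z).re) (sl Ω (fun z => u2 z - u1 z) t) := by
      have hc : Continuous (fun z : ℂ => exp (P.eval z).re) :=
        (Complex.continuous_re.comp P.continuous).rexp
      exact (hc.continuousOn.integrableOn_compact (n.hK t ht)).mono_set fun z hz => ⟨hz.1, hz.2.le⟩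
    have hd := diff_le (hslo (t + h)).measurableSet (hslo t).measurableSet
      (sl_anti (by linarith)) iq (n.i1.mono_set (hslΩ t)) (exp (C * h + 2 * ε)) (by
        intro z hz hz'
        rw [← exp_add, exp_le_exp]
        have h1 := (abs_lt.1 (hP z hz.1 hz.2.le)).2
        have h2 : u2 z - u1 z ≤ t + h := by
          by_contra hcon
          exact hz' ⟨hz.1, not_le.1 hcon⟩
        have h3 : C * (u2 z - u1 z - t) ≤ C * h := mul_le_mul_of_nonneg_left (by linarith) hC0.le
        linarith)
    have hm0 : 0 ≤ (∫ z in sl Ω (fun z => u2 z - u1 z) t, exp (u2 z)) -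
        (∫ z in sl Ω (fun z => u2 z - u1 z) t, exp (u1 z)) := by
      rw [← integral_sub (n.i2.mono_set (hslΩ t)) (n.i1.mono_set (hslΩ t))]
      exact setIntegral_nonneg (hslo t).measurableSet
        fun z hz => sub_nonneg.2 (exp_le_exp.2 (n.hpos z hz.1).le)
    have h1 := mul_le_mul_of_nonneg_left hin hh.le
    have h2 := mul_le_mul_of_nonneg_left hd hm0
    have h3 := mul_le_mul_of_nonneg_left (hl.trans h2) (by positivity : 0 ≤ 2 * exp (C * h + 2 * ε))
    have e : exp (2 * (C * h + 2 * ε)) = exp (C * h + 2 * ε) * exp (C * h + 2 * ε) := by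
      rw [← exp_add]; ring_nf
    rw [e]
    linarith
  have hc : Continuous fun ε : ℝ => 2 * exp (2 * (C * h + 2 * ε)) *
      (((∫ z in sl Ω (fun z => u2 z - u1 z) t, exp (u2 z)) -
        (∫ z in sl Ω (fun z => u2 z - u1 z) t, exp (u1 z))) *
      ((∫ z in sl Ω (fun z => u2 z - u1 z) t, exp (u1 z)) -
        (∫ z in sl Ω (fun z => u2 z - u1 z) (t + h), exp (u1 z)))) := by fun_prop
  have hlim := hc.tendsto 0
  rw [mul_zero, add_zero] at hlim
  refine ge_of_tendsto (hlim.mono_left (nhdsWithin_le_nhds (s := Set.Ioi 0))) ?_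
  filter_upwards [self_mem_nhdsWithin] with ε hε
  exact key ε hε

end Nod
end Ons

namespace Ons
namespace Nod
variable {u1 u2 f g : ℂ → ℝ} {Ω : Set ℂ}

lemma sl_int (n : Nod u1 u2 f g Ω) {u : ℂ → ℝ} (hu : IntegrableOn (fun z => exp (u z)) Ω) :
    (∀ s, 0 ≤ ∫ z in sl Ω (fun z => u2 z - u1 z) s, exp (u z)) ∧
    (∀ s s', s ≤ s' → (∫ z in sl Ω (fun z => u2 z - u1 z) s', exp (u z)) ≤
      ∫ z in sl Ω (fun z => u2 z - u1 z) s, exp (u z)) := by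
  constructor
  · intro s
    exact setIntegral_nonneg (isOpen_sl n.hO n.hφ.continuous s).measurableSet
      fun z _ => (exp_pos _).le
  · intro s s' h
    exact setIntegral_mono_set (hu.mono_set fun z hz => hz.1)
      (ae_of_all _ fun z => (exp_pos _).le) (sl_anti h).eventuallyLE

lemma N_step (n : Nod u1 u2 f g Ω) {t0 t1 θ c : ℝ} (ht0 : 0 < t0) (ht : t0 < t1) (hθ0 : 0 ≤ θ) (hθ1 : θ ≤ 1)
    (hθ : ∀ z ∈ sl Ω (fun z => u2 z - u1 z) t0, exp (u1 z) - f z ≤ θ * exp (u1 z) + g z)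
    (hc : c = 8 * π - 2 * ∫ z in Ω, g z)
    {m1 m2 : ℝ → ℝ} (hm1 : m1 = fun t => ∫ z in sl Ω (fun z => u2 z - u1 z) t, exp (u1 z))
    (hm2 : m2 = fun t => ∫ z in sl Ω (fun z => u2 z - u1 z) t, exp (u2 z)) :
    (exp t1 * (c * m1 t1 - 1 * m1 t1 ^ 2) - m2 t1 * (c - 1 * m2 t1)) -
    (exp t0 * (c * m1 t0 - 1 * m1 t0 ^ 2) - m2 t0 * (c - 1 * m2 t0)) ≤
      -((1 - θ) * m1 t1 ^ 2) * (t1 - t0) := by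
  obtain ⟨C, hC0, hC⟩ := n.exC (half_pos ht0)
  have hslo : ∀ s, IsOpen (sl Ω (fun z => u2 z - u1 z) s) :=
    fun s => isOpen_sl n.hO n.hφ.continuous s
  have hA0 : ∀ s, 0 ≤ m1 s := by rw [hm1]; exact (n.sl_int n.i1).1
  have hB0 : ∀ s, 0 ≤ m2 s := by rw [hm2]; exact (n.sl_int n.i2).1
  have hA : ∀ s s', s ≤ s' → m1 s' ≤ m1 s := by rw [hm1]; exact (n.sl_int n.i1).2
  have hB : ∀ s s', s ≤ s' → m2 s' ≤ m2 s := by rw [hm2]; exact (n.sl_int n.i2).2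
  have hAB : ∀ s, m1 s ≤ m2 s := by
    intro s
    rw [hm1, hm2]
    exact setIntegral_mono_on (n.i1.mono_set fun z hz => hz.1) (n.i2.mono_set fun z hz => hz.1)
      (hslo s).measurableSet fun z hz => exp_le_exp.2 (n.hpos z hz.1).le
  set M0 := 1 + m1 t0 + m2 t0 + exp t1 + |c| with hM0
  have a1 := hA0 t0; have a2 := hB0 t0; have a3 := exp_pos t1; have a4 := abs_nonneg c
  have hM01 : 1 ≤ M0 := by linarith
  set M := M0 + M0 ^ 2 * (4 * C + 1) with hM
  have hMM : M0 + M0 ^ 2 ≤ M := by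
    have : 0 ≤ M0 ^ 2 * (4 * C) := by positivity
    rw [hM]; linarith
  have hM0sq : 0 ≤ M0 ^ 2 := sq_nonneg _
  have hθ' : 0 ≤ 1 - θ := by linarith
  refine ode_sum (N := fun t => exp t * (c * m1 t - 1 * m1 t ^ 2) - m2 t * (c - 1 * m2 t))
      (A := m1) (C := 30 * M ^ 4) ht one_pos ?_
  intro s h hs hsh hh hh1
  have hss : s ≤ s + h := by linarith
  have hAA := hA t0 s hs
  have hBB := hB t0 s hs
  have he : exp s ≤ exp t1 := exp_le_exp.2 (by linarith)
  have hν : m1 t1 ^ 2 ≤ m1 (s + h) ^ 2 := pow_le_pow_left₀ (hA0 _) (hA _ _ hsh) 2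
  have haM : m1 (s + h) ≤ M0 := by have := hA s (s + h) hss; linarith
  have hνM : m1 (s + h) ^ 2 ≤ M0 ^ 2 := pow_le_pow_left₀ (hA0 _) haM 2
  have hν1 : (1 - θ) * m1 t1 ^ 2 ≤ (1 - θ) * m1 (s + h) ^ 2 := mul_le_mul_of_nonneg_left hν hθ'
  have hν2 : (1 - θ) * m1 (s + h) ^ 2 ≤ 1 * m1 (s + h) ^ 2 :=
    mul_le_mul_of_nonneg_right (by linarith) (sq_nonneg _)
  refine ode_step (M := M) (by linarith) (hA0 _) (hA _ _ hss) (by linarith)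
      (hB0 _) (hB _ _ hss) (by linarith) hh hh1 (by linarith) (by linarith)
      (by linarith) (by rw [abs_one]; linarith) (by linarith)
      (by rw [abs_one]; linarith) (mul_nonneg hθ' (sq_nonneg _)) (by linarith) ?_ ?_ ?_ ?_
  · rw [hm1, hm2]
    refine le_diff (hslo _).measurableSet (hslo _).measurableSet (sl_anti hss)
        (n.i2.mono_set fun z hz => hz.1) (n.i1.mono_set fun z hz => hz.1) _ ?_
    intro z hz _
    rw [← exp_add, exp_le_exp]
    have := hz.2; linarith
  · rw [hm1, hm2]
    refine diff_le (hslo _).measurableSet (hslo _).measurableSet (sl_anti hss)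
        (n.i2.mono_set fun z hz => hz.1) (n.i1.mono_set fun z hz => hz.1) _ ?_
    intro z hz hz'
    rw [← exp_add, exp_le_exp]
    have : u2 z - u1 z ≤ s + h := by
      by_contra hcon
      exact hz' ⟨hz.1, not_le.1 hcon⟩
    linarith
  · have := hAB s; have := hAB (s + h); linarith
  · have hb := n.bol_step (τ := t0 / 2) (t := s) (h := h) (half_pos ht0) (by linarith) hh hC0 hC
      hθ0 hθ1 (fun z hz => hθ z (sl_anti hs hz))
    have hb' : h * (m1 (s + h) * (c - θ * m1 (s + h))) ≤
      2 * exp (2 * (C * h)) * ((m2 s - m1 s) * (m1 s - m1 (s + h))) := by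
      rw [hm1, hm2, hc]; exact hb
    set X := m1 (s + h) * (c - θ * m1 (s + h)) with hX
    set Y := (m2 s - m1 s) * (m1 s - m1 (s + h)) with hY
    have hY0 : 0 ≤ Y := mul_nonneg (sub_nonneg.2 (hAB s)) (sub_nonneg.2 (hA _ _ hss))
    have hXM : X ≤ 2 * M0 ^ 2 := by
      have h1 : c - θ * m1 (s + h) ≤ M0 := by
        have := le_abs_self c; have := mul_nonneg hθ0 (hA0 (s + h)); linarith
      have h2 : X ≤ m1 (s + h) * M0 := mul_le_mul_of_nonneg_left h1 (hA0 _)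
      have h3 : m1 (s + h) * M0 ≤ M0 * M0 := mul_le_mul_of_nonneg_right haM (by linarith)
      nlinarith
    have h1 : h * (c * m1 (s + h) - 1 * m1 (s + h) ^ 2 + (1 - θ) * m1 t1 ^ 2) ≤ h * X := by
      refine mul_le_mul_of_nonneg_left ?_ hh.le
      rw [hX]; linarith
    have h2 : (m1 s - m1 (s + h)) * (c - c - 2 * 1 * m1 s + 2 * 1 * m2 s) = 2 * Y := by
      rw [hY]; ring
    rw [h2]
    refine le_trans (sub_le_sub_right h1 _) ?_
    have hMh : 0 ≤ M * h ^ 2 := mul_nonneg (by linarith) (sq_nonneg h)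
    rcases le_or_gt X 0 with hX0 | hX0
    · have : h * X ≤ 0 := mul_nonpos_of_nonneg_of_nonpos hh.le hX0
      linarith
    · have h3 : 1 - 2 * (C * h) ≤ exp (-(2 * (C * h))) := by
        have := add_one_le_exp (-(2 * (C * h))); linarith
      have h4 : exp (-(2 * (C * h))) * (h * X) ≤ 2 * Y := by
        have := mul_le_mul_of_nonneg_left hb' (exp_pos (-(2 * (C * h)))).le
        have e : exp (-(2 * (C * h))) * (2 * exp (2 * (C * h)) * Y) = 2 * Y := by
          have : exp (-(2 * (C * h))) * exp (2 * (C * h)) = 1 := by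
            rw [← exp_add, neg_add_cancel, exp_zero]
          linear_combination 2 * Y * this
        linarith
      have h5 : (1 - 2 * (C * h)) * (h * X) ≤ 2 * Y :=
        (mul_le_mul_of_nonneg_right h3 (mul_pos hh hX0).le).trans h4
      have h6 : 2 * C * h ^ 2 * X ≤ 2 * C * h ^ 2 * (2 * M0 ^ 2) :=
        mul_le_mul_of_nonneg_left hXM (by positivity)
      have h7 : M0 ^ 2 * (4 * C) * h ^ 2 ≤ M * h ^ 2 :=
        mul_le_mul_of_nonneg_right (by rw [hM]; linarith) (sq_nonneg h)
      linarith

/-- lower bound of the total mass of a nodal domain -/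
theorem mass (n : Nod u1 u2 f g Ω) : 8 * π - 2 * (∫ z in Ω, g z) ≤ (∫ z in Ω, exp (u1 z)) + (∫ z in Ω, exp (u2 z)) ∧
    ((∀ z ∈ Ω, 0 < f z) →
    8 * π - 2 * (∫ z in Ω, g z) < (∫ z in Ω, exp (u1 z)) + (∫ z in Ω, exp (u2 z))) := by
  set c := 8 * π - 2 * ∫ z in Ω, g z with hc
  set m1 : ℝ → ℝ := fun t => ∫ z in sl Ω (fun z => u2 z - u1 z) t, exp (u1 z) with hm1
  set m2 : ℝ → ℝ := fun t => ∫ z in sl Ω (fun z => u2 z - u1 z) t, exp (u2 z) with hm2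
  set N : ℝ → ℝ := fun t => exp t * (c * m1 t - 1 * m1 t ^ 2) - m2 t * (c - 1 * m2 t) with hN
  obtain ⟨z0, hz0⟩ := n.hne
  set φ0 := u2 z0 - u1 z0 with hφ0
  have hφ0p : 0 < φ0 := sub_pos.2 (n.hpos z0 hz0)
  have hslo : ∀ s, IsOpen (sl Ω (fun z => u2 z - u1 z) s) :=
    fun s => isOpen_sl n.hO n.hφ.continuous s
  -- top
  obtain ⟨T, hT⟩ := (n.hK φ0 hφ0p).bddAbove_image n.hφ.continuous.continuousOn
  have hemp : ∀ t, φ0 ≤ t → T ≤ t → sl Ω (fun z => u2 z - u1 z) t = ∅ := by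
    intro t h1 h2
    ext z
    simp only [Set.mem_empty_iff_false, iff_false]
    rintro ⟨h3, h4⟩
    have : u2 z - u1 z ≤ T := hT ⟨z, ⟨h3, h1.trans h4.le⟩, rfl⟩
    linarith
  have hNtop : ∀ t, φ0 ≤ t → T ≤ t → N t = 0 := by
    intro t h1 h2
    simp only [hN, hm1, hm2, hemp t h1 h2, setIntegral_empty]; ring
  have hθ1 : ∀ z, exp (u1 z) - f z ≤ 1 * exp (u1 z) + g z := fun z => by
    have := n.hgf z; linarith
  have hmono : ∀ t0 t1, 0 < t0 → t0 < t1 → N t1 ≤ N t0 := by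
    intro t0 t1 h0 h1
    have := n.N_step h0 h1 zero_le_one le_rfl (fun z _ => hθ1 z) hc hm1 hm2
    simp only [hN]
    linarith
  have hN0 : ∀ t, 0 < t → 0 ≤ N t := by
    intro t ht
    set t1 := max (t + 1) (max φ0 T)
    have h1 : t < t1 := lt_of_lt_of_le (by linarith) (le_max_left _ _)
    have := hmono t t1 ht h1
    rwa [hNtop t1 ((le_max_left _ _).trans (le_max_right _ _))
      ((le_max_right _ _).trans (le_max_right _ _))] at this
  -- limits
  have hlim : ∀ u : ℂ → ℝ, IntegrableOn (fun z => exp (u z)) Ω →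
      Tendsto (fun k : ℕ => ∫ z in sl Ω (fun z => u2 z - u1 z) (1 / ((k:ℝ) + 1)), exp (u z)) atTop
        (𝓝 (∫ z in Ω, exp (u z))) := by
    intro u hu
    have hUn : (⋃ k : ℕ, sl Ω (fun z => u2 z - u1 z) (1 / ((k:ℝ) + 1))) = Ω := by
      ext z
      simp only [Set.mem_iUnion]
      constructor
      · rintro ⟨k, hk⟩; exact hk.1
      · intro hz
        obtain ⟨k, hk⟩ := exists_nat_one_div_lt (sub_pos.2 (n.hpos z hz))
        exact ⟨k, hz, hk⟩
    have := tendsto_setIntegral_of_monotone (μ := volume) (f := fun z => exp (u z))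
      (s := fun k : ℕ => sl Ω (fun z => u2 z - u1 z) (1 / ((k:ℝ) + 1)))
      (fun k => (hslo _).measurableSet)
      (fun k l hkl => sl_anti (one_div_le_one_div_of_le (by positivity) (by
        have : (k:ℝ) ≤ l := by exact_mod_cast hkl
        linarith)))
      (by rw [hUn]; exact hu)
    rwa [hUn] at this
  set M1 := ∫ z in Ω, exp (u1 z) with hM1
  set M2 := ∫ z in Ω, exp (u2 z) with hM2
  have hl1 := hlim u1 n.i1
  have hl2 := hlim u2 n.i2
  have hlN : Tendsto (fun k : ℕ => N (1 / ((k:ℝ) + 1))) atTop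
      (𝓝 (exp 0 * (c * M1 - 1 * M1 ^ 2) - M2 * (c - 1 * M2))) := by
    have he : Tendsto (fun k : ℕ => exp (1 / ((k:ℝ) + 1))) atTop (𝓝 (exp 0)) :=
      (continuous_exp.tendsto 0).comp tendsto_one_div_add_atTop_nhds_zero_nat
    exact (he.mul ((hl1.const_mul c).sub ((hl1.pow 2).const_mul 1))).sub
      (hl2.mul ((tendsto_const_nhds (x := c)).sub (hl2.const_mul 1)))
  have eN : exp 0 * (c * M1 - 1 * M1 ^ 2) - M2 * (c - 1 * M2) = (M2 - M1) * (M1 + M2 - c) := by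
    rw [exp_zero]; ring
  rw [eN] at hlN
  have hM12 : 0 < M2 - M1 := by
    rw [hM1, hM2, ← integral_sub n.i2 n.i1]
    rw [setIntegral_pos_iff_support_of_nonneg_ae]
    · have : Function.support (fun z => exp (u2 z) - exp (u1 z)) ∩ Ω = Ω := by
        refine Set.inter_eq_right.2 fun z hz => ?_
        exact (sub_pos.2 (exp_lt_exp.2 (n.hpos z hz))).ne'
      rw [this]
      exact n.hO.measure_pos _ ⟨z0, hz0⟩
    · refine (ae_restrict_iff' n.hO.measurableSet).2 (ae_of_all _ fun z hz => ?_)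
      exact sub_nonneg.2 (exp_le_exp.2 (n.hpos z hz).le)
    · exact n.i2.sub n.i1
  constructor
  · have h0 : 0 ≤ (M2 - M1) * (M1 + M2 - c) :=
      ge_of_tendsto' hlN fun k => hN0 _ (by positivity)
    have := nonneg_of_mul_nonneg_right h0 hM12
    linarith
  · intro hfpos
    have hK := n.hK (φ0 / 4) (by positivity)
    obtain ⟨θ, hθ0, hθl, hθ⟩ : ∃ θ : ℝ, 0 ≤ θ ∧ θ < 1 ∧ ∀ z ∈ Ω, φ0 / 4 ≤ u2 z - u1 z →
        exp (u1 z) - f z ≤ θ * exp (u1 z) + g z := by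
      have hcont : ContinuousOn (fun z => f z / exp (u1 z)) {z | z ∈ Ω ∧ φ0 / 4 ≤ u2 z - u1 z} :=
        (n.hf.div n.hu1.continuous.rexp fun z => (exp_pos _).ne').continuousOn
      obtain ⟨p, hp, hpm⟩ := hK.exists_isMinOn ⟨z0, hz0, by linarith⟩ hcont
      set d := f p / exp (u1 p) with hd
      have hdp : 0 < d := div_pos (hfpos p hp.1) (exp_pos _)
      refine ⟨max 0 (1 - d), le_max_left _ _, max_lt one_pos (by linarith), ?_⟩
      intro z hz hz2
      have h1 : d ≤ f z / exp (u1 z) := hpm ⟨hz, hz2⟩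
      rw [le_div_iff₀ (exp_pos _)] at h1
      have h2 : (1 - d) * exp (u1 z) ≤ max 0 (1 - d) * exp (u1 z) :=
        mul_le_mul_of_nonneg_right (le_max_right _ _) (exp_pos _).le
      have := n.hg0 z
      linarith
    have hstep := n.N_step (t0 := φ0 / 4) (t1 := φ0 / 2) (by positivity) (by linarith) hθ0 hθl.le
      (fun z hz => hθ z hz.1 hz.2.le) hc hm1 hm2
    have hm1p : 0 < m1 (φ0 / 2) := by
      simp only [hm1]
      rw [setIntegral_pos_iff_support_of_nonneg_ae]
      · have : Function.support (fun z => exp (u1 z)) ∩ sl Ω (fun z => u2 z - u1 z) (φ0 / 2)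
            = sl Ω (fun z => u2 z - u1 z) (φ0 / 2) :=
          Set.inter_eq_right.2 fun z hz => (exp_pos _).ne'
        rw [this]
        exact (hslo _).measure_pos _ ⟨z0, hz0, half_lt_self hφ0p⟩
      · exact ae_of_all _ fun z => (exp_pos _).le
      · exact n.i1.mono_set fun z hz => hz.1
    set δ := (1 - θ) * m1 (φ0 / 2) ^ 2 * (φ0 / 2 - φ0 / 4) with hδ
    have hδp : 0 < δ := mul_pos (mul_pos (by linarith) (pow_pos hm1p 2)) (by linarith)
    have hNd : δ ≤ N (φ0 / 4) := by
      have h1 : N (φ0 / 2) - N (φ0 / 4) ≤ -((1 - θ) * m1 (φ0 / 2) ^ 2) * (φ0 / 2 - φ0 / 4) := hstep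
      have := hN0 (φ0 / 2) (by positivity)
      rw [hδ]; linarith
    have h0 : δ ≤ (M2 - M1) * (M1 + M2 - c) := by
      refine ge_of_tendsto hlN ?_
      have hev : ∀ᶠ k : ℕ in atTop, 1 / ((k:ℝ) + 1) < φ0 / 4 :=
        tendsto_one_div_add_atTop_nhds_zero_nat.eventually (gt_mem_nhds (by positivity))
      filter_upwards [hev] with k hk
      exact hNd.trans (hmono _ _ (by positivity) hk)
    have := (mul_pos_iff_of_pos_left hM12).1 (hδp.trans_le h0)
    linarith

end Nod
end Ons

namespace Ons

lemma cc_closed {F : Set ℂ} (hF : IsClosed F) (x : ℂ) : IsClosed (connectedComponentIn F x) := by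
  by_cases hx : x ∈ F
  · refine isClosed_of_closure_subset ?_
    refine (isPreconnected_connectedComponentIn.closure).subset_connectedComponentIn
      (subset_closure (mem_connectedComponentIn hx)) ?_
    exact closure_minimal (connectedComponentIn_subset F x) hF
  · rw [connectedComponentIn_eq_empty hx]; exact isClosed_empty

lemma hole_touch {Ω : Set ℂ} (hΩ : IsOpen Ω) (hne : Ω.Nonempty) {x : ℂ} (hx : x ∉ Ω) :
    (connectedComponentIn Ωᶜ x ∩ closure Ω).Nonempty := by
  by_contra hcon
  rw [Set.not_nonempty_iff_eq_empty] at hcon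
  have hcl := cc_closed hΩ.isClosed_compl x
  have hop : IsOpen (connectedComponentIn Ωᶜ x) := by
    rw [isOpen_iff_mem_nhds]
    intro y hy
    have hy2 : y ∉ closure Ω := fun h => by
      have : y ∈ connectedComponentIn Ωᶜ x ∩ closure Ω := ⟨hy, h⟩
      rw [hcon] at this; exact this
    obtain ⟨r, hr, hb⟩ := Metric.isOpen_iff.1 isClosed_closure.isOpen_compl y hy2
    rw [connectedComponentIn_eq hy]
    refine mem_of_superset (ball_mem_nhds y hr) ?_
    refine (convex_ball y r).isPreconnected.subset_connectedComponentIn (mem_ball_self hr) ?_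
    exact hb.trans (Set.compl_subset_compl.2 subset_closure)
  have := IsClopen.eq_univ ⟨hcl, hop⟩ ⟨x, mem_connectedComponentIn hx⟩
  obtain ⟨y, hy⟩ := hne
  exact connectedComponentIn_subset Ωᶜ x (this ▸ Set.mem_univ y) hy

def hull (Ω : Set ℂ) : Set ℂ := (connectedComponentIn Ωᶜ 0)ᶜ

section
variable {Ω Ω1 Ω2 : Set ℂ}

lemma hull_open (hΩ : IsOpen Ω) : IsOpen (hull Ω) := (cc_closed hΩ.isClosed_compl 0).isOpen_compl

lemma sub_hull : Ω ⊆ hull Ω := fun _ hz h => connectedComponentIn_subset _ _ h hz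

lemma hull_H (h : ∀ z ∈ Ω, 0 < z.im) : ∀ z ∈ hull Ω, 0 < z.im := by
  intro z hz
  by_contra hcon
  refine hz ?_
  have hc : Convex ℝ {z : ℂ | z.im ≤ 0} := convex_halfSpace_im_le 0
  refine hc.isPreconnected.subset_connectedComponentIn (x := 0) (by simp) ?_ (not_lt.1 hcon)
  intro y hy hy2
  exact absurd (h y hy2) (not_lt.2 hy)

lemma hull_dich (hc : IsPreconnected Ω2) (hd : Disjoint Ω2 Ω1) :
    Ω2 ⊆ hull Ω1 ∨ Disjoint Ω2 (hull Ω1) := by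
  by_cases h : ∃ x ∈ Ω2, x ∈ connectedComponentIn Ω1ᶜ 0
  · right
    obtain ⟨x, hx, hx2⟩ := h
    have : Ω2 ⊆ connectedComponentIn Ω1ᶜ 0 := by
      rw [connectedComponentIn_eq hx2]
      exact hc.subset_connectedComponentIn hx fun y hy hy2 => Set.disjoint_left.1 hd hy hy2
    exact Set.disjoint_left.2 fun y hy hy2 => hy2 (this hy)
  · left
    push Not at h
    exact fun x hx => h x hx

lemma hull_mono (h0 : (0:ℂ) ∉ Ω1) (h : Ω2 ⊆ hull Ω1) : hull Ω2 ⊆ hull Ω1 := by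
  refine Set.compl_subset_compl.2 ?_
  refine isPreconnected_connectedComponentIn.subset_connectedComponentIn
    (mem_connectedComponentIn h0) ?_
  exact fun y hy hy2 => h hy2 hy

lemma hull_disj (ho : IsOpen Ω1) (hc : IsPreconnected Ω1) (hne : Ω1.Nonempty)
    (h1 : Disjoint Ω2 (hull Ω1)) (h2 : Disjoint Ω1 (hull Ω2)) : Disjoint (hull Ω1) (hull Ω2) := by
  rw [Set.disjoint_left]
  intro x hx1 hx2
  have hxΩ1 : x ∉ Ω1 := fun h => Set.disjoint_left.1 h2 h hx2
  obtain ⟨p, hp, hp2⟩ := hole_touch ho hne hxΩ1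
  set Q := connectedComponentIn Ω1ᶜ x with hQ
  have hQ1 : Q ⊆ hull Ω1 := by
    intro y hy hy2
    refine hx1 ?_
    rw [connectedComponentIn_eq hy2, ← connectedComponentIn_eq hy]
    exact mem_connectedComponentIn hxΩ1
  have hcon : IsPreconnected (Q ∪ (Ω1 ∪ {p})) := by
    refine IsPreconnected.union p hp (Or.inr rfl) isPreconnected_connectedComponentIn ?_
    refine hc.subset_closure Set.subset_union_left ?_
    exact Set.union_subset subset_closure (Set.singleton_subset_iff.2 hp2)
  obtain ⟨y, hy⟩ := hne
  have hy2 : y ∈ connectedComponentIn Ω2ᶜ 0 := by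
    by_contra h; exact Set.disjoint_left.1 h2 hy h
  refine hx2 ?_
  rw [connectedComponentIn_eq hy2]
  refine hcon.subset_connectedComponentIn (Or.inr (Or.inl hy)) ?_
    (Or.inl (mem_connectedComponentIn hxΩ1))
  rintro z hz hz2
  refine Set.disjoint_left.1 h1 hz2 ?_
  rcases hz with hz | hz | hz
  · exact hQ1 hz
  · exact sub_hull hz
  · rw [Set.mem_singleton_iff.1 hz]; exact hQ1 hp

lemma hull_closure (ho : IsOpen Ω1) (hc : IsPreconnected Ω2)
    (hne : Ω2.Nonempty) (hd : Disjoint Ω2 Ω1) (h : Ω2 ⊆ hull Ω1) : closure Ω2 ⊆ hull Ω1 := by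
  obtain ⟨y, hy⟩ := hne
  have h1 : Ω2 ⊆ connectedComponentIn Ω1ᶜ y :=
    hc.subset_connectedComponentIn hy fun z hz hz2 => Set.disjoint_left.1 hd hz hz2
  have h2 := closure_minimal h1 (cc_closed ho.isClosed_compl y)
  intro z hz hz2
  refine h hy ?_
  rw [connectedComponentIn_eq hz2, ← connectedComponentIn_eq (h2 hz)]
  exact h1 hy

lemma hull_bdry {p : ℂ} (hp : p ∈ closure (hull Ω)) (hp2 : p ∉ hull Ω) : p ∈ closure Ω := by
  by_contra hcon
  obtain ⟨r, hr, hb⟩ := Metric.isOpen_iff.1 isClosed_closure.isOpen_compl p hcon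
  obtain ⟨y, hy, hy2⟩ := Metric.mem_closure_iff.1 hp r hr
  have hp3 : p ∈ connectedComponentIn Ωᶜ 0 := not_not.1 hp2
  refine hy ?_
  rw [connectedComponentIn_eq hp3]
  refine (convex_ball p r).isPreconnected.subset_connectedComponentIn (mem_ball_self hr)
    (hb.trans (Set.compl_subset_compl.2 subset_closure)) ?_
  rwa [mem_ball, dist_comm]

end

def ND (D Ω : Set ℂ) : Prop := ∃ z ∈ D, Ω = connectedComponentIn D z

section
variable {D Ω Ω' : Set ℂ}

lemma ND.op (hD : IsOpen D) (h : ND D Ω) : IsOpen Ω := by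
  obtain ⟨z, _, rfl⟩ := h; exact hD.connectedComponentIn
lemma ND.sub (h : ND D Ω) : Ω ⊆ D := by
  obtain ⟨z, _, rfl⟩ := h; exact connectedComponentIn_subset _ _
lemma ND.conn (h : ND D Ω) : IsPreconnected Ω := by
  obtain ⟨z, _, rfl⟩ := h; exact isPreconnected_connectedComponentIn
lemma ND.ne (h : ND D Ω) : Ω.Nonempty := by
  obtain ⟨z, hz, rfl⟩ := h; exact ⟨z, mem_connectedComponentIn hz⟩
lemma ND.eq_cc (h : ND D Ω) {x : ℂ} (hx : x ∈ Ω) : Ω = connectedComponentIn D x := by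
  obtain ⟨z, hz, rfl⟩ := h; exact connectedComponentIn_eq hx
lemma ND.eq_of (h : ND D Ω) (h' : ND D Ω') {x : ℂ} (hx : x ∈ Ω) (hx' : x ∈ Ω') : Ω = Ω' := by
  rw [h.eq_cc hx, h'.eq_cc hx']
lemma ND.disj (h : ND D Ω) (h' : ND D Ω') (hne : Ω ≠ Ω') : Disjoint Ω Ω' :=
  Set.disjoint_left.2 fun _ hx hx' => hne (h.eq_of h' hx hx')
lemma ND.cl (hD : IsOpen D) (h : ND D Ω) {z : ℂ} (hz : z ∈ closure Ω) (hzD : z ∈ D) : z ∈ Ω := by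
  have h' : ND D (connectedComponentIn D z) := ⟨z, hzD, rfl⟩
  obtain ⟨y, hy, hy2⟩ := mem_closure_iff.1 hz _ (h'.op hD) (mem_connectedComponentIn hzD)
  rw [h.eq_of h' hy2 hy]
  exact mem_connectedComponentIn hzD

theorem topo (hD : IsOpen D) (hH : ∀ z ∈ D, 0 < z.im) (hne : D.Nonempty)
    (hfin : {Ω | ND D Ω}.Finite)
    (smp : ∀ Ω p, ND D Ω → p ∈ closure Ω → p ∉ Ω → 0 < p.im → p ∈ closure (D \ Ω))
    (h0 : ∀ Ω r, ND D Ω → 0 < r → ¬ (∀ z ∈ ball (0:ℂ) r, 0 < z.im → z ∈ Ω)) :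
    ∃ Ω1 Ω2, ND D Ω1 ∧ ND D Ω2 ∧ Disjoint Ω1 Ω2 ∧ IsPreconnected Ω1ᶜ ∧ IsPreconnected Ω2ᶜ := by
  have hz : ∀ Ω, ND D Ω → (0:ℂ) ∉ Ω := fun Ω h h2 => by
    have := hH 0 (h.sub h2); simp at this
  have hHΩ : ∀ Ω, ND D Ω → ∀ z ∈ Ω, 0 < z.im := fun Ω h z hz => hH z (h.sub hz)
  -- Claim 2
  have c2 : ∀ Ω, ND D Ω → ∃ Ω', ND D Ω' ∧ Ω' ⊆ hull Ω ∧ IsPreconnected Ω'ᶜ := by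
    intro Ω hΩ
    have hf : {Ω' | ND D Ω' ∧ Ω' ⊆ hull Ω}.Finite := hfin.subset fun _ h => h.1
    obtain ⟨Ω', ⟨hn, hs⟩, hmin⟩ := Set.Finite.exists_minimalFor hull _ hf ⟨Ω, hΩ, sub_hull⟩
    refine ⟨Ω', hn, hs, ?_⟩
    have hall : ∀ Ω2, ND D Ω2 → Ω2 ≠ Ω' → Disjoint Ω2 (hull Ω') := by
      intro Ω2 h2 hne2
      have hd := h2.disj hn hne2
      rcases hull_dich h2.conn hd with h3 | h3
      · exfalso
        have h4 := hull_mono (hz _ hn) h3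
        have h5 : hull Ω' ⊆ hull Ω2 :=
          hmin ⟨h2, h3.trans (hull_mono (hz _ hΩ) hs)⟩ h4
        -- boundary point
        have hcl := hull_closure (hn.op hD) h2.conn h2.ne hd h3
        obtain ⟨y, hy⟩ := hn.ne
        have hsub : (Set.univ : Set ℂ) ⊆ hull Ω' := by
          refine isPreconnected_univ.subset_of_closure_inter_subset (hull_open (hn.op hD))
            ⟨y, trivial, sub_hull hy⟩ ?_
          rintro p ⟨hp, -⟩
          by_contra hp2
          have hp3 : p ∈ closure (hull Ω2) := closure_mono h5 hp
          have hp4 : p ∉ hull Ω2 := fun h => hp2 (h4 h)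
          exact hp2 (hcl (hull_bdry hp3 hp4))
        have := hull_H (hHΩ _ hn) 0 (hsub trivial)
        simp at this
      · exact h3
    have heq : hull Ω' = Ω' := by
      refine Set.Subset.antisymm ?_ sub_hull
      intro x hx
      by_contra hx2
      obtain ⟨p, hp, hp2⟩ := hole_touch (hn.op hD) hn.ne hx2
      have hpΩ : p ∉ Ω' := connectedComponentIn_subset _ _ hp
      have hph : p ∈ hull Ω' := by
        intro h
        refine hx ?_
        rw [connectedComponentIn_eq h, ← connectedComponentIn_eq hp]
        exact mem_connectedComponentIn hx2
      have h1 := smp Ω' p hn hp2 hpΩ (hull_H (hHΩ _ hn) p hph)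
      obtain ⟨y, hy, hy2⟩ := mem_closure_iff.1 h1 _ (hull_open (hn.op hD)) hph
      have hnd : ND D (connectedComponentIn D y) := ⟨y, hy2.1, rfl⟩
      refine Set.disjoint_left.1 (hall _ hnd fun he => hy2.2 ?_) (mem_connectedComponentIn hy2.1) hy
      rw [← he]; exact mem_connectedComponentIn hy2.1
    have : Ω'ᶜ = connectedComponentIn Ω'ᶜ 0 := by
      have := congrArg compl heq
      rw [hull, compl_compl] at this
      exact this.symm
    rw [this]
    exact isPreconnected_connectedComponentIn
  -- Claim 1
  have c1 : ∃ Ω1 Ω2, ND D Ω1 ∧ ND D Ω2 ∧ Disjoint (hull Ω1) (hull Ω2) := by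
    obtain ⟨z, hzD⟩ := hne
    obtain ⟨Ω, hΩ, hmax⟩ := Set.Finite.exists_maximalFor hull _ hfin ⟨_, z, hzD, rfl⟩
    have hΩ : ND D Ω := hΩ
    by_cases hex : ∃ Ω2, ND D Ω2 ∧ Ω2 ≠ Ω ∧ Disjoint Ω2 (hull Ω)
    · obtain ⟨Ω2, h2, hne2, hd⟩ := hex
      refine ⟨Ω, Ω2, hΩ, h2, hull_disj (hΩ.op hD) hΩ.conn hΩ.ne hd ?_⟩
      rcases hull_dich hΩ.conn (hΩ.disj h2 hne2.symm) with h3 | h3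
      · exfalso
        have h4 := hull_mono (hz _ h2) h3
        have h5 : hull Ω2 ⊆ hull Ω := hmax h2 h4
        obtain ⟨y, hy⟩ := h2.ne
        exact Set.disjoint_left.1 hd hy (h5 (sub_hull hy))
      · exact h3
    · exfalso
      push Not at hex
      have hcl : ∀ Ω2, ND D Ω2 → Ω2 ≠ Ω → closure Ω2 ⊆ hull Ω := by
        intro Ω2 h2 hne2
        have hd := h2.disj hΩ hne2
        rcases hull_dich h2.conn hd with h3 | h3
        · exact hull_closure (hΩ.op hD) h2.conn h2.ne hd h3
        · exact absurd h3 (hex Ω2 h2 hne2)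
      -- the union of the other closures is closed
      have hclosed : IsClosed (⋃ Ω2 ∈ {Ω2 | ND D Ω2 ∧ Ω2 ≠ Ω}, closure Ω2) :=
        (hfin.subset (fun _ h => h.1)).isClosed_biUnion fun _ _ => isClosed_closure
      have hsubU : D \ Ω ⊆ ⋃ Ω2 ∈ {Ω2 | ND D Ω2 ∧ Ω2 ≠ Ω}, closure Ω2 := by
        intro y hy
        refine Set.mem_biUnion (x := connectedComponentIn D y) ⟨⟨y, hy.1, rfl⟩, fun he => hy.2 ?_⟩
          (subset_closure (mem_connectedComponentIn hy.1))
        rw [← he]; exact mem_connectedComponentIn hy.1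
      have hUh : (⋃ Ω2 ∈ {Ω2 | ND D Ω2 ∧ Ω2 ≠ Ω}, closure Ω2) ⊆ hull Ω :=
        Set.iUnion₂_subset fun Ω2 h => hcl Ω2 h.1 h.2
      have hcD := (closure_minimal hsubU hclosed).trans hUh
      obtain ⟨y, hy⟩ := hΩ.ne
      have hHsub : {z : ℂ | 0 < z.im} ⊆ hull Ω := by
        refine (convex_halfSpace_im_gt 0).isPreconnected.subset_of_closure_inter_subset
          (hull_open (hΩ.op hD)) ⟨y, hHΩ _ hΩ y hy, sub_hull hy⟩ ?_
        rintro p ⟨hp, hpH⟩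
        by_contra hp2
        exact hp2 (hcD (smp Ω p hΩ (hull_bdry hp hp2) (fun h => hp2 (sub_hull h)) hpH))
      -- near 0
      have h0c : (0:ℂ) ∉ closure (D \ Ω) := fun h => by
        have := hull_H (hHΩ _ hΩ) 0 (hcD h); simp at this
      obtain ⟨r, hr, hb⟩ := Metric.isOpen_iff.1 isClosed_closure.isOpen_compl 0 h0c
      have hconv : Convex ℝ (ball (0:ℂ) r ∩ {z : ℂ | 0 < z.im}) :=
        (convex_ball 0 r).inter (convex_halfSpace_im_gt 0)
      by_cases hintg : ((ball (0:ℂ) r ∩ {z : ℂ | 0 < z.im}) ∩ Ω).Nonempty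
      · refine h0 Ω r hΩ hr fun z hz1 hz2 => ?_
        refine hconv.isPreconnected.subset_of_closure_inter_subset (hΩ.op hD) hintg ?_ ⟨hz1, hz2⟩
        rintro p ⟨hp, hp1, hp2⟩
        by_contra hpΩ
        exact hb hp1 (smp Ω p hΩ hp hpΩ hp2)
      · have hball : ball (0:ℂ) r ⊆ connectedComponentIn Ωᶜ 0 := by
          refine (convex_ball _ _).isPreconnected.subset_connectedComponentIn (mem_ball_self hr) ?_
          intro z hz hzΩ
          exact hintg ⟨z, ⟨hz, hHΩ _ hΩ z hzΩ⟩, hzΩ⟩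
        have hmem : ((r / 2 : ℝ) * Complex.I : ℂ) ∈ ball (0:ℂ) r := by
          rw [mem_ball, dist_zero_right, norm_mul, Complex.norm_I, mul_one, Complex.norm_real,
            Real.norm_of_nonneg (by positivity)]
          linarith
        refine hHsub (a := ((r / 2 : ℝ) * Complex.I : ℂ)) ?_ (hball hmem)
        show 0 < ((r / 2 : ℝ) * Complex.I : ℂ).im
        simp [hr]
  obtain ⟨Ω1, Ω2, h1, h2, hd⟩ := c1
  obtain ⟨Ω1', h1', hs1, hp1⟩ := c2 Ω1 h1
  obtain ⟨Ω2', h2', hs2, hp2⟩ := c2 Ω2 h2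
  exact ⟨Ω1', Ω2', h1', h2', hd.mono hs1 hs2, hp1, hp2⟩

end
end Ons

namespace Ons

lemma minp {K : Set ℂ} (hK : IsCompact K) {ψ : ℂ → ℝ} (hc : ContinuousOn ψ K)
    (h : ∀ z ∈ K, 0 ≤ ψ z ∨ (K ∈ 𝓝 z ∧ ContDiffAt ℝ 2 ψ z ∧ lp ψ z < 0)) : ∀ z ∈ K, 0 ≤ ψ z := by
  intro z hz
  obtain ⟨p, hp, hmin⟩ := hK.exists_isMinOn ⟨z, hz⟩ hc
  have hpz : ψ p ≤ ψ z := hmin hz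
  rcases h p hp with h1 | ⟨h1, h2, h3⟩
  · linarith
  · have hl : IsLocalMin ψ p := hmin.isLocalMin h1
    have := lp_nonneg_of_min hl h2
    linarith

lemma lp_inv_ns {z : ℂ} (hz : ns z ≠ 0) : lp (fun x => (ns x)⁻¹) z = 4 / ns z ^ 2 := by
  have h1 : ∀ᶠ s in 𝓝 (ns z), HasDerivAt (fun s : ℝ => s⁻¹) (-(s ^ 2)⁻¹) s := by
    filter_upwards [isOpen_ne.mem_nhds hz] with s hs
    exact hasDerivAt_inv hs
  have h2 : HasDerivAt (fun s : ℝ => -(s ^ 2)⁻¹) (2 / ns z ^ 3) (ns z) := by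
    have h3 : HasDerivAt (fun s : ℝ => s ^ 2) (2 * ns z) (ns z) := by
      simpa using hasDerivAt_pow 2 (ns z)
    have := (h3.fun_inv (pow_ne_zero 2 hz)).fun_neg
    refine this.congr_deriv ?_
    field_simp
  rw [lp_radial (g := fun s => s⁻¹) h1 h2]
  field_simp; ring

lemma hopf {φ : ℂ → ℝ} (hφ : ContDiff ℝ 2 φ) {x p : ℂ} {d : ℝ} (hd : 0 < d)
    (hpos : ∀ z ∈ ball x d, 0 < φ z) (hl : ∀ z ∈ ball x d, lp φ z ≤ 0) (hp : dist p x = d)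
    (hp0 : φ p = 0) : 0 < dd (x - p) φ p := by
  have hns : ∀ z, ns (z - x) = dist z x ^ 2 := fun z => by rw [ns_eq, dist_eq_norm]
  -- min on the inner circle
  have hsph : IsCompact (sphere x (d / 2)) := isCompact_sphere x _
  have hsne : (sphere x (d / 2)).Nonempty := NormedSpace.sphere_nonempty.2 (by positivity)
  obtain ⟨q, hq, hqm⟩ := hsph.exists_isMinOn hsne hφ.continuous.continuousOn
  have hqb : q ∈ ball x d := by
    rw [mem_ball, mem_sphere.1 hq]; linarith
  set m := φ q with hm
  have hm0 : 0 < m := hpos q hqb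
  set ε := m * d ^ 2 / 6 with hε
  have hε0 : 0 < ε := by positivity
  set K := closedBall x d \ ball x (d / 2) with hKdef
  have hK : IsCompact K := (isCompact_closedBall x d).diff isOpen_ball
  have hcl : ∀ z ∈ closedBall x d, 0 ≤ φ z := by
    intro z hz
    rw [← closure_ball x hd.ne'] at hz
    have : closure (ball x d) ⊆ {z | 0 ≤ φ z} :=
      closure_minimal (fun z hz => (hpos z hz).le) (isClosed_le continuous_const hφ.continuous)
    exact this hz
  set ψ : ℂ → ℝ := fun z => φ z - ε * ((ns (z - x))⁻¹ - (d ^ 2)⁻¹) with hψ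
  have hnz : ∀ z ∈ K, ns (z - x) ≠ 0 := by
    intro z hz
    rw [hns]
    have : d / 2 ≤ dist z x := not_lt.1 hz.2
    have : 0 < dist z x := by linarith
    positivity
  have hcd : ∀ z ∈ K, ContDiffAt ℝ 2 (fun z => (ns (z - x))⁻¹) z := by
    intro z hz
    have h1 : ContDiff ℝ 2 (fun z : ℂ => ns (z - x)) :=
      contDiff_ns.comp (contDiff_id.sub contDiff_const)
    exact h1.contDiffAt.fun_inv (hnz z hz)
  have hcd2 : ∀ z ∈ K, ContDiffAt ℝ 2 (fun z => (ns (z - x))⁻¹ - (d ^ 2)⁻¹) z := fun z hz =>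
    (hcd z hz).sub contDiffAt_const
  have hψ0 : ∀ z ∈ K, 0 ≤ ψ z := by
    refine minp hK (fun z hz => ?_) ?_
    · exact (hφ.contDiffAt.sub (contDiffAt_const.mul (hcd2 z hz))).continuousAt.continuousWithinAt
    · intro z hz
      have hz1 : dist z x ≤ d := hz.1
      have hz2 : d / 2 ≤ dist z x := not_lt.1 hz.2
      rcases hz1.eq_or_lt with h1 | h1
      · left
        simp only [hψ]
        rw [hns, h1, sub_self, mul_zero, sub_zero]
        exact hcl z hz.1
      rcases hz2.eq_or_lt with h2 | h2
      · left
        simp only [hψ]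
        rw [hns, ← h2]
        have h3 : m ≤ φ z := hqm (mem_sphere.2 h2.symm)
        have e : ε * (((d / 2) ^ 2)⁻¹ - (d ^ 2)⁻¹) = m / 2 := by
          rw [hε]; field_simp; ring
        rw [e]; linarith
      · right
        refine ⟨?_, hφ.contDiffAt.sub (contDiffAt_const.mul (hcd2 z hz)), ?_⟩
        · refine mem_of_superset ((isOpen_ball.inter isClosed_closedBall.isOpen_compl).mem_nhds
            (⟨h1, not_le.2 h2⟩ : z ∈ ball x d ∩ (closedBall x (d / 2))ᶜ)) ?_
          rintro y ⟨hy1, hy2⟩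
          exact ⟨ball_subset_closedBall hy1, fun h => hy2 (ball_subset_closedBall h)⟩
        · rw [hψ, lp_sub hφ.contDiffAt (contDiffAt_const.mul (hcd2 z hz)),
            lp_const_mul ε (hcd2 z hz), lp_sub (hcd z hz) contDiffAt_const, lp_const,
            lp_comp_sub (fun y => (ns y)⁻¹), lp_inv_ns (hnz z hz)]
          have h3 := hl z h1
          have h4 : 0 < ns (z - x) := by
            rw [hns]; have : 0 < dist z x := by linarith
            positivity
          have : 0 < ε * (4 / ns (z - x) ^ 2 - 0) := by rw [sub_zero]; positivity
          linarith
  -- along the segment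
  have hseg : ∀ τ : ℝ, 0 < τ → τ < 1 / 2 → ε * (2 * τ / d ^ 2) ≤ φ (p + τ * (x - p)) := by
    intro τ h1 h2
    have hdist : dist (p + τ * (x - p)) x = (1 - τ) * d := by
      rw [dist_eq_norm, show p + (τ:ℂ) * (x - p) - x = ((1 - τ : ℝ) : ℂ) * (p - x) by push_cast; ring,
        norm_mul, Complex.norm_real, Real.norm_of_nonneg (by linarith), ← dist_eq_norm, hp]
    have hmem : p + (τ:ℂ) * (x - p) ∈ K := by
      constructor
      · rw [mem_closedBall, hdist]; nlinarith
      · rw [mem_ball, hdist, not_lt]; nlinarith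
    have h3 := hψ0 _ hmem
    simp only [hψ] at h3
    rw [hns, hdist] at h3
    have h4 : 2 * τ / d ^ 2 ≤ (((1 - τ) * d) ^ 2)⁻¹ - (d ^ 2)⁻¹ := by
      have h5 : 0 < (1 - τ) ^ 2 := by
        have : 0 < 1 - τ := by linarith
        positivity
      have h6 : 1 + 2 * τ ≤ ((1 - τ) ^ 2)⁻¹ := by
        rw [← one_div, le_div_iff₀ h5]
        nlinarith [mul_pos h1 h1, mul_pos (mul_pos h1 h1) h1]
      rw [mul_pow, mul_inv, ← sub_nonneg]
      have e : ((1 - τ) ^ 2)⁻¹ * (d ^ 2)⁻¹ - (d ^ 2)⁻¹ - 2 * τ / d ^ 2 =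
        (((1 - τ) ^ 2)⁻¹ - (1 + 2 * τ)) * (d ^ 2)⁻¹ := by rw [div_eq_mul_inv]; ring
      rw [e]
      exact mul_nonneg (by linarith) (by positivity)
    have := mul_le_mul_of_nonneg_left h4 hε0.le
    linarith
  have hder : HasDerivAt (fun τ : ℝ => φ (p + τ * (x - p))) (dd (x - p) φ p) 0 := by
    have h1 : HasDerivAt (fun τ : ℝ => p + (τ:ℂ) * (x - p)) (x - p) 0 := by
      have := ((Complex.ofRealCLM.hasDerivAt (x := (0:ℝ))).mul_const (x - p)).const_add p
      simpa using this
    have h2 : HasFDerivAt φ (fderiv ℝ φ p) (p + ((0:ℝ):ℂ) * (x - p)) := by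
      simpa using (hφ.differentiable (by norm_num)).differentiableAt.hasFDerivAt
    exact h2.comp_hasDerivAt (0:ℝ) h1
  have hlim := hder.tendsto_slope_zero_right
  have hge : ε * (2 / d ^ 2) ≤ dd (x - p) φ p := by
    refine ge_of_tendsto hlim ?_
    filter_upwards [Ioo_mem_nhdsGT (show (0:ℝ) < 1 / 2 by norm_num)] with τ hτ
    have := hseg τ hτ.1 hτ.2
    simp only [zero_add, Complex.ofReal_zero, zero_mul, add_zero, hp0, sub_zero, smul_eq_mul]
    rw [inv_mul_eq_div, le_div_iff₀ hτ.1]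
    calc ε * (2 / d ^ 2) * τ = ε * (2 * τ / d ^ 2) := by ring
      _ ≤ _ := this
  have : 0 < ε * (2 / d ^ 2) := by positivity
  linarith

structure Fld (φ : ℂ → ℝ) : Prop where
  c2 : ContDiff ℝ 2 φ
  pos : ∀ z, 0 < φ z → lp φ z < 0
  neg : ∀ z, φ z < 0 → 0 < lp φ z
  real : ∀ z : ℂ, z.im = 0 → φ z = 0
  decay : ∀ t > 0, ∃ R : ℝ, ∀ z : ℂ, 0 ≤ z.im → R ≤ ‖z‖ → |φ z| < t
  hopf0 : dY φ 0 = 0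
  lb : ∃ C : ℝ, ∀ z, |lp φ z| ≤ C * ((1 + ns z) ^ 2)⁻¹ * |φ z|

def DD (φ : ℂ → ℝ) : Set ℂ := {z | 0 < z.im ∧ φ z ≠ 0}

lemma lp_neg {φ : ℂ → ℝ} (h : ContDiff ℝ 2 φ) (z : ℂ) : lp (fun z => - φ z) z = - lp φ z := by
  have e : (fun z => - φ z) = fun z => (-1) * φ z := by funext z; ring
  rw [e, lp_const_mul _ h.contDiffAt]; ring

lemma DD_neg (φ : ℂ → ℝ) : DD (fun z => - φ z) = DD φ := by
  ext z; simp [DD]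

namespace Fld
variable {φ : ℂ → ℝ}

lemma ng (F : Fld φ) : Fld (fun z => - φ z) where
  c2 := F.c2.neg
  pos := fun z hz => by rw [lp_neg F.c2]; have := F.neg z (by linarith); linarith
  neg := fun z hz => by rw [lp_neg F.c2]; have := F.pos z (by linarith); linarith
  real := fun z hz => by simp [F.real z hz]
  decay := fun t ht => by simpa only [abs_neg] using F.decay t ht
  hopf0 := by
    have := F.hopf0
    rw [dY_eq] at this ⊢
    have e : dd Complex.I (fun z => - φ z) 0 = - dd Complex.I φ 0 := by
      simp only [dd]
      rw [show (fun z => - φ z) = - φ from rfl, fderiv_neg]; simp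
    rw [e, this, neg_zero]
  lb := by
    obtain ⟨C, hC⟩ := F.lb
    exact ⟨C, fun z => by rw [lp_neg F.c2, abs_neg, abs_neg]; exact hC z⟩

lemma DDo (F : Fld φ) : IsOpen (DD φ) :=
  (isOpen_lt continuous_const Complex.continuous_im).inter
    (isOpen_ne_fun F.c2.continuous continuous_const)

lemma sign (F : Fld φ) {Ω : Set ℂ} (h : ND (DD φ) Ω) : (∀ z ∈ Ω, 0 < φ z) ∨ (∀ z ∈ Ω, φ z < 0) := by
  by_contra hcon
  push Not at hcon
  obtain ⟨⟨x, hx, hx2⟩, y, hy, hy2⟩ := hcon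
  obtain ⟨z, hz, hz2⟩ := h.conn.intermediate_value hx hy F.c2.continuous.continuousOn
    (show (0:ℝ) ∈ Set.Icc (φ x) (φ y) from ⟨hx2, hy2⟩)
  exact (h.sub hz).2 hz2

lemma smp_pos (F : Fld φ) {Ω : Set ℂ} {p : ℂ} (h : ND (DD φ) Ω) (hpos : ∀ z ∈ Ω, 0 < φ z)
    (hp : p ∈ closure Ω) (hpΩ : p ∉ Ω) (hpi : 0 < p.im) : p ∈ closure (DD φ \ Ω) := by
  by_contra hcon
  have hU : IsOpen ((closure (DD φ \ Ω))ᶜ ∩ {z : ℂ | 0 < z.im}) :=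
    isClosed_closure.isOpen_compl.inter (isOpen_lt continuous_const Complex.continuous_im)
  obtain ⟨ρ, hρ, hb⟩ := Metric.isOpen_iff.1 hU p ⟨hcon, hpi⟩
  have hnn : ∀ z ∈ ball p ρ, 0 ≤ φ z := by
    intro z hz
    by_contra hz2
    push Not at hz2
    have h1 := hb hz
    refine h1.1 (subset_closure ⟨⟨h1.2, hz2.ne⟩, fun h2 => ?_⟩)
    have := hpos z h2; linarith
  obtain ⟨x, hx, hxp⟩ := Metric.mem_closure_iff.1 hp (ρ / 3) (by positivity)
  obtain ⟨p', hp', hpd⟩ := ((h.op F.DDo).isClosed_compl).exists_infDist_eq_dist ⟨p, hpΩ⟩ x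
  have hle : dist x p' ≤ dist x p := by rw [← hpd]; exact infDist_le_dist_of_mem hpΩ
  have hxp' : dist x p < ρ / 3 := by rw [dist_comm]; exact hxp
  have hp'b : p' ∈ ball p ρ := by
    rw [mem_ball]
    have := dist_triangle p' x p
    rw [dist_comm p' x] at this
    linarith
  set d := dist x p' with hd
  have hd0 : 0 < d := dist_pos.2 fun e => hp' (e ▸ hx)
  have hball : ball x d ⊆ Ω := by
    intro z hz
    by_contra hz2
    have h1 : infDist x Ωᶜ ≤ dist x z := infDist_le_dist_of_mem hz2
    rw [hpd] at h1
    rw [mem_ball, dist_comm] at hz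
    linarith
  have hp'c : p' ∈ closure Ω := by
    refine closure_mono hball ?_
    rw [closure_ball x hd0.ne', mem_closedBall, dist_comm]
  have hφ' : φ p' = 0 := by
    by_contra hne
    exact hp' (h.cl F.DDo hp'c ⟨(hb hp'b).2, hne⟩)
  have h1 := hopf F.c2 hd0 (fun z hz => hpos z (hball hz))
    (fun z hz => (F.pos z (hpos z (hball hz))).le) (by rw [dist_comm]) hφ'
  have hmin : IsLocalMin φ p' := by
    filter_upwards [isOpen_ball.mem_nhds hp'b] with z hz
    rw [hφ']; exact hnn z hz
  rw [dd, hmin.fderiv_eq_zero] at h1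
  simp at h1

lemma smp (F : Fld φ) {Ω : Set ℂ} {p : ℂ} (h : ND (DD φ) Ω)
    (hp : p ∈ closure Ω) (hpΩ : p ∉ Ω) (hpi : 0 < p.im) : p ∈ closure (DD φ \ Ω) := by
  rcases F.sign h with hs | hs
  · exact F.smp_pos h hs hp hpΩ hpi
  · have := F.ng.smp_pos (Ω := Ω) (p := p) (by rwa [DD_neg]) (fun z hz => by
      have := hs z hz; linarith) hp hpΩ hpi
    rwa [DD_neg] at this

lemma nothalf_pos (F : Fld φ) {Ω : Set ℂ} {r : ℝ} (hpos : ∀ z ∈ Ω, 0 < φ z)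
    (hr : 0 < r) : ¬ (∀ z ∈ ball (0:ℂ) r, 0 < z.im → z ∈ Ω) := by
  intro hall
  have hn : ‖((r / 2 : ℝ) * Complex.I : ℂ)‖ = r / 2 := by
    rw [norm_mul, Complex.norm_I, mul_one, Complex.norm_real, Real.norm_of_nonneg (by positivity)]
  have hb : ball ((r / 2 : ℝ) * Complex.I : ℂ) (r / 2) ⊆ Ω := by
    intro z hz
    rw [mem_ball, dist_eq_norm] at hz
    refine hall z ?_ ?_
    · rw [mem_ball, dist_zero_right]
      have := norm_sub_norm_le z ((r / 2 : ℝ) * Complex.I : ℂ)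
      rw [hn] at this; linarith
    · have h1 := Complex.abs_im_le_norm (z - ((r / 2 : ℝ) * Complex.I : ℂ))
      have h2 : (z - ((r / 2 : ℝ) * Complex.I : ℂ)).im = z.im - r / 2 := by simp
      rw [h2] at h1
      have := neg_le_of_abs_le h1
      linarith
  have h1 := hopf F.c2 (half_pos hr) (fun z hz => hpos z (hb hz))
    (fun z hz => (F.pos z (hpos z (hb hz))).le) (p := 0) (by rw [dist_comm, dist_zero_right, hn])
    (F.real 0 (by simp))
  have h2 : dd (((r / 2 : ℝ) * Complex.I : ℂ) - 0) φ 0 = (r / 2) * dY φ 0 := by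
    rw [dY_eq, sub_zero, dd, dd, ← Complex.real_smul, map_smul, smul_eq_mul]
  rw [h2, F.hopf0, mul_zero] at h1
  exact lt_irrefl _ h1

lemma nothalf (F : Fld φ) {Ω : Set ℂ} {r : ℝ} (h : ND (DD φ) Ω)
    (hr : 0 < r) : ¬ (∀ z ∈ ball (0:ℂ) r, 0 < z.im → z ∈ Ω) := by
  rcases F.sign h with hs | hs
  · exact F.nothalf_pos hs hr
  · exact F.ng.nothalf_pos (fun z hz => by have := hs z hz; linarith) hr

lemma cpt (F : Fld φ) {Ω : Set ℂ} (h : ND (DD φ) Ω) {t : ℝ} (ht : 0 < t) :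
    IsCompact {z | z ∈ Ω ∧ t ≤ φ z} := by
  refine isCompact_of_isClosed_isBounded ?_ ?_
  · refine isClosed_of_closure_subset fun z hz => ?_
    have h1 : z ∈ closure Ω := closure_mono (fun _ h => h.1) hz
    have h2 : t ≤ φ z := by
      have : closure {z | z ∈ Ω ∧ t ≤ φ z} ⊆ {z | t ≤ φ z} :=
        closure_minimal (fun _ h => h.2) (isClosed_le continuous_const F.c2.continuous)
      exact this hz
    have h3 : 0 ≤ z.im := by
      have : closure Ω ⊆ {z : ℂ | 0 ≤ z.im} :=
        closure_minimal (fun _ hz => (h.sub hz).1.le) (isClosed_le continuous_const Complex.continuous_im)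
      exact this h1
    have h4 : 0 < z.im := lt_of_le_of_ne h3 fun e => by
      have := F.real z e.symm; linarith
    exact ⟨h.cl F.DDo h1 ⟨h4, by linarith⟩, h2⟩
  · obtain ⟨R, hR⟩ := F.decay t ht
    refine (isBounded_iff_forall_norm_le).2 ⟨R, fun z hz => ?_⟩
    by_contra hcon
    have := hR z (h.sub hz.1).1.le (not_le.1 hcon).le
    have := le_abs_self (φ z)
    have := hz.2
    linarith

lemma ext_conn {R : ℝ} (hR : 0 ≤ R) : IsPreconnected (closedBall (0:ℂ) R)ᶜ := by
  have h1 : IsPreconnected ((Set.Ioi R) ×ˢ (Set.univ : Set ℝ)) :=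
    isPreconnected_Ioi.prod isPreconnected_univ
  have h2 := h1.image (fun p : ℝ × ℝ => (p.1 : ℂ) * Complex.exp (p.2 * Complex.I))
    (by fun_prop)
  convert h2 using 1
  ext z
  simp only [Set.mem_compl_iff, mem_closedBall, dist_zero_right, not_le, Set.mem_image,
    Set.mem_prod, Set.mem_Ioi, Set.mem_univ, and_true, Prod.exists]
  constructor
  · intro hz
    exact ⟨‖z‖, Complex.arg z, hz, Complex.norm_mul_exp_arg_mul_I z⟩
  · rintro ⟨ρ, θ, hρ, rfl⟩
    rw [norm_mul, Complex.norm_exp_ofReal_mul_I, mul_one, Complex.norm_real, Real.norm_eq_abs,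
      abs_of_pos (lt_of_le_of_lt hR hρ)]
    exact hρ

lemma cptc (F : Fld φ) {Ω : Set ℂ} (h : ND (DD φ) Ω) (hpos : ∀ z ∈ Ω, 0 < φ z)
    (hc : IsPreconnected Ωᶜ) {t : ℝ} (ht : 0 < t) :
    IsPreconnected {z | z ∈ Ω ∧ t ≤ φ z}ᶜ := by
  have hK := F.cpt h ht
  set K := {z | z ∈ Ω ∧ t ≤ φ z} with hKdef
  have hΩK : Ωᶜ ⊆ Kᶜ := Set.compl_subset_compl.2 fun z hz => hz.1
  have h0 : (0:ℂ) ∈ Ωᶜ := fun h0 => by have := (h.sub h0).1; simp at this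
  suffices hs : ∀ x ∈ Kᶜ, x ∈ connectedComponentIn Kᶜ 0 by
    have : Kᶜ = connectedComponentIn Kᶜ 0 :=
      Set.Subset.antisymm hs (connectedComponentIn_subset _ _)
    rw [this]; exact isPreconnected_connectedComponentIn
  intro x hx
  have hsub : Ωᶜ ⊆ connectedComponentIn Kᶜ 0 := hc.subset_connectedComponentIn h0 hΩK
  set W := connectedComponentIn Kᶜ x with hW
  have hxW : x ∈ W := mem_connectedComponentIn hx
  have hWK : W ⊆ Kᶜ := connectedComponentIn_subset _ _
  have hWo : IsOpen W := hK.isClosed.isOpen_compl.connectedComponentIn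
  suffices hm : ∃ y ∈ W, y ∉ Ω by
    obtain ⟨y, hy, hy2⟩ := hm
    rw [connectedComponentIn_eq (hsub hy2), ← connectedComponentIn_eq hy]
    exact hxW
  by_contra hcon
  push Not at hcon
  have hWc : ∀ z ∈ closure W, z ∈ Kᶜ → z ∈ W := by
    intro z hz hzK
    have h' : ND Kᶜ W := ⟨x, hx, rfl⟩
    exact h'.cl hK.isClosed.isOpen_compl hz hzK
  -- W is bounded
  obtain ⟨R, hR⟩ := (isBounded_iff_forall_norm_le).1 hK.isBounded
  have hWb : ∀ z ∈ W, ‖z‖ ≤ max R 0 := by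
    intro z hz
    by_contra hz2
    push Not at hz2
    have hpc : IsPreconnected (closedBall (0:ℂ) (max R 0))ᶜ := ext_conn (le_max_right _ _)
    have hsubK : (closedBall (0:ℂ) (max R 0))ᶜ ⊆ Kᶜ := by
      intro y hy hyK
      refine hy ?_
      rw [mem_closedBall, dist_zero_right]
      exact (hR y hyK).trans (le_max_left _ _)
    have hzm : z ∈ (closedBall (0:ℂ) (max R 0))ᶜ := by
      intro hm; rw [mem_closedBall, dist_zero_right] at hm; linarith
    have h1 : (closedBall (0:ℂ) (max R 0))ᶜ ⊆ W := by
      rw [hW, connectedComponentIn_eq hz]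
      exact hpc.subset_connectedComponentIn hzm hsubK
    have h2 : ((-(max R 0 + 1) : ℝ) * Complex.I : ℂ) ∈ (closedBall (0:ℂ) (max R 0))ᶜ := by
      intro hm
      rw [mem_closedBall, dist_zero_right, norm_mul, Complex.norm_I, mul_one, Complex.norm_real,
        Real.norm_eq_abs, abs_neg, abs_of_pos (by positivity)] at hm
      linarith
    have h3 := (h.sub (hcon _ (h1 h2))).1
    have h4 : ((-(max R 0 + 1) : ℝ) * Complex.I : ℂ).im = -(max R 0 + 1) := by simp
    rw [h4] at h3
    have := le_max_right R 0
    linarith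
  have hcc : IsCompact (closure W) :=
    ((isBounded_iff_forall_norm_le).2 ⟨_, hWb⟩).isCompact_closure
  obtain ⟨q, hq, hqm⟩ := hcc.exists_isMinOn ⟨x, subset_closure hxW⟩ F.c2.continuous.continuousOn
  have hlt : ∀ z ∈ W, φ z < t := by
    intro z hz
    by_contra hz2
    exact hWK hz ⟨hcon z hz, not_lt.1 hz2⟩
  have hqx : φ q ≤ φ x := hqm (subset_closure hxW)
  have hqW : q ∈ W := by
    refine hWc q hq fun hqK => ?_
    have := hqK.2; have := hlt x hxW; linarith
  have hmin : IsLocalMin φ q := hqm.isLocalMin (mem_of_superset (hWo.mem_nhds hqW) subset_closure)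
  have h1 := lp_nonneg_of_min hmin F.c2.contDiffAt
  have h2 := F.pos q (hpos q (hcon q hqW))
  linarith

end Fld
end Ons

namespace Ons

lemma int_w : Integrable (fun z : ℂ => ((1 + ns z) ^ 2)⁻¹) := by
  have h := integrable_rpow_neg_one_add_norm_sq (E := ℂ) (μ := volume) (r := 4)
    (by rw [Complex.finrank_real_complex]; norm_num)
  refine h.congr (Filter.Eventually.of_forall fun z => ?_)
  simp only []
  rw [ns_eq, show (-4/2 : ℝ) = -(2:ℕ) by norm_num, Real.rpow_neg (by positivity), Real.rpow_natCast]

lemma wt : ∃ Φ : ℂ → ℂ, Differentiable ℂ Φ ∧ ∀ z : ℂ, 0 ≤ z.im →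
    (1/64) * ((1 + ns z) ^ 2)⁻¹ ≤ ‖deriv Φ z‖ ^ 2 ∧ ‖deriv Φ z‖ ^ 2 ≤ 16 * ((1 + ns z) ^ 2)⁻¹ := by
  set e : ℂ → ℂ := fun ζ => Complex.exp (Complex.I * ζ) with he
  have hd : Differentiable ℂ (dslope e 0) := by
    have : DifferentiableOn ℂ (dslope e 0) Set.univ := by
      rw [Complex.differentiableOn_dslope Filter.univ_mem]
      exact (by rw [he]; fun_prop : Differentiable ℂ e).differentiableOn
    exact differentiableOn_univ.1 this
  have hE : Differentiable ℂ (fun z => (dslope e 0 (z + Complex.I)) ^ 2) :=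
    (hd.comp (differentiable_id.add_const _)).pow 2
  obtain ⟨Φ, hΦ⟩ := hE.isExactOn_univ
  refine ⟨Φ, fun z => (hΦ z trivial).differentiableAt, fun z hz => ?_⟩
  rw [(hΦ z trivial).deriv]
  have hne : z + Complex.I ≠ 0 := by
    intro h
    have := congrArg Complex.im h
    simp at this
    linarith
  have hval : dslope e 0 (z + Complex.I) = (z + Complex.I)⁻¹ * (e (z + Complex.I) - 1) := by
    rw [dslope_of_ne _ hne, slope_def_field, he]
    simp only [mul_zero, Complex.exp_zero, sub_zero]
    field_simp
  set N := ‖z + Complex.I‖ with hN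
  have hN2 : N ^ 2 = 1 + ns z + 2 * z.im := by
    rw [hN, ← ns_eq]; simp [ns]; ring
  have hs := ns_nonneg z
  have hNp : 0 < N := norm_pos_iff.2 hne
  have him : z.im ^ 2 ≤ ns z := by simp [ns]; positivity
  have hNl : 1 + ns z ≤ N ^ 2 := by linarith
  have hNu : N ^ 2 ≤ 2 * (1 + ns z) := by nlinarith [sq_nonneg (z.im - 1)]
  have hexp : ‖e (z + Complex.I)‖ ≤ 1/2 := by
    rw [he]; simp only [Complex.norm_exp]
    have : (Complex.I * (z + Complex.I)).re = -(z.im + 1) := by simp; try ring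
    rw [this]
    have h1 : Real.exp (-(z.im+1)) ≤ Real.exp (-1) := Real.exp_le_exp.2 (by linarith)
    have h2 : Real.exp (-1) ≤ 1/2 := by
      rw [Real.exp_neg, one_div]
      exact inv_anti₀ (by norm_num) (by have := Real.add_one_le_exp (1:ℝ); linarith)
    linarith
  set B := ‖e (z + Complex.I) - 1‖ with hB
  have hBl : 1/2 ≤ B := by
    have := norm_sub_norm_le (1:ℂ) (e (z + Complex.I))
    rw [norm_one, norm_sub_rev, ← hB] at this; linarith
  have hBu : B ≤ 2 := by
    have := norm_sub_le (e (z + Complex.I)) 1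
    rw [norm_one, ← hB] at this; linarith
  have hnorm : ‖(dslope e 0 (z + Complex.I)) ^ 2‖ ^ 2 = B ^ 4 * ((N ^ 2) ^ 2)⁻¹ := by
    rw [hval, norm_pow, norm_mul, norm_inv, ← hN, ← hB]
    field_simp
  rw [hnorm]
  have hB4l : 1/16 ≤ B ^ 4 := by
    calc (1/16:ℝ) = (1/2)^4 := by norm_num
      _ ≤ B ^ 4 := pow_le_pow_left₀ (by norm_num) hBl 4
  have hB4u : B ^ 4 ≤ 16 := by
    calc B ^ 4 ≤ 2 ^ 4 := pow_le_pow_left₀ (by linarith) hBu 4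
      _ = 16 := by norm_num
  constructor
  · calc (1/64) * ((1 + ns z) ^ 2)⁻¹ = (1/16) * ((2 * (1 + ns z)) ^ 2)⁻¹ := by
          rw [mul_pow, mul_inv]; ring
      _ ≤ B ^ 4 * ((N ^ 2) ^ 2)⁻¹ := by
          refine mul_le_mul hB4l ?_ (by positivity) (by positivity)
          exact inv_anti₀ (by positivity) (pow_le_pow_left₀ (by positivity) hNu 2)
  · refine mul_le_mul hB4u ?_ (by positivity) (by positivity)
    exact inv_anti₀ (by positivity) (pow_le_pow_left₀ (by positivity) hNl 2)

/-- telescoping lower bound -/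
lemma tele {m : ℝ → ℝ} {k A s0 L : ℝ} (hk : 0 < k) (hL : 0 < L) (ha : 0 < A)
    (hlow : ∀ s, s0 ≤ s → s ≤ s0 + L → A ≤ m s)
    (hst : ∀ s h, s0 ≤ s → 0 < h → k * h * m (s + h) ≤ m s * (m s - m (s + h)))  :
    k * L / 2 ≤ m s0 := by
  obtain ⟨n, hn⟩ := exists_nat_gt (k * L / A)
  have hn0 : (0:ℝ) < n := lt_of_le_of_lt (by positivity) hn
  set h := L / n with hh
  have hhp : 0 < h := by positivity
  have hkh : k * h ≤ A := by
    rw [hh, mul_div_assoc', div_le_iff₀ hn0]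
    rw [div_lt_iff₀ ha] at hn; linarith
  have step : ∀ j : ℕ, j ≤ n → (j:ℝ) * (k * h / 2) ≤ m s0 - m (s0 + j * h) := by
    intro j
    induction j with
    | zero => intro _; simp
    | succ j ih =>
      intro hj
      have h1 := ih (by omega)
      have hjn : ((j:ℝ) + 1) ≤ n := by exact_mod_cast hj
      have e : s0 + ((j+1 : ℕ):ℝ) * h = (s0 + j * h) + h := by push_cast; ring
      have hnh : (n:ℝ) * h = L := by rw [hh]; field_simp
      have hjh : ((j:ℝ)+1) * h ≤ L := by rw [← hnh]; exact mul_le_mul_of_nonneg_right hjn hhp.le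
      have hj0 : (0:ℝ) ≤ j * h := by positivity
      have hx := hlow (s0 + j * h) (by linarith) (by linarith)
      have hy := hlow ((s0 + j * h) + h) (by linarith) (by linarith)
      have h2 := hst (s0 + j * h) h (by linarith) hhp
      rw [e]
      set x := m (s0 + j * h)
      set y := m (s0 + j * h + h)
      have h3 : k * h / 2 ≤ x - y := by
        by_contra hc
        push Not at hc
        have hkp : 0 < k * h := by positivity
        have h4 : x * (x - y) < x * (k * h / 2) := mul_lt_mul_of_pos_left hc (by linarith)
        have h5 : k * h * y < k * h * (x / 2) := by linarith
        have h6 : y < x / 2 := lt_of_mul_lt_mul_left h5 hkp.le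
        linarith
      push_cast
      linarith
  have h1 := step n le_rfl
  have e : (n:ℝ) * (k * h / 2) = k * L / 2 := by rw [hh]; field_simp
  have e2 : s0 + (n:ℝ) * h = s0 + L := by rw [hh]; field_simp
  rw [e, e2] at h1
  have := hlow (s0 + L) (by linarith) le_rfl
  linarith

namespace Fld
variable {φ : ℂ → ℝ}

lemma mass_low_pos (F : Fld φ) {Φ : ℂ → ℂ} (hΦ : Differentiable ℂ Φ)
    (hw : ∀ z : ℂ, 0 ≤ z.im → (1/64) * ((1 + ns z) ^ 2)⁻¹ ≤ ‖deriv Φ z‖ ^ 2)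
    (hi : IntegrableOn (fun z => ‖deriv Φ z‖ ^ 2) {z : ℂ | 0 < z.im}) {C : ℝ} (hC : 0 < C)
    (hlb : ∀ z, |lp φ z| ≤ C * ((1 + ns z) ^ 2)⁻¹ * |φ z|)
    {Ω : Set ℂ} (h : ND (DD φ) Ω) (hpos : ∀ z ∈ Ω, 0 < φ z) :
    π / (128 * C) ≤ ∫ z in Ω, ‖deriv Φ z‖ ^ 2 := by
  obtain ⟨z0, hz0⟩ := h.ne
  have hcp := F.cpt h (hpos z0 hz0)
  obtain ⟨p, hp, hmax⟩ := hcp.exists_isMaxOn ⟨z0, hz0, le_rfl⟩ F.c2.continuous.continuousOn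
  set M := φ p with hM
  have hMp : 0 < M := hpos p hp.1
  have hMx : ∀ z ∈ Ω, φ z ≤ M := by
    intro z hz
    by_cases hzz : φ z0 ≤ φ z
    · exact hmax ⟨hz, hzz⟩
    · push Not at hzz
      exact hzz.le.trans hp.2
  have hO := h.op F.DDo
  have hΩH : Ω ⊆ {z : ℂ | 0 < z.im} := fun z hz => (h.sub hz).1
  have hiΩ := hi.mono_set hΩH
  have hwpos : ∀ z ∈ Ω, 0 < ‖deriv Φ z‖ ^ 2 := by
    intro z hz
    have h1 := hw z (hΩH hz).le
    have h2 := ns_nonneg z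
    exact lt_of_lt_of_le (by positivity) h1
  have hslsub : ∀ s, sl Ω φ s ⊆ Ω := fun s z hz => hz.1
  have hmono : ∀ s t, s ≤ t → ∫ z in sl Ω φ t, ‖deriv Φ z‖ ^ 2 ≤ ∫ z in sl Ω φ s, ‖deriv Φ z‖ ^ 2 := by
    intro s t hst
    refine setIntegral_mono_set (hiΩ.mono_set (hslsub s))
      (Filter.Eventually.of_forall fun z => by simp only [Pi.zero_apply]; positivity)
      (HasSubset.Subset.eventuallyLE (fun z hz => ⟨hz.1, lt_of_le_of_lt hst hz.2⟩))
  have hA : 0 < ∫ z in sl Ω φ (M/2), ‖deriv Φ z‖ ^ 2 := by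
    rw [setIntegral_pos_iff_support_of_nonneg_ae
      (Filter.Eventually.of_forall fun z => by simp only [Pi.zero_apply]; positivity) (hiΩ.mono_set (hslsub _))]
    have hop := isOpen_sl hO F.c2.continuous (M/2)
    refine lt_of_lt_of_le (hop.measure_pos volume ⟨p, hp.1, by linarith⟩) (measure_mono ?_)
    intro z hz
    exact ⟨(hwpos z hz.1).ne', hz⟩
  have key := tele (m := fun s => ∫ z in sl Ω φ s, ‖deriv Φ z‖ ^ 2) (k := 4 * π / (64 * C * M)) (s0 := M/4)
    (L := M/4) (by positivity) (by positivity) hA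
    (fun s hs1 hs2 => hmono _ _ (by linarith)) (by
      intro s t hs ht
      have hl := layer (G := Ω) hO F.c2 (s := s) (h := t) ht (F.cpt h (by linarith))
        (R := fun z => (64 * C * M) * ‖deriv Φ z‖ ^ 2)
        ((hiΩ.mono_set (hslsub s)).const_mul _) (fun z _ => by positivity) (by
          intro z hz
          have h1 := hlb z
          have h2 := hw z (hΩH hz.1).le
          have h3 := hMx z hz.1
          have h4 := hpos z hz.1
          have h5 := neg_abs_le (lp φ z)
          have h6 : C * ((1 + ns z) ^ 2)⁻¹ ≤ 64 * C * ‖deriv Φ z‖ ^ 2 := by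
            have := mul_le_mul_of_nonneg_left h2 (by positivity : 0 ≤ 64 * C)
            linarith
          rw [abs_of_pos h4] at h1
          have h7 : C * ((1 + ns z) ^ 2)⁻¹ * φ z ≤ 64 * C * ‖deriv Φ z‖ ^ 2 * M :=
            mul_le_mul h6 h3 h4.le (by positivity)
          linarith) hΦ
      rw [integral_const_mul] at hl
      have hD : 0 < 64 * C * M := by positivity
      have := div_le_div_of_nonneg_right hl hD.le
      calc _ = 4 * π * t * (∫ z in sl Ω φ (s + t), ‖deriv Φ z‖ ^ 2) / (64 * C * M) := by ring
        _ ≤ _ := this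
        _ = _ := by field_simp)
  have hfin : ∫ z in sl Ω φ (M/4), ‖deriv Φ z‖ ^ 2 ≤ ∫ z in Ω, ‖deriv Φ z‖ ^ 2 :=
    setIntegral_mono_set hiΩ
      (Filter.Eventually.of_forall fun z => by simp only [Pi.zero_apply]; positivity)
      (HasSubset.Subset.eventuallyLE (hslsub _))
  refine le_trans (le_of_eq ?_) (key.trans hfin)
  field_simp
  ring

lemma fin (F : Fld φ) : {Ω | ND (DD φ) Ω}.Finite := by
  obtain ⟨Φ, hΦ, hw⟩ := wt
  obtain ⟨C0, hC0⟩ := F.lb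
  set C := max C0 1 with hCd
  have hC : 0 < C := lt_of_lt_of_le one_pos (le_max_right _ _)
  have hlb : ∀ z, |lp φ z| ≤ C * ((1 + ns z) ^ 2)⁻¹ * |φ z| := by
    intro z
    refine (hC0 z).trans ?_
    have := ns_nonneg z
    refine mul_le_mul_of_nonneg_right (mul_le_mul_of_nonneg_right (le_max_left _ _) (by positivity)) (abs_nonneg _)
  have hHm : MeasurableSet {z : ℂ | 0 < z.im} :=
    (isOpen_lt continuous_const Complex.continuous_im).measurableSet
  have hdc : Continuous (deriv Φ) := (hΦ.contDiff (n := 1)).continuous_deriv le_rfl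
  have hwc : Continuous (fun z => ‖deriv Φ z‖ ^ 2) := hdc.norm.pow 2
  have hi : IntegrableOn (fun z => ‖deriv Φ z‖ ^ 2) {z : ℂ | 0 < z.im} := by
    refine Integrable.mono' ((int_w.const_mul 16).integrableOn) hwc.aestronglyMeasurable ?_
    rw [ae_restrict_iff' hHm]
    refine Filter.Eventually.of_forall fun z hz => ?_
    rw [Real.norm_of_nonneg (by positivity)]
    exact (hw z (le_of_lt hz)).2
  have hml : ∀ Ω, ND (DD φ) Ω → π / (128 * C) ≤ ∫ z in Ω, ‖deriv Φ z‖ ^ 2 := by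
    intro Ω h
    rcases F.sign h with hp | hn
    · exact F.mass_low_pos hΦ (fun z hz => (hw z hz).1) hi hC hlb h hp
    · refine F.ng.mass_low_pos hΦ (fun z hz => (hw z hz).1) hi hC ?_ (by rw [DD_neg]; exact h)
        (fun z hz => by have := hn z hz; linarith)
      intro z
      rw [lp_neg F.c2, abs_neg, abs_neg]; exact hlb z
  set ν : Measure ℂ := (volume.restrict {z : ℂ | 0 < z.im}).withDensity
    (fun z => ENNReal.ofReal (‖deriv Φ z‖ ^ 2)) with hν
  have hfin := Measure.finite_const_le_meas_of_disjoint_iUnion ν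
    (ε := ENNReal.ofReal (π / (128 * C))) (by rw [ENNReal.ofReal_pos]; positivity)
    (As := fun Ω : {Ω | ND (DD φ) Ω} => Ω.1) (fun Ω => (Ω.2.op F.DDo).measurableSet)
    (fun Ω Ω' hne => Ω.2.disj Ω'.2 (fun h => hne (Subtype.ext h))) (by
      have : IsFiniteMeasure ν := by
        rw [hν]
        exact isFiniteMeasure_withDensity_ofReal hi.2
      exact measure_ne_top _ _)
  have hall : {i : {Ω | ND (DD φ) Ω} | ENNReal.ofReal (π / (128 * C)) ≤ ν i.1} = Set.univ := by
    ext Ω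
    simp only [Set.mem_setOf_eq, Set.mem_univ, iff_true]
    have hΩm := (Ω.2.op F.DDo).measurableSet
    have hsub : Ω.1 ⊆ {z : ℂ | 0 < z.im} := fun z hz => (Ω.2.sub hz).1
    rw [hν, withDensity_apply _ hΩm, Measure.restrict_restrict hΩm, Set.inter_eq_left.2 hsub,
      ← ofReal_integral_eq_lintegral_ofReal (hi.mono_set hsub)
        (Filter.Eventually.of_forall fun z => by simp only [Pi.zero_apply]; positivity)]
    exact ENNReal.ofReal_le_ofReal (hml _ Ω.2)
  rw [hall] at hfin
  have := Set.finite_univ_iff.1 hfin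
  exact Set.toFinite _

end Fld
end Ons

namespace Ons

lemma rp_d {a s : ℝ} (hs : 0 < s) : HasDerivAt (fun s : ℝ => s ^ a) (a * s ^ (a - 1)) s := by
  simpa using Real.hasDerivAt_rpow_const (x := s) (p := a) (Or.inl hs.ne')

lemma barr_c {z : ℂ} (hz : 0 < ns z) : ContDiffAt ℝ 2 (fun x => ns x ^ (-(3/4) : ℝ)) z :=
  contDiff_ns.contDiffAt.rpow_const_of_ne hz.ne'

lemma lp_barr {z : ℂ} (hz : 0 < ns z) :
    lp (fun x => x.im * ns x ^ (-(3/4) : ℝ)) z = - (3/4) * z.im * ns z ^ (-(7/4) : ℝ) := by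
  have h1 : ∀ᶠ s in 𝓝 (ns z), HasDerivAt (fun s : ℝ => s ^ (-(3/4) : ℝ))
      ((fun s : ℝ => -(3/4) * s ^ (-(7/4) : ℝ)) s) s := by
    filter_upwards [isOpen_Ioi.mem_nhds hz] with s hs
    refine (rp_d (a := -(3/4)) hs).congr_deriv ?_
    norm_num
  have h2 : HasDerivAt (fun s : ℝ => -(3/4) * s ^ (-(7/4) : ℝ)) (21/16 * ns z ^ (-(11/4) : ℝ)) (ns z) := by
    refine ((rp_d (a := -(7/4)) hz).const_mul (-(3/4) : ℝ)).congr_deriv ?_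
    norm_num; ring
  rw [lp_mul contDiff_im.contDiffAt (barr_c hz),
    lp_radial (g := fun s : ℝ => s ^ (-(3/4) : ℝ)) h1 h2, lp_im, dX_im, dY_im]
  have h3 : dY (fun x => ns x ^ (-(3/4) : ℝ)) z = (-(3/4) * ns z ^ (-(7/4) : ℝ)) * dY ns z := by
    rw [dY_eq]
    exact dd_comp (contDiff_ns (n := 1).contDiffAt.differentiableAt (by norm_num)) h1.self_of_nhds
  rw [h3, dY_ns]
  have h4 : ns z * ns z ^ (-(11/4) : ℝ) = ns z ^ (-(7/4) : ℝ) := by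
    nth_rewrite 1 [← Real.rpow_one (ns z)]
    rw [← Real.rpow_add hz]; norm_num
  linear_combination (z.im * 4 * 21/16) * h4

lemma lp_log {z : ℂ} (hz : 0 < ns z) : lp (fun x => Real.log (ns x)) z = 0 := by
  have h1 : ∀ᶠ s in 𝓝 (ns z), HasDerivAt (fun s : ℝ => Real.log s) (s⁻¹) s := by
    filter_upwards [isOpen_Ioi.mem_nhds hz] with s hs
    exact Real.hasDerivAt_log (ne_of_gt hs)
  have h2 := hasDerivAt_inv (𝕜 := ℝ) hz.ne'
  rw [lp_radial (g := fun s => Real.log s) h1 h2]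
  field_simp; ring

lemma decay_one {φ : ℂ → ℝ} (hφ : ContDiff ℝ 2 φ) {B C : ℝ} (hB : ∀ z, φ z ≤ B) (hC : 0 ≤ C)
    (hr : ∀ z : ℂ, z.im = 0 → φ z = 0)
    (hl : ∀ z, - lp φ z ≤ C * ((1 + ns z) ^ 2)⁻¹) :
    ∀ z : ℂ, 0 ≤ z.im → φ z ≤ (8 * C + 1) * (ns (z + Complex.I)) ^ (-(1/4) : ℝ) := by
  have hS : ∀ z : ℂ, ns (z + Complex.I) = 1 + ns z + 2 * z.im := by
    intro z; simp [ns]; ring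
  have hS1 : ∀ z : ℂ, 0 ≤ z.im → 1 ≤ ns (z + Complex.I) := by
    intro z hz; rw [hS]; have := ns_nonneg z; linarith
  set A := 8 * C + 1 with hA
  have hAp : 0 < A := by positivity
  set b : ℂ → ℝ := fun x => x.im * ns x ^ (-(3/4) : ℝ) with hb
  set l : ℂ → ℝ := fun x => Real.log (ns x) with hlg
  have main : ∀ z : ℂ, 0 ≤ z.im → ∀ ε > 0, φ z ≤ A * b (z + Complex.I) + ε * l (z + Complex.I) := by
    intro z hz ε hε
    set ψ : ℂ → ℝ := fun x => (A * b (x + Complex.I) + ε * l (x + Complex.I)) - φ x with hψ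
    -- radius
    set ρ := max (Real.exp (max B 0 / ε)) (ns (z + Complex.I)) with hρ
    set K : Set ℂ := {x | 0 ≤ x.im ∧ ns (x + Complex.I) ≤ ρ} with hK
    have hKcl : IsClosed K := (isClosed_le continuous_const Complex.continuous_im).inter
      (isClosed_le (continuous_ns.comp (continuous_id.add continuous_const)) continuous_const)
    have hKc : IsCompact K := by
      refine Metric.isCompact_of_isClosed_isBounded hKcl ?_
      rw [isBounded_iff_forall_norm_le]
      refine ⟨ρ, fun x hx => ?_⟩
      have h1 := hx.2
      rw [hS, ns_eq] at h1
      have h2 := hx.1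
      nlinarith [sq_nonneg (‖x‖ - 1), norm_nonneg x]
    have hcd : ∀ x : ℂ, 0 ≤ x.im → ContDiffAt ℝ 2 (fun x => b (x + Complex.I)) x ∧
        ContDiffAt ℝ 2 (fun x => l (x + Complex.I)) x := by
      intro x hx
      have hp : 0 < ns (x + Complex.I) := lt_of_lt_of_le one_pos (hS1 x hx)
      have ha : ContDiffAt ℝ 2 (fun x : ℂ => x + Complex.I) x := contDiffAt_id.add contDiffAt_const
      have h1 : ContDiffAt ℝ 2 b (x + Complex.I) := contDiff_im.contDiffAt.mul (barr_c hp)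
      have h2 : ContDiffAt ℝ 2 l (x + Complex.I) := contDiff_ns.contDiffAt.log hp.ne'
      exact ⟨ContDiffAt.comp (g := b) (f := fun x : ℂ => x + Complex.I) x h1 ha,
        ContDiffAt.comp (g := l) (f := fun x : ℂ => x + Complex.I) x h2 ha⟩
    have hψc : ∀ x : ℂ, 0 ≤ x.im → ContDiffAt ℝ 2 ψ x := by
      intro x hx
      exact ((contDiffAt_const.mul (hcd x hx).1).add (contDiffAt_const.mul (hcd x hx).2)).sub hφ.contDiffAt
    have hbn : ∀ x : ℂ, 0 ≤ x.im → 0 ≤ b (x + Complex.I) := by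
      intro x hx
      have := hS1 x hx
      refine mul_nonneg ?_ (Real.rpow_nonneg (by linarith) _)
      simp; linarith
    have hln : ∀ x : ℂ, 0 ≤ x.im → 0 ≤ l (x + Complex.I) := by
      intro x hx
      exact Real.log_nonneg (hS1 x hx)
    have := minp hKc (ψ := ψ) (fun x hx => (hψc x hx.1).continuousAt.continuousWithinAt) (by
      intro x hx
      have h1 := hx.1
      have hb0 := mul_nonneg hAp.le (hbn x h1)
      have hl0 := mul_nonneg hε.le (hln x h1)
      rcases eq_or_lt_of_le h1 with h0 | h0
      · left
        simp only [hψ]; rw [hr x h0.symm]; linarith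
      rcases eq_or_lt_of_le hx.2 with h2 | h2
      · left
        have h3 : B ≤ ε * l (x + Complex.I) := by
          simp only [hlg]; rw [h2]
          have h4 : max B 0 / ε ≤ Real.log ρ := by
            rw [← Real.log_exp (max B 0 / ε)]
            exact Real.log_le_log (Real.exp_pos _) (le_max_left _ _)
          rw [div_le_iff₀ hε] at h4
          have := le_max_left B 0
          linarith
        simp only [hψ]
        have := hB x
        linarith
      · right
        refine ⟨?_, hψc x h1, ?_⟩
        · have ho : IsOpen {x : ℂ | 0 < x.im ∧ ns (x + Complex.I) < ρ} :=
            (isOpen_lt continuous_const Complex.continuous_im).inter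
              (isOpen_lt (continuous_ns.comp (continuous_id.add continuous_const)) continuous_const)
          exact Filter.mem_of_superset (ho.mem_nhds ⟨h0, h2⟩) (fun y hy => ⟨hy.1.le, hy.2.le⟩)
        · have hp : 0 < ns (x + Complex.I) := lt_of_lt_of_le one_pos (hS1 x h1)
          have hc1 : ContDiffAt ℝ 2 (fun x => A * b (x + Complex.I)) x := contDiffAt_const.mul (hcd x h1).1
          have hc2 : ContDiffAt ℝ 2 (fun x => ε * l (x + Complex.I)) x := contDiffAt_const.mul (hcd x h1).2
          rw [hψ, lp_sub (hc1.add hc2) hφ.contDiffAt, lp_add hc1 hc2, lp_const_mul _ (hcd x h1).1,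
            lp_const_mul _ (hcd x h1).2, lp_comp_add, lp_comp_add, lp_barr hp, lp_log hp]
          have h3 := hl x
          have hSx := hS x
          have hS1x := hS1 x h1
          set S := ns (x + Complex.I) with hSd
          have him : (x + Complex.I).im = x.im + 1 := by simp
          have h5 : (S ^ 2)⁻¹ ≤ S ^ (-(7/4) : ℝ) := by
            rw [← Real.rpow_natCast, ← Real.rpow_neg hp.le]
            exact Real.rpow_le_rpow_of_exponent_le hS1x (by norm_num)
          have h6 : ((1 + ns x) ^ 2)⁻¹ ≤ 4 * (S ^ 2)⁻¹ := by
            have h7 : S ≤ 2 * (1 + ns x) := by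
              have : x.im ^ 2 ≤ ns x := by simp [ns]; positivity
              nlinarith [sq_nonneg (x.im - 1)]
            have h8 : ((2 * (1 + ns x)) ^ 2)⁻¹ ≤ (S ^ 2)⁻¹ :=
              inv_anti₀ (by positivity) (pow_le_pow_left₀ hp.le h7 2)
            rw [mul_pow, mul_inv] at h8
            linarith
          have h9 : 0 < (S ^ 2)⁻¹ := by positivity
          have h10 : S ^ (-(7/4) : ℝ) ≤ (x.im + 1) * S ^ (-(7/4) : ℝ) := by
            refine le_mul_of_one_le_left (by positivity) (by linarith)
          have h11 : A * (S ^ 2)⁻¹ ≤ A * ((x.im + 1) * S ^ (-(7/4) : ℝ)) :=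
            mul_le_mul_of_nonneg_left (h5.trans h10) hAp.le
          have h12 : C * ((1 + ns x) ^ 2)⁻¹ ≤ C * (4 * (S ^ 2)⁻¹) := mul_le_mul_of_nonneg_left h6 hC
          rw [him]
          have h13 : A * (S ^ 2)⁻¹ = 8 * (C * (S^2)⁻¹) + (S^2)⁻¹ := by rw [hA]; ring
          have h14 : 0 ≤ C * (S^2)⁻¹ := by positivity
          linarith) z ⟨hz, le_max_right _ _⟩
    simp only [hψ] at this
    linarith
  intro z hz
  have hp : 0 < ns (z + Complex.I) := lt_of_lt_of_le one_pos (hS1 z hz)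
  have h1 : φ z ≤ A * b (z + Complex.I) := by
    refine le_of_forall_pos_le_add fun δ hδ => ?_
    have hl0 : 0 ≤ l (z + Complex.I) := Real.log_nonneg (hS1 z hz)
    have := main z hz (δ / (l (z + Complex.I) + 1)) (by positivity)
    have h2 : δ / (l (z + Complex.I) + 1) * l (z + Complex.I) ≤ δ := by
      rw [div_mul_eq_mul_div, div_le_iff₀ (by positivity)]
      exact mul_le_mul_of_nonneg_left (by linarith) hδ.le
    linarith
  refine h1.trans (mul_le_mul_of_nonneg_left ?_ hAp.le)
  simp only [hb]
  have h3 : (z + Complex.I).im ≤ ns (z + Complex.I) ^ (1/2 : ℝ) := by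
    rw [← Real.sqrt_eq_rpow]
    refine Real.le_sqrt_of_sq_le ?_
    unfold ns
    nlinarith [sq_nonneg (z + Complex.I).re]
  calc _ ≤ ns (z + Complex.I) ^ (1/2 : ℝ) * ns (z + Complex.I) ^ (-(3/4) : ℝ) :=
        mul_le_mul_of_nonneg_right h3 (Real.rpow_nonneg hp.le _)
    _ = _ := by rw [← Real.rpow_add hp]; norm_num

lemma decay_two {φ : ℂ → ℝ} (hφ : ContDiff ℝ 2 φ) {B C : ℝ} (hB : ∀ z, |φ z| ≤ B) (hC : 0 ≤ C)
    (hr : ∀ z : ℂ, z.im = 0 → φ z = 0)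
    (hl : ∀ z, |lp φ z| ≤ C * ((1 + ns z) ^ 2)⁻¹) :
    ∀ t > 0, ∃ R : ℝ, ∀ z : ℂ, 0 ≤ z.im → R ≤ ‖z‖ → |φ z| < t := by
  intro t ht
  have h1 := decay_one hφ (fun z => (le_abs_self _).trans (hB z)) hC hr
    (fun z => (neg_le_abs _).trans (hl z))
  have h2 := decay_one (φ := fun z => - φ z) hφ.neg (fun z => (neg_le_abs _).trans (hB z)) hC
    (fun z hz => by simp [hr z hz])
    (fun z => by rw [lp_neg hφ, neg_neg]; exact (le_abs_self _).trans (hl z))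
  have h3 : Tendsto (fun s : ℝ => (8 * C + 1) * s ^ (-(1/4) : ℝ)) atTop (𝓝 ((8 * C + 1) * 0)) :=
    (tendsto_rpow_neg_atTop (by norm_num)).const_mul _
  rw [mul_zero] at h3
  obtain ⟨R, hR⟩ := Filter.eventually_atTop.1 (h3.eventually (gt_mem_nhds ht))
  refine ⟨max R 1, fun z hz hRz => ?_⟩
  have h4 : R ≤ ns (z + Complex.I) := by
    have e : ns (z + Complex.I) = 1 + ns z + 2 * z.im := by simp [ns]; ring
    rw [e, ns_eq]
    have := le_max_left R 1
    have := le_max_right R 1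
    nlinarith
  have h5 := hR _ h4
  rw [abs_lt]
  constructor
  · have := h2 z hz; linarith
  · have := h1 z hz; linarith

end Ons

namespace Ons

/-- two solutions agreeing on the real axis -/
structure Pair (U V f g : ℂ → ℝ) : Prop where
  hU : ContDiff ℝ 2 U
  hV : ContDiff ℝ 2 V
  eU : ∀ z, lp U z + exp (U z) = f z
  eV : ∀ z, lp V z + exp (V z) = f z
  hf : Continuous f
  bd : ∃ C, 0 ≤ C ∧ ∀ z, exp (U z) ≤ C * ((1 + ns z) ^ 2)⁻¹ ∧ exp (V z) ≤ C * ((1 + ns z) ^ 2)⁻¹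
  df : ∃ B, ∀ z, |U z - V z| ≤ B
  re : ∀ z : ℂ, z.im = 0 → U z = V z
  dU : dY U 0 = 0
  dV : dY V 0 = 0
  ig : Integrable g
  g0 : ∀ z, 0 ≤ g z
  gf : ∀ z, - f z ≤ g z

lemma exp_lip_aux {a b c : ℝ} (ha : exp a ≤ c) (hab : b ≤ a) : |exp a - exp b| ≤ c * |a - b| := by
  have h1 : exp b ≤ exp a := exp_le_exp.2 hab
  rw [abs_of_nonneg (by linarith), abs_of_nonneg (by linarith)]
  have h2 : exp b = exp a * exp (b - a) := by rw [← exp_add]; ring_nf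
  have h3 := add_one_le_exp (b - a)
  have h4 : exp a * (b - a + 1) ≤ exp b := by
    rw [h2]; exact mul_le_mul_of_nonneg_left h3 (exp_pos a).le
  have h5 : exp a * (a - b) ≤ c * (a - b) := mul_le_mul_of_nonneg_right ha (by linarith)
  linarith

lemma exp_lip {a b c : ℝ} (ha : exp a ≤ c) (hb : exp b ≤ c) : |exp a - exp b| ≤ c * |a - b| := by
  rcases le_total b a with h | h
  · exact exp_lip_aux ha h
  · rw [abs_sub_comm, abs_sub_comm a b]; exact exp_lip_aux hb h

namespace Pair
variable {U V f g : ℂ → ℝ}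

lemma swap (P : Pair U V f g) : Pair V U f g where
  hU := P.hV
  hV := P.hU
  eU := P.eV
  eV := P.eU
  hf := P.hf
  bd := by
    obtain ⟨C, h0, hC⟩ := P.bd
    exact ⟨C, h0, fun z => ⟨(hC z).2, (hC z).1⟩⟩
  df := by
    obtain ⟨B, hB⟩ := P.df
    exact ⟨B, fun z => by rw [abs_sub_comm]; exact hB z⟩
  re := fun z hz => (P.re z hz).symm
  dU := P.dV
  dV := P.dU
  ig := P.ig
  g0 := P.g0
  gf := P.gf

lemma int (P : Pair U V f g) : Integrable (fun z => exp (U z)) := by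
  obtain ⟨C, h0, hC⟩ := P.bd
  refine Integrable.mono' (int_w.const_mul C) (P.hU.continuous.rexp).aestronglyMeasurable ?_
  refine Filter.Eventually.of_forall fun z => ?_
  rw [Real.norm_of_nonneg (exp_pos _).le]
  exact (hC z).1

lemma lpd (P : Pair U V f g) (z : ℂ) : lp (fun z => U z - V z) z = - (exp (U z) - exp (V z)) := by
  rw [lp_sub P.hU.contDiffAt P.hV.contDiffAt]
  have := P.eU z
  have := P.eV z
  linarith

lemma fld (P : Pair U V f g) : Fld (fun z => U z - V z) := by
  obtain ⟨C, h0, hC⟩ := P.bd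
  obtain ⟨B, hB⟩ := P.df
  have hlb : ∀ z, |lp (fun z => U z - V z) z| ≤ C * ((1 + ns z) ^ 2)⁻¹ * |U z - V z| := by
    intro z
    rw [P.lpd, abs_neg]
    exact exp_lip (hC z).1 (hC z).2
  have hB0 : 0 ≤ B := (abs_nonneg _).trans (hB 0)
  refine ⟨P.hU.sub P.hV, ?_, ?_, ?_, ?_, ?_, ⟨C, hlb⟩⟩
  · intro z hz
    rw [P.lpd]
    have := exp_lt_exp.2 (show V z < U z by linarith)
    linarith
  · intro z hz
    rw [P.lpd]
    have := exp_lt_exp.2 (show U z < V z by linarith)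
    linarith
  · intro z hz; rw [P.re z hz, sub_self]
  · refine decay_two (B := B) (C := C * B) (P.hU.sub P.hV) hB (by positivity)
      (fun z hz => by rw [P.re z hz, sub_self]) ?_
    intro z
    refine (hlb z).trans ?_
    have := ns_nonneg z
    calc _ ≤ C * ((1 + ns z) ^ 2)⁻¹ * B := mul_le_mul_of_nonneg_left (hB z) (by positivity)
      _ = _ := by ring
  · have h1 := P.dU
    have h2 := P.dV
    rw [dY_eq] at *
    rw [dd_sub (P.hU.differentiable (by norm_num) 0) (P.hV.differentiable (by norm_num) 0), h1, h2, sub_self]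

lemma nod (P : Pair U V f g) {Ω : Set ℂ} (h : ND (DD (fun z => U z - V z)) Ω)
    (hpos : ∀ z ∈ Ω, 0 < U z - V z) (hc : IsPreconnected Ωᶜ) : Nod V U f g Ω where
  hu1 := P.hV
  hu2 := P.hU
  heq1 := P.eV
  heq2 := P.eU
  hf := P.hf
  hO := h.op P.fld.DDo
  hne := h.ne
  hpos := fun z hz => by have := hpos z hz; linarith
  hK := fun t ht => P.fld.cpt h ht
  hKc := fun t ht => P.fld.cptc h hpos hc ht
  i1 := P.swap.int.integrableOn
  i2 := P.int.integrableOn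
  hg := P.ig.integrableOn
  hg0 := P.g0
  hgf := P.gf

lemma piece (P : Pair U V f g) {Ω : Set ℂ} (h : ND (DD (fun z => U z - V z)) Ω)
    (hc : IsPreconnected Ωᶜ) :
    8 * π - 2 * (∫ z in Ω, g z) ≤ (∫ z in Ω, (exp (U z) + exp (V z))) ∧
    ((∀ z ∈ Ω, 0 < f z) →
    8 * π - 2 * (∫ z in Ω, g z) < (∫ z in Ω, (exp (U z) + exp (V z)))) := by
  rw [integral_add P.int.integrableOn P.swap.int.integrableOn]
  rcases P.fld.sign h with hp | hn
  · have := (P.nod h hp hc).mass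
    rw [add_comm]; exact this
  · have e : DD (fun z => V z - U z) = DD (fun z => U z - V z) := by
      rw [← DD_neg]; congr 1; funext z; ring
    exact (P.swap.nod (by rw [e]; exact h) (fun z hz => by have := hn z hz; linarith) hc).mass

end Pair

lemma half_int {k : ℂ → ℝ} (hk : Integrable k) (h0 : ∀ z, 0 ≤ k z) :
    (∫ z in {z : ℂ | 0 < z.im}, k z) + (∫ z in {z : ℂ | 0 < z.im}, k ((starRingEnd ℂ) z)) ≤ ∫ z, k z := by
  have hm : MeasurableSet {z : ℂ | 0 < z.im} :=
    (isOpen_lt continuous_const Complex.continuous_im).measurableSet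
  have hm' : MeasurableSet {z : ℂ | z.im < 0} :=
    (isOpen_lt Complex.continuous_im continuous_const).measurableSet
  have h1 : (∫ z in {z : ℂ | 0 < z.im}, k ((starRingEnd ℂ) z)) = ∫ z in {z : ℂ | z.im < 0}, k z := by
    have := (Complex.conjLIE.measurePreserving).setIntegral_preimage_emb
      Complex.conjLIE.toHomeomorph.measurableEmbedding k {z : ℂ | z.im < 0}
    rw [← this]
    have e : Complex.conjLIE ⁻¹' {z : ℂ | z.im < 0} = {z : ℂ | 0 < z.im} := by
      ext z; simp
    rw [e]
    rfl
  rw [h1, ← setIntegral_union _ hm' hk.integrableOn hk.integrableOn]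
  · exact setIntegral_le_integral hk (Filter.Eventually.of_forall h0)
  · rw [Set.disjoint_left]
    intro z hz hz'
    simp only [Set.mem_setOf_eq] at hz hz'
    linarith

theorem main_sym {U f g : ℂ → ℝ} (hU : ContDiff ℝ 2 U) (eU : ∀ z, lp U z + exp (U z) = f z)
    (hf : Continuous f) (hfc : ∀ z, f ((starRingEnd ℂ) z) = f z) {C B : ℝ} (hC0 : 0 ≤ C)
    (hC : ∀ z, exp (U z) ≤ C * ((1 + ns z) ^ 2)⁻¹)
    (hB : ∀ z, |U z - U ((starRingEnd ℂ) z)| ≤ B) (dU : dY U 0 = 0)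
    (ig : Integrable g) (g0 : ∀ z, 0 ≤ g z) (gf : ∀ z, - f z ≤ g z)
    (gc : ∀ z, g ((starRingEnd ℂ) z) = g z)
    (hm : ∫ z, exp (U z) < 16 * π - ∫ z, g z ∨
      (∫ z, exp (U z) ≤ 16 * π - ∫ z, g z ∧ ∀ z, z ≠ 0 → 0 < f z)) :
    ∀ z, U ((starRingEnd ℂ) z) = U z := by
  set V : ℂ → ℝ := fun z => U ((starRingEnd ℂ) z) with hVd
  have nsc : ∀ z, ns ((starRingEnd ℂ) z) = ns z := fun z => by simp [ns]
  have P : Pair U V f g := by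
    refine ⟨hU, hU.comp Complex.conjCLE.contDiff, eU, ?_, hf, ⟨C, hC0, fun z => ⟨hC z, ?_⟩⟩, ⟨B, hB⟩, ?_, dU, ?_, ig, g0, gf⟩
    · intro z
      rw [hVd, lp_comp_conj, ← hfc z]
      exact eU _
    · have := hC ((starRingEnd ℂ) z)
      rwa [nsc] at this
    · intro z hz
      simp only [hVd]
      rw [Complex.conj_eq_iff_im.2 hz]
    · rw [dY_eq] at *
      rw [hVd, dd_comp_conj, Complex.conj_I, dd_neg_dir, map_zero, dU, neg_zero]
  by_contra hcon
  push Not at hcon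
  obtain ⟨z0, hz0⟩ := hcon
  have F := P.fld
  have hne : (DD (fun z => U z - V z)).Nonempty := by
    have him : z0.im ≠ 0 := fun h => hz0 (by rw [Complex.conj_eq_iff_im.2 h])
    rcases lt_or_gt_of_ne him with h | h
    · refine ⟨(starRingEnd ℂ) z0, by simpa using h, ?_⟩
      simp only [hVd, Complex.conj_conj]
      exact sub_ne_zero.2 hz0
    · exact ⟨z0, h, sub_ne_zero.2 (Ne.symm hz0)⟩
  obtain ⟨Ω1, Ω2, n1, n2, hdis, c1, c2⟩ := topo F.DDo (fun z hz => hz.1) hne F.fin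
    (fun Ω p h hp hp2 hp3 => F.smp h hp hp2 hp3) (fun Ω r h hr => F.nothalf h hr)
  have p1 := P.piece n1 c1
  have p2 := P.piece n2 c2
  have hiS : Integrable (fun z => exp (U z) + exp (V z)) := P.int.add P.swap.int
  have hsub : Ω1 ∪ Ω2 ⊆ {z : ℂ | 0 < z.im} := by
    rintro z (hz | hz)
    · exact (n1.sub hz).1
    · exact (n2.sub hz).1
  have sum : ∀ k : ℂ → ℝ, Integrable k → (∀ z, 0 ≤ k z) →
      (∫ z in Ω1, k z) + (∫ z in Ω2, k z) ≤ ∫ z in {z : ℂ | 0 < z.im}, k z := by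
    intro k hk hk0
    rw [← setIntegral_union hdis (n2.op F.DDo).measurableSet hk.integrableOn hk.integrableOn]
    exact setIntegral_mono_set hk.integrableOn (Filter.Eventually.of_forall hk0)
      (Filter.Eventually.of_forall fun z hz => hsub hz)
  have s1 := sum _ hiS (fun z => by positivity)
  have s2 := sum _ ig g0
  have t1 := half_int P.int (fun z => (exp_pos _).le)
  have t2 := half_int ig g0
  simp only [gc] at t2
  have s4 := integral_add (μ := volume.restrict {z : ℂ | 0 < z.im}) P.int.integrableOn P.swap.int.integrableOn
  rw [s4] at s1
  have s3 : (∫ z in {z : ℂ | 0 < z.im}, exp (U z)) + (∫ z in {z : ℂ | 0 < z.im}, exp (V z)) ≤ ∫ z, exp (U z) := t1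
  rcases hm with hm | ⟨hm, hfp⟩
  · linarith [p1.1, p2.1]
  · have q1 := p1.2 (fun z hz => hfp z (fun h => by
      have := hsub (Or.inl hz); simp [h] at this))
    linarith [p2.1]

end Ons

namespace Ons

/-- the Laplacian of `log h`, as a function of `|z|²` -/
def FF (b γ s : ℝ) : ℝ := 4 * ((2 * b - 2) / (1 + s) ^ 2 - 2 * γ * (1 - s) / (1 + s) ^ 3)

def LL (b γ s : ℝ) : ℝ := (2 * b - 2) * Real.log (1 + s) + 2 * γ * (1 + s)⁻¹

lemma LL_c {b γ : ℝ} : ContDiff ℝ 2 (fun z => LL b γ (ns z)) := by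
  have h1 : ContDiff ℝ 2 (fun z => 1 + ns z) := contDiff_const.add contDiff_ns
  have h2 : ∀ z, 1 + ns z ≠ 0 := fun z => by have := ns_nonneg z; positivity
  exact (contDiff_const.mul (h1.log h2)).add (contDiff_const.mul (h1.inv h2))

lemma LL_d (b γ : ℝ) {s : ℝ} (hs : 0 < 1 + s) :
    HasDerivAt (LL b γ) ((2 * b - 2) * (1 + s)⁻¹ - 2 * γ * ((1 + s) ^ 2)⁻¹) s := by
  have h0 : HasDerivAt (fun s : ℝ => 1 + s) 1 s := (hasDerivAt_id s).const_add 1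
  have h1 := (h0.log hs.ne').const_mul (2 * b - 2)
  have h2 := (h0.fun_inv hs.ne').const_mul (2 * γ)
  refine (h1.fun_add h2).congr_deriv ?_
  field_simp
  ring

lemma LL_d2 (b γ : ℝ) {s : ℝ} (hs : 0 < 1 + s) :
    HasDerivAt (fun s => (2 * b - 2) * (1 + s)⁻¹ - 2 * γ * ((1 + s) ^ 2)⁻¹)
      (-(2 * b - 2) * ((1 + s) ^ 2)⁻¹ + 4 * γ * ((1 + s) ^ 3)⁻¹) s := by
  have h0 : HasDerivAt (fun s : ℝ => 1 + s) 1 s := (hasDerivAt_id s).const_add 1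
  have h1 := (h0.fun_inv hs.ne').const_mul (2 * b - 2)
  have h2 := ((h0.fun_pow 2).fun_inv (pow_ne_zero 2 hs.ne')).const_mul (2 * γ)
  refine (h1.fun_sub h2).congr_deriv ?_
  field_simp
  norm_num
  ring

lemma lp_LL (b γ : ℝ) (z : ℂ) : lp (fun z => LL b γ (ns z)) z = FF b γ (ns z) := by
  have hs : 0 < 1 + ns z := by have := ns_nonneg z; positivity
  have ho : ∀ᶠ s in 𝓝 (ns z), HasDerivAt (LL b γ)
      ((fun s => (2 * b - 2) * (1 + s)⁻¹ - 2 * γ * ((1 + s) ^ 2)⁻¹) s) s := by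
    have : IsOpen {s : ℝ | 0 < 1 + s} := isOpen_lt continuous_const (by fun_prop)
    filter_upwards [this.mem_nhds hs] with s hs
    exact LL_d b γ hs
  rw [lp_radial (g := LL b γ) ho (LL_d2 b γ hs), FF]
  field_simp
  ring

lemma FF_c (b γ : ℝ) : Continuous (fun z => FF b γ (ns z)) := by
  have h2 : ∀ z, 1 + ns z ≠ 0 := fun z => by have := ns_nonneg z; positivity
  have h1 : Continuous (fun z => 1 + ns z) := continuous_const.add continuous_ns
  have h3 : Continuous (fun z => 2 * γ * (1 - ns z)) := continuous_const.mul (continuous_const.sub continuous_ns)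
  exact continuous_const.mul ((continuous_const.div (h1.pow 2) (fun z => pow_ne_zero 2 (h2 z))).sub
    (h3.div (h1.pow 3) (fun z => pow_ne_zero 3 (h2 z))))

lemma FF_eq (b γ : ℝ) {s : ℝ} (hs : 0 ≤ s) :
    FF b γ s = 8 * ((b - 1) * (1 + s) - γ * (1 - s)) / (1 + s) ^ 3 := by
  unfold FF
  have : 1 + s ≠ 0 := by positivity
  field_simp
  ring

lemma g_int {b γ : ℝ} (hb : 1 ≤ b) (hγ : 0 ≤ γ) : Integrable (fun z : ℂ => max (-FF b γ (ns z)) 0) := by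
  refine Integrable.mono' (int_w.const_mul (8 * γ))
    ((FF_c b γ).neg.max continuous_const).aestronglyMeasurable ?_
  refine Filter.Eventually.of_forall fun z => ?_
  rw [Real.norm_of_nonneg (le_max_right _ _)]
  have hs := ns_nonneg z
  refine max_le ?_ (by positivity)
  rw [FF_eq b γ hs]
  have e : 8 * γ * ((1 + ns z) ^ 2)⁻¹ = 8 * γ * (1 + ns z) / (1 + ns z) ^ 3 := by
    have : 1 + ns z ≠ 0 := by positivity
    field_simp
  rw [e, ← neg_div]
  refine div_le_div_of_nonneg_right ?_ (by positivity)
  have h1 : 0 ≤ (b - 1) * (1 + ns z) := mul_nonneg (by linarith) (by linarith)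
  have h2 : 0 ≤ γ * ns z := by positivity
  linarith

lemma g_val {b γ : ℝ} (hb : 1 < b) (hγ : b - 1 < γ) :
    ∫ z : ℂ, max (-FF b γ (ns z)) 0 = 2 * π * (γ - b + 1) ^ 2 / γ := by
  have hγ0 : 0 < γ := by linarith
  set s0 := (γ - b + 1) / (γ + b - 1) with hs0
  have hd : 0 < γ + b - 1 := by linarith
  have hs0p : 0 < s0 := div_pos (by linarith) hd
  set r0 := Real.sqrt s0 with hr0
  have hr0p : 0 < r0 := Real.sqrt_pos.2 hs0p
  have hr0s : r0 ^ 2 = s0 := Real.sq_sqrt hs0p.le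
  have h1 := integral_fun_norm_addHaar (volume : Measure ℂ) (fun r : ℝ => max (-FF b γ (r ^ 2)) 0)
  have h2 : ∀ z : ℂ, max (-FF b γ (ns z)) 0 = (fun r : ℝ => max (-FF b γ (r ^ 2)) 0) ‖z‖ := by
    intro z; rw [ns_eq]
  simp_rw [h2]
  rw [h1, Complex.finrank_real_complex]
  have hball : volume.real (ball (0:ℂ) 1) = π := by
    rw [Measure.real, Complex.volume_ball]; simp
  rw [hball]
  -- sign
  have hsg : ∀ s, 0 ≤ s → ((b - 1) * (1 + s) - γ * (1 - s)) = (γ + b - 1) * (s - s0) := by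
    intro s hs
    rw [hs0]; field_simp; ring
  have hneg : ∀ s, 0 ≤ s → s ≤ s0 → FF b γ s ≤ 0 := by
    intro s hs hs'
    rw [FF_eq b γ hs, hsg s hs]
    refine div_nonpos_of_nonpos_of_nonneg ?_ (by positivity)
    have := mul_nonneg hd.le (sub_nonneg.2 hs')
    linarith
  have hpos : ∀ s, 0 ≤ s → s0 ≤ s → 0 ≤ FF b γ s := by
    intro s hs hs'
    rw [FF_eq b γ hs, hsg s hs]
    have := mul_nonneg hd.le (sub_nonneg.2 hs')
    positivity
  have h3 : ∫ y in Set.Ioi (0:ℝ), y ^ (2 - 1) • max (-FF b γ (y ^ 2)) 0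
      = ∫ y in Set.Ioc (0:ℝ) r0, -(y * FF b γ (y ^ 2)) := by
    rw [setIntegral_eq_of_subset_of_forall_sdiff_eq_zero (s := Set.Ioc (0:ℝ) r0) (t := Set.Ioi 0)
      measurableSet_Ioi Set.Ioc_subset_Ioi_self]
    · refine setIntegral_congr_fun measurableSet_Ioc ?_
      intro y hy
      have hy2 : y ^ 2 ≤ s0 := by rw [← hr0s]; exact pow_le_pow_left₀ hy.1.le hy.2 2
      have := hneg (y ^ 2) (by positivity) hy2
      simp only [smul_eq_mul]
      rw [max_eq_left (by linarith)]
      norm_num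
    · intro y hy
      have hy1 : r0 < y := by
        by_contra hc; push Not at hc; exact hy.2 ⟨hy.1, hc⟩
      have hy2 : s0 ≤ y ^ 2 := by rw [← hr0s]; exact pow_le_pow_left₀ hr0p.le hy1.le 2
      have := hpos (y ^ 2) (by positivity) hy2
      rw [max_eq_right (by linarith), smul_zero]
  rw [h3, ← intervalIntegral.integral_of_le hr0p.le]
  have h4 : ∀ y ∈ Set.uIcc 0 r0, HasDerivAt (fun y : ℝ => -(2 * ((2 * b - 2) * (y ^ 2 / (1 + y ^ 2)) - 2 * γ * (y ^ 2 / (1 + y ^ 2) ^ 2))))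
      (-(y * FF b γ (y ^ 2))) y := by
    intro y _
    have hp : 1 + y ^ 2 ≠ 0 := by positivity
    have e1 : HasDerivAt (fun y : ℝ => y ^ 2) (2 * y) y := by simpa using hasDerivAt_pow 2 y
    have e2 := e1.const_add 1
    have e3 := (e1.fun_div e2 hp).const_mul (2 * b - 2)
    have e4 := (e1.fun_div (e2.fun_pow 2) (pow_ne_zero 2 hp)).const_mul (2 * γ)
    refine (((e3.fun_sub e4).const_mul 2).fun_neg).congr_deriv ?_
    rw [FF]
    field_simp
    norm_num
    ring
  have h5 : Continuous (fun y : ℝ => -(y * FF b γ (y ^ 2))) := by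
    unfold FF
    have hp : ∀ y : ℝ, (1 + y ^ 2) ≠ 0 := fun y => by positivity
    have hp2 : ∀ y : ℝ, (1 + y ^ 2) ^ 2 ≠ 0 := fun y => by positivity
    have hp3 : ∀ y : ℝ, (1 + y ^ 2) ^ 3 ≠ 0 := fun y => by positivity
    fun_prop (disch := assumption)
  rw [intervalIntegral.integral_eq_sub_of_hasDerivAt h4 (h5.intervalIntegrable _ _)]
  rw [hr0s]
  have hs1 : 1 + s0 = 2 * γ / (γ + b - 1) := by rw [hs0]; field_simp; ring
  rw [hs1, hs0]
  simp only [smul_eq_mul, nsmul_eq_mul]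
  field_simp
  norm_num
  field_simp
  ring

lemma arith {b γ : ℝ} (hb : 1 < b) (hb2 : b ≤ 2) (hγ : b - 1 < γ)
    (hγ' : γ ≤ 3 - b + Real.sqrt (2 * (3 - b) * (2 - b))) :
    8 * π * b < 16 * π - 2 * π * (γ - b + 1) ^ 2 / γ := by
  have hγ0 : 0 < γ := by linarith
  have hb3 : b < 2 := by
    rcases eq_or_lt_of_le hb2 with h | h
    · rw [h] at hγ' hγ; norm_num at hγ'; linarith
    · exact h
  have key : (γ - b + 1) ^ 2 < 4 * γ * (2 - b) := by
    have hsq : Real.sqrt (2 * (3 - b) * (2 - b)) ^ 2 = 2 * (3 - b) * (2 - b) :=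
      Real.sq_sqrt (mul_nonneg (by linarith) (by linarith))
    have hs0 := Real.sqrt_nonneg (2 * (3 - b) * (2 - b))
    set q := Real.sqrt (2 * (3 - b) * (2 - b))
    obtain ⟨r, hr⟩ : ∃ r, γ = 3 - b + r := ⟨γ - 3 + b, by ring⟩
    obtain ⟨c, hc⟩ : ∃ c, b = 2 - c := ⟨2 - b, by ring⟩
    subst hr; subst hc
    have h1 : r ^ 2 < 4 * c := by
      rcases le_or_gt 0 r with h | h
      · have : r ^ 2 ≤ q ^ 2 := pow_le_pow_left₀ h (by linarith) 2
        nlinarith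
      · nlinarith
    nlinarith
  have hp := Real.pi_pos
  rw [lt_sub_iff_add_lt, ← lt_sub_iff_add_lt', div_lt_iff₀ hγ0]
  nlinarith

end Ons

namespace Ons

lemma dd_two {E : Type*} [NormedAddCommGroup E] [NormedSpace ℝ E] {u : E → ℝ}
    (hu : ContDiff ℝ 2 u) (x v : E) :
    fderiv ℝ (fun y => fderiv ℝ u y v) x v = iteratedFDeriv ℝ 2 u x ![v, v] := by
  have hd : DifferentiableAt ℝ (fderiv ℝ u) x :=
    ((hu.fderiv_right (m := 1) (by norm_num)).differentiable (by norm_num)) x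
  rw [iteratedFDeriv_two_apply]
  simp only [Matrix.cons_val_zero, Matrix.cons_val_one]
  have h := (hd.hasFDerivAt.clm_apply (hasFDerivAt_const v x)).fderiv
  rw [h]
  simp

lemma lap_eq {u : Pl → ℝ} (hu : ContDiff ℝ 2 u) (x : Pl) : lap u x = Laplacian.laplacian u x := by
  rw [InnerProductSpace.laplacian_eq_iteratedFDeriv_orthonormalBasis u (EuclideanSpace.basisFun (Fin 2) ℝ)]
  unfold lap
  refine Finset.sum_congr rfl fun i _ => ?_
  rw [dd_two hu, EuclideanSpace.basisFun_apply]

lemma dd_isom (T : ℂ ≃ₗᵢ[ℝ] Pl) (u : Pl → ℝ) (z v : ℂ) :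
    dd v (fun z => u (T z)) z = fderiv ℝ u (T z) (T v) := by
  unfold dd
  have := T.toContinuousLinearEquiv.comp_right_fderiv (f := u) (x := z)
  have e : (fun z => u (T z)) = u ∘ T.toContinuousLinearEquiv := rfl
  rw [e, this]
  rfl

lemma lp_isom (T : ℂ ≃ₗᵢ[ℝ] Pl) {u : Pl → ℝ} (hu : ContDiff ℝ 2 u) (z : ℂ) :
    lp (fun z => u (T z)) z = lap u (T z) := by
  rw [lap_eq hu, InnerProductSpace.laplacian_eq_iteratedFDeriv_orthonormalBasis u
    (Complex.orthonormalBasisOneI.map T)]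
  have h : ∀ v, dd v (dd v (fun z => u (T z))) z = iteratedFDeriv ℝ 2 u (T z) ![T v, T v] := by
    intro v
    rw [← dd_two hu, ← dd_isom T (fun y => fderiv ℝ u y (T v))]
    congr 1
    funext y
    rw [dd_isom]
  unfold lp
  rw [dX_eq, dY_eq, h, h]
  simp [Fin.sum_univ_two]

lemma exists_rot (L : ℂ →L[ℝ] ℝ) : ∃ c : Circle, L (c * Complex.I) = 0 := by
  set d : ℂ := (L 1 : ℂ) + (L Complex.I : ℂ) * Complex.I with hd
  have hL : ∀ x y : ℝ, L (x + y * Complex.I) = x * L 1 + y * L Complex.I := by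
    intro x y
    have : ((x:ℂ) + y * Complex.I) = x • (1:ℂ) + y • Complex.I := by simp
    rw [this, map_add, map_smul, map_smul, smul_eq_mul, smul_eq_mul]
  by_cases h0 : d = 0
  · refine ⟨1, ?_⟩
    have h1 := congrArg Complex.im h0
    simp [hd] at h1
    simp [h1]
  · have hn : ‖d‖ ≠ 0 := norm_ne_zero_iff.2 h0
    refine ⟨Circle.exp (Complex.arg d), ?_⟩
    rw [Circle.coe_exp]
    have h1 : L (‖d‖ • (Complex.exp (Complex.arg d * Complex.I) * Complex.I)) = 0 := by
      rw [Complex.real_smul, ← mul_assoc, Complex.norm_mul_exp_arg_mul_I]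
      have e : d * Complex.I = ((-(L Complex.I) : ℝ) : ℂ) + (L 1 : ℝ) * Complex.I := by
        rw [hd]
        push_cast
        linear_combination (L Complex.I : ℂ) * Complex.I_mul_I
      rw [e, hL]; ring
    rw [map_smul, smul_eq_mul] at h1
    exact (mul_eq_zero.1 h1).resolve_left hn

theorem final (β γ : ℝ) (hβ : 8*π < β) (hβ' : β ≤ 16*π)
    (hγ : 0 ≤ γ)
    (hγ' : γ ≤ 3 - β/(8*π) + Real.sqrt (2 * (3 - β/(8*π)) * (2 - β/(8*π))))
    (w : Pl → ℝ) (hw : ContDiff ℝ 2 w)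
    (heq : ∀ x : Pl,
      lap w x + (8 * (1 + ‖x‖ ^ 2) ^ (-2 + β/(4*π)) * Real.exp (γ * (2/(1 + ‖x‖ ^ 2))))
        * Real.exp (w x) = 0)
    (hmass : ∫ x : Pl,
      (8 * (1 + ‖x‖ ^ 2) ^ (-2 + β/(4*π)) * Real.exp (γ * (2/(1 + ‖x‖ ^ 2))))
        * Real.exp (w x) = β)
    (hbd : ∃ C : ℝ, ∀ x : Pl, |w x + (β/(4*π)) * Real.log (1 + ‖x‖ ^ 2)| ≤ C) :
    ∃ e : Pl, ‖e‖ = 1 ∧ ∀ x : Pl, w (x - (2 * ⟪x, e⟫) • e) = w x := by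
  have hpi := Real.pi_pos
  obtain ⟨C, hC⟩ := hbd
  set b := β / (8 * π) with hb
  have hbβ : β = 8 * π * b := by rw [hb]; field_simp
  have hb4 : β / (4 * π) = 2 * b := by rw [hb]; field_simp; ring
  have hb1 : 1 < b := by rw [hb, lt_div_iff₀ (by positivity)]; linarith
  have hb2 : b ≤ 2 := by rw [hb, div_le_iff₀ (by positivity)]; linarith
  rw [hb4] at heq hmass hC
  set T0 : ℂ ≃ₗᵢ[ℝ] Pl := Complex.orthonormalBasisOneI.repr with hT0
  obtain ⟨c, hc⟩ := exists_rot (fderiv ℝ (fun z => w (T0 z)) 0)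
  set T : ℂ ≃ₗᵢ[ℝ] Pl := (rotation c).trans T0 with hT
  have hdW : dd Complex.I (fun z => w (T z)) 0 = 0 := by
    rw [dd_isom]
    have h1 := dd_isom T0 w 0 (c * Complex.I)
    unfold dd at h1
    rw [hc] at h1
    have h2 : T Complex.I = T0 (c * Complex.I) := by rw [hT]; simp
    rw [h2, map_zero]
    rw [map_zero] at h1
    exact h1.symm
  set W : ℂ → ℝ := fun z => w (T z) with hW
  have hWc : ContDiff ℝ 2 W := hw.comp T.toContinuousLinearEquiv.contDiff
  have hnT : ∀ z, ‖T z‖ ^ 2 = ns z := fun z => by rw [T.norm_map, ns_eq]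
  set U : ℂ → ℝ := fun z => (Real.log 8 + LL b γ (ns z)) + W z with hU
  have hLc : ContDiff ℝ 2 (fun z => Real.log 8 + LL b γ (ns z)) := contDiff_const.add LL_c
  have hUc : ContDiff ℝ 2 U := hLc.add hWc
  have hexpU : ∀ z, exp (U z) = (8 * (1 + ‖T z‖ ^ 2) ^ (-2 + 2 * b) * Real.exp (γ * (2/(1 + ‖T z‖ ^ 2))))
        * Real.exp (w (T z)) := by
    intro z
    have hs : 0 < 1 + ns z := by have := ns_nonneg z; positivity
    rw [hnT, Real.rpow_def_of_pos hs, hU]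
    simp only []
    rw [exp_add, exp_add, Real.exp_log (by norm_num), LL, exp_add]
    rw [show (2 * b - 2) * Real.log (1 + ns z) = Real.log (1 + ns z) * (-2 + 2 * b) by ring,
      show 2 * γ * (1 + ns z)⁻¹ = γ * (2 / (1 + ns z)) by field_simp]
    ring
  have nsc : ∀ z, ns ((starRingEnd ℂ) z) = ns z := fun z => by simp [ns]
  have eU : ∀ z, lp U z + exp (U z) = FF b γ (ns z) := by
    intro z
    rw [hexpU, hU, lp_add hLc.contDiffAt hWc.contDiffAt, lp_add contDiffAt_const LL_c.contDiffAt,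
      lp_const, lp_LL, hW, lp_isom T hw]
    have := heq (T z)
    linarith
  have hmassU : ∫ z, exp (U z) = 8 * π * b := by
    rw [← hbβ, ← hmass]
    have := (T.measurePreserving).integral_comp T.toHomeomorph.measurableEmbedding
      (fun x : Pl => (8 * (1 + ‖x‖ ^ 2) ^ (-2 + 2 * b) * Real.exp (γ * (2/(1 + ‖x‖ ^ 2))))
        * Real.exp (w x))
    rw [← this]
    exact integral_congr_ae (Filter.Eventually.of_forall hexpU)
  have hWb : ∀ z, |W z + 2 * b * Real.log (1 + ns z)| ≤ C := by
    intro z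
    have := hC (T z)
    rwa [hnT] at this
  have hle : ∀ z, exp (U z) ≤ exp (Real.log 8 + 2 * γ + C) * ((1 + ns z) ^ 2)⁻¹ := by
    intro z
    have hs0 := ns_nonneg z
    have hs : 0 < 1 + ns z := by positivity
    have e : ((1 + ns z) ^ 2)⁻¹ = exp (- (2 * Real.log (1 + ns z))) := by
      rw [Real.exp_neg, mul_comm, ← Real.rpow_def_of_pos hs]
      norm_num
    rw [e, ← exp_add]
    refine exp_le_exp.2 ?_
    have h1 := (abs_le.1 (hWb z)).2
    have h2 : 2 * γ * (1 + ns z)⁻¹ ≤ 2 * γ * 1 :=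
      mul_le_mul_of_nonneg_left (inv_le_one_of_one_le₀ (by linarith)) (by linarith)
    simp only [hU, LL]
    linarith
  have hdif : ∀ z, |U z - U ((starRingEnd ℂ) z)| ≤ 2 * C := by
    intro z
    have h1 := abs_le.1 (hWb z)
    have h2 := abs_le.1 (hWb ((starRingEnd ℂ) z))
    rw [nsc] at h2
    simp only [hU]
    rw [nsc, abs_le]
    constructor <;> linarith [h1.1, h1.2, h2.1, h2.2]
  have hdU : dY U 0 = 0 := by
    rw [dY_eq, hU, dd_add (hLc.differentiable (by norm_num) 0) (hWc.differentiable (by norm_num) 0), hdW,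
      add_zero]
    have h0 : HasDerivAt (fun s => Real.log 8 + LL b γ s)
        ((2 * b - 2) * (1 + ns 0)⁻¹ - 2 * γ * ((1 + ns 0) ^ 2)⁻¹) (ns 0) :=
      (LL_d b γ (by simp [ns])).const_add _
    rw [dd_comp (T := fun s => Real.log 8 + LL b γ s) (contDiff_ns (n := 1).differentiable (by norm_num) 0) h0, dd_ns]
    simp
  have key : ∀ z, U ((starRingEnd ℂ) z) = U z := by
    refine main_sym (g := fun z => max (-FF b γ (ns z)) 0) hUc eU (FF_c b γ) (fun z => by rw [nsc])
      (exp_pos _).le hle hdif hdU (g_int hb1.le hγ) (fun z => le_max_right _ _)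
      (fun z => le_max_left _ _) (fun z => by rw [nsc]) ?_
    rw [hmassU]
    rcases lt_or_ge (b - 1) γ with h | h
    · left
      rw [g_val hb1 h]
      exact arith hb1 hb2 h hγ'
    · have hn : ∀ z : ℂ, z ≠ 0 → 0 < FF b γ (ns z) := by
        intro z hz
        have hs : 0 < ns z := by rw [ns_eq]; have := norm_pos_iff.2 hz; positivity
        rw [FF_eq b γ hs.le]
        refine div_pos (mul_pos (by norm_num) ?_) (by positivity)
        have h1 : 0 < (b - 1) * ns z := mul_pos (by linarith) hs
        have h2 : 0 ≤ γ * ns z := by positivity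
        linarith
      have hg0 : ∫ z : ℂ, max (-FF b γ (ns z)) 0 = 0 := by
        have : ∀ z : ℂ, max (-FF b γ (ns z)) 0 = 0 := by
          intro z
          refine max_eq_right ?_
          by_cases hz : z = 0
          · subst hz
            have e0 : ns 0 = 0 := by simp [ns]
            rw [FF_eq b γ (ns_nonneg _), e0]
            norm_num
            linarith
          · have := hn z hz; linarith
        simp_rw [this]
        simp
      right
      rw [hg0]
      refine ⟨?_, hn⟩
      have := mul_le_mul_of_nonneg_left hb2 (by positivity : 0 ≤ 8 * π)
      linarith
  refine ⟨T Complex.I, by rw [T.norm_map, Complex.norm_I], fun x => ?_⟩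
  obtain ⟨z, rfl⟩ := T.surjective x
  rw [T.inner_map_map, ← T.map_smul, ← T.map_sub]
  have h1 : z - (2 * ⟪z, Complex.I⟫) • Complex.I = (starRingEnd ℂ) z := by
    apply Complex.ext <;> simp [Complex.inner] <;> ring
  rw [h1]
  have := key z
  simp only [hU] at this
  rw [nsc] at this
  simp only [hW] at this
  linarith

end Ons

/-- Even symmetry for the spherical Onsager vortex equation, planar form
(Theorem 1.11). -/
theorem onsager_even_symmetry (β γ : ℝ) (hβ : 8*π < β) (hβ' : β ≤ 16*π)
    (hγ : 0 ≤ γ)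
    (hγ' : γ ≤ 3 - β/(8*π) + Real.sqrt (2 * (3 - β/(8*π)) * (2 - β/(8*π))))
    (w : Pl → ℝ) (hw : ContDiff ℝ 2 w)
    (heq : ∀ x : Pl,
      lap w x + (8 * (1 + ‖x‖ ^ 2) ^ (-2 + β/(4*π)) * Real.exp (γ * (2/(1 + ‖x‖ ^ 2))))
        * Real.exp (w x) = 0)
    (hmass : ∫ x : Pl,
      (8 * (1 + ‖x‖ ^ 2) ^ (-2 + β/(4*π)) * Real.exp (γ * (2/(1 + ‖x‖ ^ 2))))
        * Real.exp (w x) = β)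
    (hbd : ∃ C : ℝ, ∀ x : Pl, |w x + (β/(4*π)) * Real.log (1 + ‖x‖ ^ 2)| ≤ C) :
    ∃ e : Pl, ‖e‖ = 1 ∧ ∀ x : Pl, w (x - (2 * ⟪x, e⟫) • e) = w x := by
  exact Ons.final β γ hβ hβ' hγ hγ' w hw heq hmass hbd
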